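/- arXiv:2210.11734 — 2 statements merged into one kernel-verified Lean document; each statement's English description precedes it below -/
import Mathlib

section
/- Let n ≥ 2 and let Ω ⊂ ℝⁿ be a bounded set of finite perimeter. Then H^{n−1}(∂Ω ∩ Ω⁰) = 0 if and only if there exists a sequence of bounded open sets E_k with smooth boundary such that Ω ⋐ E_k for every k (i.e. the closure of Ω is contained in E_k), E_k → Ω in L¹, and P(E_k) → P(Ω) as k → ∞. -/
open MeasureTheory Metric Filter Set
open scoped ENNReal Topology NNReal

noncomputable section

/-- The divergence of a vector field `φ : ℝⁿ → ℝⁿ`. -/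
def vdiv {n : ℕ} (φ : EuclideanSpace ℝ (Fin n) → EuclideanSpace ℝ (Fin n))
    (x : EuclideanSpace ℝ (Fin n)) : ℝ :=
  ∑ i, fderiv ℝ φ x (EuclideanSpace.single i 1) i

/-- The relative perimeter `P(E; W)` of a set `E` in an open set `W`, defined variationally as
`sup { ∫_E div φ : φ ∈ C¹_c(W; ℝⁿ), ‖φ‖_∞ ≤ 1 }`. -/
def relPerimeter {n : ℕ} (E W : Set (EuclideanSpace ℝ (Fin n))) : ℝ≥0∞ :=
  ⨆ (φ : EuclideanSpace ℝ (Fin n) → EuclideanSpace ℝ (Fin n)) (_ : ContDiff ℝ 1 φ)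
    (_ : HasCompactSupport φ) (_ : tsupport φ ⊆ W) (_ : ∀ x, ‖φ x‖ ≤ 1),
    ENNReal.ofReal (∫ x in E, vdiv φ x)

/-- The perimeter `P(E)` of a set `E ⊆ ℝⁿ`:
`P(E) = sup { ∫_E div φ : φ ∈ C¹_c(ℝⁿ; ℝⁿ), ‖φ‖_∞ ≤ 1 }`. -/
def perimeter {n : ℕ} (E : Set (EuclideanSpace ℝ (Fin n))) : ℝ≥0∞ :=
  relPerimeter E Set.univ

/-- The set of points where `Ω` has Lebesgue density `α`; `densityPts Ω 1` is the
measure-theoretic interior `Ω¹` and `densityPts Ω 0` is the measure-theoretic exterior `Ω⁰`. -/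
def densityPts {n : ℕ} (Ω : Set (EuclideanSpace ℝ (Fin n))) (α : ℝ≥0∞) :
    Set (EuclideanSpace ℝ (Fin n)) :=
  {x | Tendsto (fun r : ℝ => volume (Ω ∩ ball x r) / volume (ball x r)) (𝓝[>] 0) (𝓝 α)}

/-- A smooth set: a bounded open set whose topological boundary is a smooth hypersurface,
expressed via a smooth defining function with nonvanishing differential on the boundary. -/
def IsSmoothSet {n : ℕ} (E : Set (EuclideanSpace ℝ (Fin n))) : Prop :=
  IsOpen E ∧ Bornology.IsBounded E ∧
  ∃ f : EuclideanSpace ℝ (Fin n) → ℝ, ContDiff ℝ (⊤ : ℕ∞) f ∧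
    E = {x | f x < 0} ∧ frontier E = {x | f x = 0} ∧
    ∀ x ∈ frontier E, fderiv ℝ f x ≠ 0

/-- `E ⋐ Ω` : the closure of `E` is compact and contained in `Ω`. -/
def CpctContained {n : ℕ} (E Ω : Set (EuclideanSpace ℝ (Fin n))) : Prop :=
  IsCompact (closure E) ∧ closure E ⊆ Ω

/-- `E_k → Ω` in `L¹`, i.e. `|E_k Δ Ω| → 0`. -/
def TendstoL1 {n : ℕ} (E : ℕ → Set (EuclideanSpace ℝ (Fin n)))
    (Ω : Set (EuclideanSpace ℝ (Fin n))) : Prop :=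
  Tendsto (fun k => volume ((E k \ Ω) ∪ (Ω \ E k))) atTop (𝓝 0)

/-- The volume `ω_n` of the unit ball in ℝⁿ. -/
def unitBallVol (n : ℕ) : ℝ≥0∞ := volume (ball (0 : EuclideanSpace ℝ (Fin n)) 1)


/-! ### Test fields and basic facts on the perimeter -/

/-- Admissible test vector fields. -/
structure IsTest {n : ℕ} (φ : EuclideanSpace ℝ (Fin n) → EuclideanSpace ℝ (Fin n)) : Prop where
  smooth : ContDiff ℝ 1 φ
  cpt : HasCompactSupport φ
  le_one : ∀ x, ‖φ x‖ ≤ 1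

theorem IsTest.ofReal_le {n : ℕ} {φ : EuclideanSpace ℝ (Fin n) → EuclideanSpace ℝ (Fin n)}
    (h : IsTest φ) {E W : Set (EuclideanSpace ℝ (Fin n))} (hW : tsupport φ ⊆ W) :
    ENNReal.ofReal (∫ x in E, vdiv φ x) ≤ relPerimeter E W := by
  unfold relPerimeter
  refine le_trans ?_ (le_iSup _ φ)
  refine le_trans ?_ (le_iSup _ h.smooth)
  refine le_trans ?_ (le_iSup _ h.cpt)
  refine le_trans ?_ (le_iSup _ hW)
  exact le_iSup (fun _ : ∀ x, ‖φ x‖ ≤ 1 => ENNReal.ofReal (∫ x in E, vdiv φ x)) h.le_one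

theorem IsTest.le_toReal {n : ℕ} {φ : EuclideanSpace ℝ (Fin n) → EuclideanSpace ℝ (Fin n)}
    (h : IsTest φ) {E W : Set (EuclideanSpace ℝ (Fin n))} (hW : tsupport φ ⊆ W)
    (hf : relPerimeter E W ≠ ⊤) :
    ∫ x in E, vdiv φ x ≤ (relPerimeter E W).toReal :=
  (ENNReal.ofReal_le_iff_le_toReal hf).1 (h.ofReal_le hW)

theorem relPerimeter_le {n : ℕ} {E W : Set (EuclideanSpace ℝ (Fin n))} {c : ℝ}
    (h : ∀ φ : EuclideanSpace ℝ (Fin n) → EuclideanSpace ℝ (Fin n), IsTest φ → tsupport φ ⊆ W →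
      ∫ x in E, vdiv φ x ≤ c) : relPerimeter E W ≤ ENNReal.ofReal c := by
  unfold relPerimeter
  refine iSup_le fun φ => iSup_le fun h1 => iSup_le fun h2 => iSup_le fun h3 => iSup_le fun h4 => ?_
  exact ENNReal.ofReal_le_ofReal (h φ ⟨h1, h2, h4⟩ h3)

theorem exists_test {n : ℕ} (E W : Set (EuclideanSpace ℝ (Fin n)))
    {η : ℝ} (hη : 0 < η) :
    ∃ φ : EuclideanSpace ℝ (Fin n) → EuclideanSpace ℝ (Fin n), IsTest φ ∧ tsupport φ ⊆ W ∧
      (relPerimeter E W).toReal - η < ∫ x in E, vdiv φ x := by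
  by_contra! hcon
  have h0 : IsTest (fun _ : EuclideanSpace ℝ (Fin n) => (0 : EuclideanSpace ℝ (Fin n))) :=
    ⟨contDiff_const, HasCompactSupport.zero, by simp⟩
  have h1 : 0 ≤ (relPerimeter E W).toReal - η := by
    have := hcon _ h0 (by simp [tsupport])
    simpa [vdiv] using this
  have := relPerimeter_le hcon
  have h2 := ENNReal.toReal_mono ENNReal.ofReal_ne_top this
  rw [ENNReal.toReal_ofReal h1] at h2
  linarith

theorem relPerimeter_mono {n : ℕ} {E W W' : Set (EuclideanSpace ℝ (Fin n))} (h : W ⊆ W') :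
    relPerimeter E W ≤ relPerimeter E W' := by
  unfold relPerimeter
  refine iSup_mono fun φ => iSup_mono fun h1 => iSup_mono fun h2 => ?_
  refine iSup_le fun h3 => ?_
  exact le_iSup_of_le (h3.trans h) le_rfl

theorem continuous_vdiv {n : ℕ} {φ : EuclideanSpace ℝ (Fin n) → EuclideanSpace ℝ (Fin n)}
    (h : ContDiff ℝ 1 φ) : Continuous (vdiv φ) := by
  unfold vdiv
  have := h.continuous_fderiv (by norm_num)
  fun_prop

theorem vdiv_eq_zero {n : ℕ} {φ : EuclideanSpace ℝ (Fin n) → EuclideanSpace ℝ (Fin n)}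
    {x : EuclideanSpace ℝ (Fin n)} (h : x ∉ tsupport φ) : vdiv φ x = 0 := by
  have : fderiv ℝ φ x = 0 := by
    by_contra hc
    exact h (support_fderiv_subset ℝ (show x ∈ Function.support (fderiv ℝ φ) from hc))
  simp [vdiv, this]

theorem hasCompactSupport_vdiv {n : ℕ} {φ : EuclideanSpace ℝ (Fin n) → EuclideanSpace ℝ (Fin n)}
    (h : HasCompactSupport φ) : HasCompactSupport (vdiv φ) :=
  HasCompactSupport.intro h fun _ hx => vdiv_eq_zero hx

theorem integrable_vdiv {n : ℕ} {φ : EuclideanSpace ℝ (Fin n) → EuclideanSpace ℝ (Fin n)}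
    (h : ContDiff ℝ 1 φ) (hc : HasCompactSupport φ) : Integrable (vdiv φ) :=
  (continuous_vdiv h).integrable_of_hasCompactSupport (hasCompactSupport_vdiv hc)

theorem exists_bound_vdiv {n : ℕ} {φ : EuclideanSpace ℝ (Fin n) → EuclideanSpace ℝ (Fin n)}
    (h : ContDiff ℝ 1 φ) (hc : HasCompactSupport φ) : ∃ C : ℝ, 0 < C ∧ ∀ x, |vdiv φ x| ≤ C := by
  obtain ⟨C, hC⟩ := (continuous_vdiv h).bounded_above_of_compact_support (hasCompactSupport_vdiv hc)
  exact ⟨max C 1, by positivity, fun x => (hC x).trans (le_max_left _ _)⟩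

theorem vdiv_add {n : ℕ} {φ ψ : EuclideanSpace ℝ (Fin n) → EuclideanSpace ℝ (Fin n)}
    (hφ : ContDiff ℝ 1 φ) (hψ : ContDiff ℝ 1 ψ) (x : EuclideanSpace ℝ (Fin n)) :
    vdiv (fun y => φ y + ψ y) x = vdiv φ x + vdiv ψ x := by
  unfold vdiv
  rw [fderiv_fun_add (hφ.differentiable (by norm_num) x) (hψ.differentiable (by norm_num) x)]
  simp [Finset.sum_add_distrib]

theorem vdiv_smul {n : ℕ} {g : EuclideanSpace ℝ (Fin n) → ℝ}
    {φ : EuclideanSpace ℝ (Fin n) → EuclideanSpace ℝ (Fin n)}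
    (hg : ContDiff ℝ 1 g) (hφ : ContDiff ℝ 1 φ) (x : EuclideanSpace ℝ (Fin n)) :
    vdiv (fun y => g y • φ y) x = g x * vdiv φ x + fderiv ℝ g x (φ x) := by
  unfold vdiv
  rw [fderiv_fun_smul (hg.differentiable (by norm_num) x) (hφ.differentiable (by norm_num) x)]
  have : fderiv ℝ g x (φ x) = ∑ i, fderiv ℝ g x (EuclideanSpace.single i 1) * φ x i := by
    conv_lhs => rw [← (EuclideanSpace.basisFun (Fin n) ℝ).sum_repr (φ x)]
    simp [map_sum, mul_comm]
  rw [this, Finset.mul_sum, ← Finset.sum_add_distrib]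
  refine Finset.sum_congr rfl fun i _ => ?_
  simp [ContinuousLinearMap.smulRight_apply]

theorem integral_vdiv {n : ℕ} {φ : EuclideanSpace ℝ (Fin n) → EuclideanSpace ℝ (Fin n)}
    (h : ContDiff ℝ 1 φ) (hc : HasCompactSupport φ) : ∫ x, vdiv φ x = 0 := by
  unfold vdiv
  have hcont := h.continuous_fderiv (by norm_num)
  have key : ∀ i : Fin n, Integrable (fun x => fderiv ℝ φ x (EuclideanSpace.single i 1) i) := by
    intro i
    refine Continuous.integrable_of_hasCompactSupport (by fun_prop) ?_
    refine HasCompactSupport.intro hc fun x hx => ?_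
    have : fderiv ℝ φ x = 0 := by
      by_contra hc
      exact hx (support_fderiv_subset ℝ (show x ∈ Function.support (fderiv ℝ φ) from hc))
    simp [this]
  rw [integral_finsetSum _ fun i _ => key i]
  refine Finset.sum_eq_zero fun i _ => ?_
  have hpi : ContDiff ℝ 1 (fun x => φ x i) := by fun_prop
  have e : ∀ x, fderiv ℝ φ x (EuclideanSpace.single i 1) i
      = fderiv ℝ (fun x => φ x i) x (EuclideanSpace.single i 1) := by
    intro x
    have h1 : HasFDerivAt (fun x => φ x i)
        ((EuclideanSpace.proj i : EuclideanSpace ℝ (Fin n) →L[ℝ] ℝ).comp (fderiv ℝ φ x)) x :=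
      (EuclideanSpace.proj i : EuclideanSpace ℝ (Fin n) →L[ℝ] ℝ).hasFDerivAt.comp x
        (h.differentiable (by norm_num) x).hasFDerivAt
    rw [h1.fderiv]
    rfl
  have h2 : HasCompactSupport (fun x => φ x i) :=
    HasCompactSupport.intro hc fun x hx => by simp [image_eq_zero_of_notMem_tsupport hx]
  have := integral_mul_fderiv_eq_neg_fderiv_mul_of_integrable (μ := volume)
    (f := fun _ : EuclideanSpace ℝ (Fin n) => (1 : ℝ)) (g := fun x => φ x i)
    (v := EuclideanSpace.single i 1) (by simp) (by simpa [← e] using key i)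
    (by simpa using hpi.continuous.integrable_of_hasCompactSupport h2)
    (by simp) (fun x _ => hpi.differentiable (by norm_num) x)
  simp_rw [e]
  simpa using this

theorem integrable_fderiv_apply {n : ℕ} {g : EuclideanSpace ℝ (Fin n) → ℝ}
    {φ : EuclideanSpace ℝ (Fin n) → EuclideanSpace ℝ (Fin n)}
    (hg : ContDiff ℝ 1 g) (hφ : ContDiff ℝ 1 φ) (hc : HasCompactSupport φ) :
    Integrable (fun x => fderiv ℝ g x (φ x)) := by
  have hg' : Continuous (fderiv ℝ g) := hg.continuous_fderiv (by norm_num)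
  refine Continuous.integrable_of_hasCompactSupport (hg'.clm_apply hφ.continuous) ?_
  exact HasCompactSupport.intro hc fun x hx => by
    rw [image_eq_zero_of_notMem_tsupport hx, map_zero]

theorem integrable_mul_vdiv {n : ℕ} {g : EuclideanSpace ℝ (Fin n) → ℝ}
    {φ : EuclideanSpace ℝ (Fin n) → EuclideanSpace ℝ (Fin n)}
    (hg : Continuous g) (hφ : ContDiff ℝ 1 φ) (hc : HasCompactSupport φ) :
    Integrable (fun x => g x * vdiv φ x) := by
  have h2 : HasCompactSupport (fun x => g x * vdiv φ x) :=
    HasCompactSupport.intro hc fun x hx => by rw [vdiv_eq_zero hx, mul_zero]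
  exact (hg.mul (continuous_vdiv hφ)).integrable_of_hasCompactSupport h2

/-- Integration by parts. -/
theorem integral_mul_vdiv {n : ℕ} {g : EuclideanSpace ℝ (Fin n) → ℝ}
    {φ : EuclideanSpace ℝ (Fin n) → EuclideanSpace ℝ (Fin n)}
    (hg : ContDiff ℝ 1 g) (hφ : ContDiff ℝ 1 φ) (hc : HasCompactSupport φ) :
    ∫ x, g x * vdiv φ x = - ∫ x, fderiv ℝ g x (φ x) := by
  have h1 : ContDiff ℝ 1 (fun y => g y • φ y) := hg.smul hφ
  have h2 : HasCompactSupport (fun y => g y • φ y) := 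
    HasCompactSupport.intro hc fun x hx => by
      rw [image_eq_zero_of_notMem_tsupport hx, smul_zero]
  have h3 := integral_vdiv h1 h2
  have h4 : ∫ x, (g x * vdiv φ x + fderiv ℝ g x (φ x)) = 0 := by
    rw [← h3]
    exact integral_congr_ae (ae_of_all _ fun x => (vdiv_smul hg hφ x).symm)
  rw [integral_add (integrable_mul_vdiv hg.continuous hφ hc)
    (integrable_fderiv_apply hg hφ hc)] at h4
  linarith

theorem abs_fderiv_apply_le {n : ℕ} {g : EuclideanSpace ℝ (Fin n) → ℝ}
    {φ : EuclideanSpace ℝ (Fin n) → EuclideanSpace ℝ (Fin n)} (hφ : ∀ x, ‖φ x‖ ≤ 1)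
    (x : EuclideanSpace ℝ (Fin n)) : |fderiv ℝ g x (φ x)| ≤ ‖fderiv ℝ g x‖ := by
  calc |fderiv ℝ g x (φ x)| ≤ ‖fderiv ℝ g x‖ * ‖φ x‖ := (fderiv ℝ g x).le_opNorm _
    _ ≤ ‖fderiv ℝ g x‖ * 1 := by gcongr; exact hφ x
    _ = _ := mul_one _

/-- Selection of a point with small derivative. -/
theorem exists_deriv_le {M : ℝ → ℝ} {a b : ℝ} (hab : a < b) (hM : MonotoneOn M (Icc a b))
    {N : Set ℝ} (hN : volume N = 0) :
    ∃ t ∈ Ioo a b, t ∉ N ∧ DifferentiableAt ℝ M t ∧ deriv M t ≤ (M b - M a) / (b - a) := by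
  have hM' : MonotoneOn M (uIcc a b) := by rwa [uIcc_of_le hab.le]
  have hint := hM'.intervalIntegrable_deriv
  have hle : ∫ x in a..b, deriv M x ≤ M b - M a := by
    have h := hM'.intervalIntegral_deriv_mem_uIcc
    have hnn : 0 ≤ M b - M a := sub_nonneg.2 (hM (by simp [hab.le]) (by simp [hab.le]) hab.le)
    rw [uIcc_of_le hnn] at h
    exact h.2
  have hdiff : ∀ᵐ x, x ∈ Ioo a b → DifferentiableAt ℝ M x := by
    filter_upwards [hM.ae_differentiableWithinAt_of_mem] with x hx hxm
    exact (hx (Ioo_subset_Icc_self hxm)).differentiableAt (Icc_mem_nhds hxm.1 hxm.2)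
  by_contra! hcon
  have hlt : ∀ᵐ x, x ∈ Ioo a b → (M b - M a) / (b - a) < deriv M x := by
    filter_upwards [hdiff, measure_eq_zero_iff_ae_notMem.1 hN] with x hx hxN hxm
    exact hcon x hxm hxN (hx hxm)
  have h2 : (∫ x in a..b, (M b - M a) / (b - a)) < ∫ x in a..b, deriv M x := by
    refine intervalIntegral.integral_lt_integral_of_ae_le_of_measure_setOfPred_lt_ne_zero hab.le
      (by simp) hint ?_ ?_
    · rw [Measure.restrict_congr_set Ioo_ae_eq_Ioc.symm]
      filter_upwards [(ae_restrict_iff' measurableSet_Ioo).2 hlt] with x hx using hx.le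
    · rw [Measure.restrict_congr_set Ioo_ae_eq_Ioc.symm]
      intro h0
      have h3 : ∀ᵐ x ∂(volume.restrict (Ioo a b)), False := by
        filter_upwards [(ae_restrict_iff' measurableSet_Ioo).2 hlt,
          measure_eq_zero_iff_ae_notMem.1 h0] with x hx hx'
        exact hx' hx
      rw [ae_iff] at h3
      simp at h3
      linarith
  rw [intervalIntegral.integral_const, smul_eq_mul, mul_div_cancel₀ _ (by linarith)] at h2
  linarith


/-- Abbreviation for Euclidean space. -/
abbrev EE (n : ℕ) := EuclideanSpace ℝ (Fin n)

/-- A `C¹` one-dimensional cutoff with almost optimal slope. -/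
theorem exists_cutoff {a b κ : ℝ} (hab : a < b) (hκ : 0 < κ) :
    ∃ F : ℝ → ℝ, ContDiff ℝ 1 F ∧ (∀ y, y ≤ a → F y = 0) ∧ (∀ y, b ≤ y → F y = 1) ∧
      (∀ y, 0 ≤ F y) ∧ (∀ y, F y ≤ 1) ∧ (∀ y, 0 ≤ deriv F y) ∧
      (∀ y, deriv F y ≤ (1 + κ) / (b - a)) ∧ (∀ y, y ≤ a → deriv F y = 0) ∧
      (∀ y, b ≤ y → deriv F y = 0) := by
  set l : ℝ := κ / (2 * (1 + κ)) with hl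
  have hl0 : 0 < l := by positivity
  have hl1 : 1 - 2 * l = 1 / (1 + κ) := by rw [hl]; field_simp; ring
  have hba : 0 < b - a := by linarith
  set h : ℝ := (b - a) * l with hh
  have hh0 : 0 < h := by positivity
  set θ : ℝ → ℝ := fun y => max 0 (min 1 (min ((y - a) / h) ((b - y) / h))) with hθ
  have hθc : Continuous θ := by rw [hθ]; fun_prop
  have hθ0 : ∀ y, 0 ≤ θ y := fun y => le_max_left _ _
  have hθ1 : ∀ y, θ y ≤ 1 := fun y => max_le zero_le_one (min_le_left _ _)
  have hθa : ∀ y, y ≤ a → θ y = 0 := by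
    intro y hy
    refine max_eq_left ((min_le_right _ _).trans ((min_le_left _ _).trans ?_))
    exact div_nonpos_of_nonpos_of_nonneg (by linarith) hh0.le
  have hθb : ∀ y, b ≤ y → θ y = 0 := by
    intro y hy
    refine max_eq_left ((min_le_right _ _).trans ((min_le_right _ _).trans ?_))
    exact div_nonpos_of_nonpos_of_nonneg (by linarith) hh0.le
  have hθm : ∀ y ∈ Icc (a + h) (b - h), 1 ≤ θ y := by
    intro y hy
    refine le_max_of_le_right (le_min le_rfl (le_min ?_ ?_))
    · rw [le_div_iff₀ hh0]; linarith [hy.1]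
    · rw [le_div_iff₀ hh0]; linarith [hy.2]
  set ψ : ℝ → ℝ := fun y => ∫ s in a..y, θ s with hψ
  have hii : ∀ c d, IntervalIntegrable θ volume c d := fun c d => hθc.intervalIntegrable _ _
  have hder : ∀ y, HasDerivAt ψ (θ y) y := fun y =>
    intervalIntegral.integral_hasDerivAt_right (hii _ _)
      (hθc.stronglyMeasurableAtFilter _ _) hθc.continuousAt
  have hsum : ∀ c d, ψ d = ψ c + ∫ s in c..d, θ s := by
    intro c d
    rw [hψ]; exact (intervalIntegral.integral_add_adjacent_intervals (hii _ _) (hii _ _)).symm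
  have hmono : ∀ c d, c ≤ d → ψ c ≤ ψ d := by
    intro c d hcd
    rw [hsum c d]
    have := intervalIntegral.integral_nonneg (μ := volume) hcd fun u _ => hθ0 u
    linarith
  have hψa : ψ a = 0 := by simp [hψ]
  have hψa' : ∀ y, y ≤ a → ψ y = 0 := by
    intro y hy
    have h1 : ∫ s in y..a, θ s = ∫ s in y..a, (0 : ℝ) :=
      intervalIntegral.integral_congr fun s hs => by
        rw [uIcc_of_le hy] at hs; exact hθa s hs.2
    have h2 := hsum y a
    rw [h1, hψa] at h2
    simp at h2; linarith
  have hψb' : ∀ y, b ≤ y → ψ y = ψ b := by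
    intro y hy
    have h1 : ∫ s in b..y, θ s = ∫ s in b..y, (0 : ℝ) :=
      intervalIntegral.integral_congr fun s hs => by
        rw [uIcc_of_le hy] at hs; exact hθb s hs.1
    rw [hsum b y, h1]; simp
  have hlt : a + h ≤ b - h := by
    have : 0 < (b - a) * (1 - 2 * l) := by rw [hl1]; positivity
    rw [hh]; nlinarith
  have hψb : (b - a) / (1 + κ) ≤ ψ b := by
    have h1 : ψ (b - h) = ψ (a + h) + ∫ s in (a + h)..(b - h), θ s := hsum _ _
    have h2 : ∫ s in (a + h)..(b - h), (1 : ℝ) ≤ ∫ s in (a + h)..(b - h), θ s :=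
      intervalIntegral.integral_mono_on hlt (by simp) (hii _ _) hθm
    have h3 := hmono a (a + h) (by linarith)
    have h4 := hmono (b - h) b (by linarith)
    simp only [intervalIntegral.integral_const, smul_eq_mul, mul_one] at h2
    have h5 : (b - a) / (1 + κ) = (b - a) * (1 - 2 * l) := by rw [hl1]; ring
    rw [h5, hh] at *
    nlinarith
  have hψbpos : 0 < ψ b := lt_of_lt_of_le (by positivity) hψb
  have hF : ∀ y, HasDerivAt (fun y => ψ y / ψ b) (θ y / ψ b) y := fun y => (hder y).div_const _
  have hF' : deriv (fun y => ψ y / ψ b) = fun y => θ y / ψ b := funext fun y => (hF y).deriv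
  refine ⟨fun y => ψ y / ψ b, ?_, ?_, ?_, ?_, ?_, ?_, ?_, ?_, ?_⟩
  · rw [contDiff_one_iff_deriv]
    refine ⟨fun y => (hF y).differentiableAt, ?_⟩
    rw [hF']
    exact hθc.div_const _
  · intro y hy; simp [hψa' y hy]
  · intro y hy; simp only []; rw [hψb' y hy, div_self hψbpos.ne']
  · intro y
    refine div_nonneg ?_ hψbpos.le
    rcases le_total y a with hy | hy
    · rw [hψa' y hy]
    · rw [← hψa]; exact hmono _ _ hy
  · intro y
    rw [div_le_one hψbpos]
    rcases le_total y b with hy | hy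
    · exact hmono _ _ hy
    · rw [hψb' y hy]
  · intro y; rw [hF']; exact div_nonneg (hθ0 y) hψbpos.le
  · intro y; rw [hF']
    calc θ y / ψ b ≤ 1 / ((b - a) / (1 + κ)) := by
          gcongr; exact hθ1 y
      _ = _ := by field_simp
  · intro y hy; rw [hF']; simp [hθa y hy]
  · intro y hy; rw [hF']; simp [hθb y hy]

theorem abs_setIntegral_sub_le {n : ℕ} {A B : Set (EE n)} (hA : MeasurableSet A)
    (hB : MeasurableSet B) {f : EE n → ℝ} (hf : Integrable f) {C δ : ℝ} (hC : ∀ x, |f x| ≤ C)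
    (hδ : 0 ≤ δ) (h : volume ((A \ B) ∪ (B \ A)) ≤ ENNReal.ofReal δ) :
    |(∫ x in A, f x) - ∫ x in B, f x| ≤ C * δ := by
  have hfin : volume ((A \ B) ∪ (B \ A)) ≠ ⊤ := (h.trans_lt ENNReal.ofReal_lt_top).ne
  have hC0 : 0 ≤ C := (abs_nonneg _).trans (hC 0)
  rw [← integral_indicator hA, ← integral_indicator hB,
    ← integral_sub (hf.indicator hA) (hf.indicator hB)]
  have hS : MeasurableSet ((A \ B) ∪ (B \ A)) := (hA.diff hB).union (hB.diff hA)
  have e : ∀ x, A.indicator f x - B.indicator f x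
      = ((A \ B) ∪ (B \ A)).indicator (fun x => A.indicator f x - B.indicator f x) x := by
    intro x
    by_cases h1 : x ∈ A <;> by_cases h2 : x ∈ B <;> simp [h1, h2]
  rw [integral_congr_ae (ae_of_all _ e), integral_indicator hS]
  have := norm_setIntegral_le_of_norm_le_const (μ := volume) (C := C) hfin.lt_top
    (f := fun x => A.indicator f x - B.indicator f x) (s := (A \ B) ∪ (B \ A)) ?_
  · refine this.trans ?_
    gcongr
    exact ENNReal.toReal_le_of_le_ofReal hδ h
  · intro x hx
    rcases hx with hx | hx
    · simpa [hx.1, hx.2] using hC x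
    · simpa [hx.1, hx.2] using hC x

/-- Lower semicontinuity of the perimeter. -/
theorem perimeter_lsc {n : ℕ} {Ω : Set (EE n)} (hm : MeasurableSet Ω) {η : ℝ} (hη : 0 < η) :
    ∃ δ : ℝ, 0 < δ ∧ ∀ E : Set (EE n), MeasurableSet E →
      volume ((E \ Ω) ∪ (Ω \ E)) ≤ ENNReal.ofReal δ → perimeter E ≠ ⊤ →
      (perimeter Ω).toReal - η ≤ (perimeter E).toReal := by
  obtain ⟨φ, hφ, hs, hlt⟩ := exists_test Ω univ (half_pos hη)
  obtain ⟨C, hC0, hC⟩ := exists_bound_vdiv hφ.smooth hφ.cpt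
  refine ⟨η / 2 / C, by positivity, fun E hE hvol hfin => ?_⟩
  have h1 := abs_setIntegral_sub_le hE hm (integrable_vdiv hφ.smooth hφ.cpt) hC
    (by positivity) hvol
  have h2 := hφ.le_toReal hs hfin
  have h3 : C * (η / 2 / C) = η / 2 := by field_simp
  rw [h3] at h1
  have := (abs_le.1 h1).1
  unfold perimeter at *
  linarith

/-- If `∫ u div φ ≤ c` for all test fields, then the total variation of `u` is at most `c`. -/
theorem integral_norm_fderiv_le {n : ℕ} {u : EE n → ℝ} (hu : ContDiff ℝ 2 u)
    (hc : HasCompactSupport u) {c : ℝ}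
    (h : ∀ φ : EE n → EE n, IsTest φ → ∫ x, u x * vdiv φ x ≤ c) :
    ∫ x, ‖fderiv ℝ u x‖ ≤ c := by
  have hu1 : ContDiff ℝ 1 u := hu.of_le (by norm_num)
  have hDu : ContDiff ℝ 1 (fderiv ℝ u) := hu.fderiv_right (m := 1) (by norm_num)
  set L := (InnerProductSpace.toDual ℝ (EE n)).symm with hL
  set G : EE n → EE n := fun x => L (fderiv ℝ u x) with hG
  have hGn : ∀ x, ‖G x‖ = ‖fderiv ℝ u x‖ := fun x => LinearIsometryEquiv.norm_map _ _
  have hGs : ContDiff ℝ 1 G := L.toContinuousLinearEquiv.contDiff.comp hDu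
  have hGa : ∀ x, fderiv ℝ u x (G x) = ‖G x‖ ^ 2 := by
    intro x
    have : inner ℝ (G x) (G x) = fderiv ℝ u x (G x) :=
      InnerProductSpace.toDual_symm_apply
    rw [← this, real_inner_self_eq_norm_sq]
  have hGc : ∀ x, x ∉ tsupport u → G x = 0 := by
    intro x hx
    have : fderiv ℝ u x = 0 := by
      by_contra hc
      exact hx (support_fderiv_subset ℝ (show x ∈ Function.support (fderiv ℝ u) from hc))
    rw [hG]; simp [this]
  have hint : Integrable (fun x => ‖fderiv ℝ u x‖) := by
    refine Continuous.integrable_of_hasCompactSupport hDu.continuous.norm ?_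
    exact HasCompactSupport.intro hc fun x hx => by rw [← hGn, hGc x hx, norm_zero]
  set K := tsupport u with hK
  have hKf : volume K ≠ ⊤ := hc.measure_lt_top.ne
  have main : ∀ κ : ℝ, 0 < κ → ∫ x, ‖fderiv ℝ u x‖ ≤ c + κ * volume.real K := by
    intro κ hκ
    set q : EE n → ℝ := fun x => -(√(‖G x‖ ^ 2 + κ ^ 2))⁻¹ with hq
    have hpos : ∀ x, 0 < √(‖G x‖ ^ 2 + κ ^ 2) := fun x => Real.sqrt_pos.2 (by positivity)
    have hqs : ContDiff ℝ 1 q := by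
      refine ContDiff.neg (ContDiff.inv ?_ fun x => (hpos x).ne')
      exact ((hGs.norm_sq ℝ).add contDiff_const).sqrt fun x => by positivity
    have hφ : IsTest (fun x => q x • G x) := by
      refine ⟨hqs.smul hGs, HasCompactSupport.intro hc fun x hx => ?_, fun x => ?_⟩
      · rw [hGc x hx, smul_zero]
      · rw [norm_smul, hq, norm_neg, norm_inv, Real.norm_of_nonneg (hpos x).le,
          inv_mul_le_one₀ (hpos x)]
        exact Real.le_sqrt_of_sq_le (by nlinarith)
    have h1 := h _ hφ
    rw [integral_mul_vdiv hu1 hφ.smooth hφ.cpt, ← integral_neg] at h1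
    have h2 : ∫ x, (‖fderiv ℝ u x‖ - K.indicator (fun _ => κ) x) ≤
        ∫ x, -(fderiv ℝ u x) (q x • G x) := by
      refine integral_mono (hint.sub ?_) (integrable_fderiv_apply hu1 hφ.smooth hφ.cpt).neg
        fun x => ?_
      · exact (integrable_indicator_iff hc.measurableSet).2 (integrableOn_const hKf)
      · simp only [map_smul, hGa, smul_eq_mul]
        by_cases hx : x ∈ K
        · rw [indicator_of_mem hx, ← hGn, hq]
          simp only []
          have h5 : √(‖G x‖ ^ 2 + κ ^ 2) ≤ ‖G x‖ + κ := by
            refine Real.sqrt_le_iff.2 ⟨by positivity, ?_⟩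
            nlinarith [norm_nonneg (G x)]
          have h6 : -(-(√(‖G x‖ ^ 2 + κ ^ 2))⁻¹ * ‖G x‖ ^ 2) = ‖G x‖ ^ 2 / √(‖G x‖ ^ 2 + κ ^ 2) := by
            field_simp
          rw [h6, le_div_iff₀ (hpos x)]
          rcases le_total (‖G x‖) κ with h7 | h7
          · nlinarith [(hpos x), norm_nonneg (G x)]
          · nlinarith [(hpos x), norm_nonneg (G x)]
        · rw [indicator_of_notMem hx, ← hGn, hGc x hx]; simp
    rw [integral_sub hint ((integrable_indicator_iff hc.measurableSet).2
      (integrableOn_const hKf)), integral_indicator hc.measurableSet, setIntegral_const,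
      smul_eq_mul] at h2
    linarith
  refine le_of_forall_pos_le_add fun e he => ?_
  have := main (e / (volume.real K + 1)) (by positivity)
  refine this.trans ?_
  gcongr
  rw [div_mul_eq_mul_div, div_le_iff₀ (by positivity)]
  nlinarith [measureReal_nonneg (μ := (volume : Measure (EE n))) (s := K)]


open scoped Convolution in
/-- Mollification of the indicator function of a set. -/
def moll {n : ℕ} (ρ : ContDiffBump (0 : EE n)) (Ω : Set (EE n)) : EE n → ℝ :=
  (ρ.normed volume) ⋆[ContinuousLinearMap.lsmul ℝ ℝ, volume] (Ω.indicator fun _ => (1 : ℝ))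

theorem moll_apply {n : ℕ} (ρ : ContDiffBump (0 : EE n)) (Ω : Set (EE n)) (x : EE n) :
    moll ρ Ω x = ∫ t, ρ.normed volume t * Ω.indicator (fun _ => (1 : ℝ)) (x - t) := rfl

theorem integrable_indicator_one {n : ℕ} {Ω : Set (EE n)} (hm : MeasurableSet Ω)
    (hb : Bornology.IsBounded Ω) : Integrable (Ω.indicator fun _ => (1 : ℝ)) :=
  (integrable_indicator_iff hm).2 (integrableOn_const hb.measure_lt_top.ne)

theorem moll_contDiff {n : ℕ} (ρ : ContDiffBump (0 : EE n)) {Ω : Set (EE n)}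
    (hm : MeasurableSet Ω) (hb : Bornology.IsBounded Ω) :
    ContDiff ℝ (⊤ : ℕ∞) (moll ρ Ω) := by
  refine HasCompactSupport.contDiff_convolution_left _ ρ.hasCompactSupport_normed
    ρ.contDiff_normed ?_
  exact (integrable_indicator_one hm hb).locallyIntegrable

theorem moll_cpt {n : ℕ} (ρ : ContDiffBump (0 : EE n)) {Ω : Set (EE n)}
    (hb : Bornology.IsBounded Ω) : HasCompactSupport (moll ρ Ω) := by
  refine HasCompactSupport.convolution _ ρ.hasCompactSupport_normed ?_
  exact HasCompactSupport.intro hb.isCompact_closure fun x hx => by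
    exact indicator_of_notMem (fun h => hx (subset_closure h)) _

theorem indicator_one_nonneg {n : ℕ} (Ω : Set (EE n)) (x : EE n) :
    0 ≤ Ω.indicator (fun _ => (1 : ℝ)) x := indicator_nonneg (fun _ _ => zero_le_one) _

theorem indicator_one_le {n : ℕ} (Ω : Set (EE n)) (x : EE n) :
    Ω.indicator (fun _ => (1 : ℝ)) x ≤ 1 := indicator_le_self' (fun _ _ => zero_le_one) x

theorem moll_nonneg {n : ℕ} (ρ : ContDiffBump (0 : EE n)) (Ω : Set (EE n)) (x : EE n) :
    0 ≤ moll ρ Ω x := by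
  rw [moll_apply]
  exact integral_nonneg fun t => mul_nonneg (ρ.nonneg_normed t) (indicator_one_nonneg _ _)

theorem integrable_normed {n : ℕ} (ρ : ContDiffBump (0 : EE n)) :
    Integrable (ρ.normed (volume : Measure (EE n))) :=
  ρ.continuous_normed.integrable_of_hasCompactSupport ρ.hasCompactSupport_normed

theorem integrable_moll_integrand {n : ℕ} (ρ : ContDiffBump (0 : EE n)) {Ω : Set (EE n)}
    (hm : MeasurableSet Ω) (x : EE n) :
    Integrable (fun t => ρ.normed volume t * Ω.indicator (fun _ => (1 : ℝ)) (x - t)) := by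
  refine (integrable_normed ρ).mul_bdd (c := 1) ?_ (ae_of_all _ fun t => ?_)
  · exact ((measurable_const.indicator hm).comp (measurable_const.sub measurable_id)).aestronglyMeasurable
  · rw [Real.norm_of_nonneg (indicator_one_nonneg _ _)]; exact indicator_one_le _ _

theorem moll_le_one {n : ℕ} (ρ : ContDiffBump (0 : EE n)) {Ω : Set (EE n)}
    (hm : MeasurableSet Ω) (x : EE n) : moll ρ Ω x ≤ 1 := by
  rw [moll_apply]
  refine le_trans ?_ (ρ.integral_normed (μ := volume)).le
  refine integral_mono (integrable_moll_integrand ρ hm x) (integrable_normed ρ) fun t => ?_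
  exact mul_le_of_le_one_right (ρ.nonneg_normed t) (indicator_one_le _ _)

theorem moll_lower {n : ℕ} (ρ : ContDiffBump (0 : EE n)) {Ω : Set (EE n)}
    (hm : MeasurableSet Ω) (x : EE n) :
    volume.real (Ω ∩ ball x ρ.rIn) ≤ moll ρ Ω x * volume.real (ball (0 : EE n) ρ.rOut) := by
  have hI : 0 < ∫ t, ρ t := ρ.integral_pos
  have hfin : volume (ball (0 : EE n) ρ.rOut) ≠ ⊤ := measure_ball_lt_top.ne
  have h1 : ∫ t, ρ t ≤ volume.real (ball (0 : EE n) ρ.rOut) := by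
    calc ∫ t, ρ t ≤ ∫ t, (ball (0 : EE n) ρ.rOut).indicator (fun _ => (1 : ℝ)) t := by
          refine integral_mono ρ.integrable ?_ fun t => ?_
          · exact integrable_indicator_one measurableSet_ball isBounded_ball
          · by_cases ht : t ∈ ball (0 : EE n) ρ.rOut
            · rw [indicator_of_mem ht]; exact ρ.le_one
            · rw [indicator_of_notMem ht]
              refine (ρ.zero_of_le_dist ?_).le
              simpa using ht
      _ = _ := by rw [integral_indicator measurableSet_ball]; simp
  have hS : MeasurableSet ((fun t => x - t) ⁻¹' (Ω ∩ ball x ρ.rIn)) :=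
    (measurable_const.sub measurable_id) (hm.inter measurableSet_ball)
  have h2 : volume.real (Ω ∩ ball x ρ.rIn) / (∫ t, ρ t) ≤ moll ρ Ω x := by
    have h3 : ∫ t, ((fun t => x - t) ⁻¹' (Ω ∩ ball x ρ.rIn)).indicator
        (fun _ => (∫ t, ρ t)⁻¹) t ≤ moll ρ Ω x := by
      rw [moll_apply]
      refine integral_mono ?_ (integrable_moll_integrand ρ hm x) fun t => ?_
      · refine (integrable_indicator_iff hS).2 (integrableOn_const ?_)
        rw [(Measure.measurePreserving_sub_left volume x).measure_preimage
          (hm.inter measurableSet_ball).nullMeasurableSet]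
        exact (measure_mono inter_subset_right).trans_lt measure_ball_lt_top |>.ne
      · by_cases ht : x - t ∈ Ω ∩ ball x ρ.rIn
        · rw [indicator_of_mem (by exact ht), indicator_of_mem ht.1, mul_one, ρ.normed_def,
            ρ.one_of_mem_closedBall, one_div]
          have := ht.2
          rw [mem_ball, dist_eq_norm] at this
          simp only [sub_sub_cancel_left, norm_neg] at this
          simpa using this.le
        · rw [indicator_of_notMem (by exact ht)]
          exact mul_nonneg (ρ.nonneg_normed t) (indicator_one_nonneg _ _)
    rw [integral_indicator hS, setIntegral_const, smul_eq_mul, measureReal_def,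
      (Measure.measurePreserving_sub_left volume x).measure_preimage
          (hm.inter measurableSet_ball).nullMeasurableSet] at h3
    exact h3
  rw [div_le_iff₀ hI] at h2
  exact h2.trans (mul_le_mul_of_nonneg_left h1 (moll_nonneg _ _ _))

theorem vdiv_translate {n : ℕ} (φ : EE n → EE n) (t x : EE n) :
    vdiv (fun y => φ (y + t)) x = vdiv φ (x + t) := by
  unfold vdiv
  rw [fderiv_comp_add_right]

theorem moll_test {n : ℕ} (ρ : ContDiffBump (0 : EE n)) {Ω : Set (EE n)}
    (hm : MeasurableSet Ω) (hP : perimeter Ω ≠ ⊤)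
    {φ : EE n → EE n} (hφ : IsTest φ) :
    ∫ x, moll ρ Ω x * vdiv φ x ≤ (perimeter Ω).toReal := by
  have hsw : Integrable (Function.uncurry fun x t =>
      ρ.normed volume t * Ω.indicator (fun _ => (1 : ℝ)) (x - t) * vdiv φ x)
      (volume.prod volume) := by
    have h1 : Integrable (fun z : EE n × EE n => vdiv φ z.1 * ρ.normed volume z.2)
        (volume.prod volume) :=
      (integrable_vdiv hφ.smooth hφ.cpt).mul_prod (integrable_normed ρ)
    have h2 := h1.mul_bdd (c := 1) (g := fun z : EE n × EE n => Ω.indicator (fun _ => (1 : ℝ)) (z.1 - z.2))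
      ((measurable_const.indicator hm).comp (measurable_fst.sub measurable_snd)).aestronglyMeasurable
      (ae_of_all _ fun z => by
        rw [Real.norm_of_nonneg (indicator_one_nonneg _ _)]; exact indicator_one_le _ _)
    refine h2.congr (ae_of_all _ fun z => ?_)
    simp only [Function.uncurry]
    ring
  have e1 : ∫ x, moll ρ Ω x * vdiv φ x = ∫ x, ∫ t,
      ρ.normed volume t * Ω.indicator (fun _ => (1 : ℝ)) (x - t) * vdiv φ x := by
    refine integral_congr_ae (ae_of_all _ fun x => ?_)
    simp only []
    rw [moll_apply, integral_mul_const]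
  rw [e1, integral_integral_swap hsw]
  have e2 : ∀ t, ∫ x, ρ.normed volume t * Ω.indicator (fun _ => (1 : ℝ)) (x - t) * vdiv φ x
      ≤ ρ.normed volume t * (perimeter Ω).toReal := by
    intro t
    simp_rw [mul_assoc]
    rw [integral_const_mul]
    refine mul_le_mul_of_nonneg_left ?_ (ρ.nonneg_normed t)
    have h1 := integral_add_right_eq_self (μ := volume)
      (fun x => Ω.indicator (fun _ => (1 : ℝ)) (x - t) * vdiv φ x) t
    rw [← h1]
    have hφt : IsTest (fun y => φ (y + t)) := by
      refine ⟨hφ.smooth.comp (contDiff_id.add contDiff_const), ?_, fun x => hφ.le_one _⟩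
      exact hφ.cpt.comp_homeomorph (Homeomorph.addRight t)
    have h2 := hφt.le_toReal (E := Ω) (W := univ) (subset_univ _) hP
    rw [← integral_indicator hm] at h2
    refine le_trans (le_of_eq ?_) h2
    refine integral_congr_ae (ae_of_all _ fun x => ?_)
    simp only [add_sub_cancel_right]
    by_cases hx : x ∈ Ω <;> simp [hx, vdiv_translate]
  calc _ ≤ ∫ t, ρ.normed volume t * (perimeter Ω).toReal :=
        integral_mono hsw.integral_prod_right ((integrable_normed ρ).mul_const _) e2
    _ = _ := by rw [integral_mul_const, ρ.integral_normed, one_mul]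

theorem moll_L1 {n : ℕ} {Ω : Set (EE n)} (hm : MeasurableSet Ω) (hb : Bornology.IsBounded Ω)
    {η : ℝ} (hη : 0 < η) : ∃ δ : ℝ, 0 < δ ∧ ∀ ρ : ContDiffBump (0 : EE n),
      ρ.rOut ≤ 2 * ρ.rIn → ρ.rOut < δ →
      ∫ x, |moll ρ Ω x - Ω.indicator (fun _ => (1 : ℝ)) x| < η := by
  set l : Filter (ContDiffBump (0 : EE n)) :=
    comap (fun ρ => ρ.rOut) (𝓝 0) ⊓ 𝓟 {ρ | ρ.rOut ≤ 2 * ρ.rIn} with hl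
  have h1 : Tendsto (fun ρ : ContDiffBump (0 : EE n) => ρ.rOut) l (𝓝 0) :=
    tendsto_comap.mono_left inf_le_left
  have h2 : ∀ᶠ ρ in l, ρ.rOut ≤ 2 * ρ.rIn := by
    rw [hl]; exact mem_inf_of_right (mem_principal_self _)
  have hae := ContDiffBump.ae_convolution_tendsto_right_of_locallyIntegrable (μ := volume) h1 h2
    (integrable_indicator_one hm hb).locallyIntegrable
  obtain ⟨R, hR⟩ := hb.subset_closedBall 0
  have ht : Tendsto (fun ρ => ∫ x, |moll ρ Ω x - Ω.indicator (fun _ => (1 : ℝ)) x|) l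
      (𝓝 (∫ _ : EE n, (0 : ℝ))) := by
    refine tendsto_integral_filter_of_dominated_convergence
      ((closedBall (0 : EE n) (R + 1)).indicator fun _ => (1 : ℝ)) ?_ ?_ ?_ ?_
    · refine Eventually.of_forall fun ρ => ?_
      exact ((moll_contDiff ρ hm hb).continuous.aestronglyMeasurable.sub
        (integrable_indicator_one hm hb).aestronglyMeasurable).norm
    · filter_upwards [h1.eventually (gt_mem_nhds zero_lt_one)] with ρ hρ
      refine ae_of_all _ fun x => ?_
      rw [Real.norm_of_nonneg (abs_nonneg _)]
      by_cases hx : x ∈ closedBall (0 : EE n) (R + 1)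
      · rw [indicator_of_mem hx, abs_le]
        constructor
        · linarith [moll_nonneg ρ Ω x, indicator_one_le Ω x]
        · linarith [moll_le_one ρ hm x, indicator_one_nonneg Ω x]
      · have hx1 : x ∉ Ω := fun h => hx (closedBall_subset_closedBall (by linarith) (hR h))
        have : moll ρ Ω x = 0 := by
          rw [moll_apply]
          refine integral_eq_zero_of_ae (ae_of_all _ fun t => ?_)
          simp only [Pi.zero_apply]
          by_cases ht : t ∈ ball (0 : EE n) ρ.rOut
          · rw [indicator_of_notMem, mul_zero]
            intro h
            apply hx
            have h4 := hR h
            simp only [mem_closedBall, dist_zero_right, mem_ball] at *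
            calc ‖x‖ = ‖(x - t) + t‖ := by simp
              _ ≤ ‖x - t‖ + ‖t‖ := norm_add_le _ _
              _ ≤ R + 1 := by linarith
          · have : ρ.normed volume t = 0 := by
              by_contra h
              exact ht (by rw [← ρ.support_normed_eq (μ := volume)]; exact h)
            rw [this, zero_mul]
        rw [indicator_of_notMem hx, indicator_of_notMem hx1, this]; simp
    · exact integrable_indicator_one measurableSet_closedBall isBounded_closedBall
    · filter_upwards [hae] with x hx
      have := (hx.sub_const (Ω.indicator (fun _ => (1 : ℝ)) x)).abs
      rw [sub_self, abs_zero] at this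
      exact this
  rw [integral_zero] at ht
  have hev := ht.eventually (gt_mem_nhds hη)
  rw [hl, eventually_inf_principal, eventually_comap] at hev
  obtain ⟨δ, hδ, h⟩ := Metric.eventually_nhds_iff.1 hev
  refine ⟨δ, hδ, fun ρ hρ hρ' => h ?_ ρ rfl hρ⟩
  rw [dist_zero_right, Real.norm_of_nonneg ρ.rOut_pos.le]; exact hρ'

/-- Summary of the properties of mollifications. -/
theorem exists_moll {n : ℕ} {Ω : Set (EE n)} (hm : MeasurableSet Ω) (hb : Bornology.IsBounded Ω)
    (hP : perimeter Ω ≠ ⊤) {η : ℝ} (hη : 0 < η) :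
    ∃ δ : ℝ, 0 < δ ∧ ∀ ε : ℝ, 0 < ε → ε < δ → ∃ u : EE n → ℝ, ContDiff ℝ (⊤ : ℕ∞) u ∧
      HasCompactSupport u ∧ ∫ x, ‖fderiv ℝ u x‖ ≤ (perimeter Ω).toReal ∧
      ∫ x, |u x - Ω.indicator (fun _ => (1 : ℝ)) x| < η ∧ (∀ x, 0 ≤ u x) ∧
      ∀ x, volume.real (Ω ∩ ball x ε) ≤ u x * volume.real (ball (0 : EE n) (2 * ε)) := by
  obtain ⟨δ, hδ, h⟩ := moll_L1 hm hb hη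
  refine ⟨δ / 2, by positivity, fun ε h0 h1 => ?_⟩
  set ρ : ContDiffBump (0 : EE n) := ⟨ε, 2 * ε, h0, by linarith⟩ with hρ
  refine ⟨moll ρ Ω, moll_contDiff ρ hm hb, moll_cpt ρ hb, ?_, ?_, moll_nonneg ρ Ω, ?_⟩
  · refine integral_norm_fderiv_le ((moll_contDiff ρ hm hb).of_le ?_) (moll_cpt ρ hb)
      fun φ hφ => moll_test ρ hm hP hφ
    exact WithTop.coe_le_coe.2 le_top
  · exact h ρ le_rfl (by simp only [hρ]; linarith)
  · exact moll_lower ρ hm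


/-- Isoperimetric inequality (with a non-sharp constant). -/
theorem exists_isoperimetric (n : ℕ) (hn : 2 ≤ n) : ∃ C : ℝ, 0 < C ∧ ∀ E : Set (EE n),
    MeasurableSet E → Bornology.IsBounded E → perimeter E ≠ ⊤ →
    (volume.real E ^ (1 / (n : ℝ))) ^ (n - 1) ≤ C * (perimeter E).toReal := by
  have hn' : (2 : ℝ) ≤ n := by exact_mod_cast hn
  set p : ℝ := Real.conjExponent n with hp
  have hconj : Real.HolderConjugate (n : ℝ) p := Real.HolderConjugate.conjExponent (by linarith)
  have hconj' : Real.HolderConjugate (Module.finrank ℝ (EE n) : ℝ) p := by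
    simpa using hconj
  have hp0 : 0 < p := hconj.symm.pos
  set K : ℝ≥0 := lintegralPowLePowLIntegralFDerivConst (volume : Measure (EE n)) p with hK
  set A : ℝ := 2 ^ p * (K + 1) with hA
  have hA0 : 0 < A := by positivity
  refine ⟨A ^ (1 / p), by positivity, fun E hE hb hP => ?_⟩
  set P := (perimeter E).toReal with hPdef
  have hP0 : 0 ≤ P := ENNReal.toReal_nonneg
  have key : ∀ η : ℝ, 0 < η → volume.real E ≤ A * P ^ p + 2 * η := by
    intro η hη
    obtain ⟨δ, hδ, h⟩ := exists_moll hE hb hP hη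
    obtain ⟨u, hu, huc, hDu, hL1, hu0, -⟩ := h (δ / 2) (by positivity) (by linarith)
    have hu1 : ContDiff ℝ 1 u := hu.of_le (WithTop.coe_le_coe.2 le_top)
    have hsob := lintegral_pow_le_pow_lintegral_fderiv (volume : Measure (EE n)) hu1 huc hconj'
    have hDint : Integrable (fun x => ‖fderiv ℝ u x‖) := by
      refine Continuous.integrable_of_hasCompactSupport
        (hu1.continuous_fderiv (by norm_num)).norm ?_
      exact (huc.fderiv ℝ).norm
    have h1 : ∫⁻ x, ‖fderiv ℝ u x‖ₑ ≤ ENNReal.ofReal P := by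
      have : ∫⁻ x, ‖fderiv ℝ u x‖ₑ = ENNReal.ofReal (∫ x, ‖fderiv ℝ u x‖) := by
        rw [ofReal_integral_eq_lintegral_ofReal hDint (ae_of_all _ fun x => norm_nonneg _)]
        simp
      rw [this]
      exact ENNReal.ofReal_le_ofReal hDu
    have hmeas : MeasurableSet {x | 1 / 2 ≤ u x} :=
      measurableSet_le measurable_const hu.continuous.measurable
    have h2 : ENNReal.ofReal ((1 / 2) ^ p) * volume {x | 1 / 2 ≤ u x} ≤ ∫⁻ x, ‖u x‖ₑ ^ p := by
      rw [← setLIntegral_const]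
      refine (setLIntegral_mono_ae
        ((hu.continuous.measurable.enorm.pow_const p).aemeasurable) (ae_of_all _ fun x hx => ?_)).trans
        (setLIntegral_le_lintegral _ _)
      rw [← ENNReal.ofReal_rpow_of_nonneg (by norm_num) hp0.le]
      refine ENNReal.rpow_le_rpow ?_ hp0.le
      rw [← ofReal_norm_eq_enorm]
      refine ENNReal.ofReal_le_ofReal ?_
      rw [Real.norm_of_nonneg (hu0 x)]; exact hx
    have h3 : ENNReal.ofReal ((1 / 2) ^ p) * volume {x | 1 / 2 ≤ u x}
        ≤ ENNReal.ofReal (K * P ^ p) := by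
      refine h2.trans (hsob.trans ?_)
      rw [ENNReal.ofReal_mul (by positivity), ENNReal.ofReal_coe_nnreal,
        ← ENNReal.ofReal_rpow_of_nonneg hP0 hp0.le]
      gcongr
    have h4 : volume {x | 1 / 2 ≤ u x} ≤ ENNReal.ofReal (A * P ^ p) := by
      have e : (2 : ℝ) ^ p * (1 / 2) ^ p = 1 := by
        rw [← Real.mul_rpow (by norm_num) (by norm_num)]; norm_num
      calc volume {x | 1 / 2 ≤ u x} = ENNReal.ofReal (2 ^ p) *
            (ENNReal.ofReal ((1 / 2) ^ p) * volume {x | 1 / 2 ≤ u x}) := by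
            rw [← mul_assoc, ← ENNReal.ofReal_mul (by positivity), e]; simp
        _ ≤ ENNReal.ofReal (2 ^ p) * ENNReal.ofReal (K * P ^ p) := by gcongr
        _ = ENNReal.ofReal (2 ^ p * (K * P ^ p)) := by rw [← ENNReal.ofReal_mul (by positivity)]
        _ ≤ _ := by
            refine ENNReal.ofReal_le_ofReal ?_
            rw [hA, mul_assoc]
            have : (0 : ℝ) ≤ P ^ p := by positivity
            gcongr
            linarith
    have hint : Integrable (fun x => |u x - E.indicator (fun _ => (1 : ℝ)) x|) :=
      ((hu.continuous.integrable_of_hasCompactSupport huc).sub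
        (integrable_indicator_one hE hb)).abs
    have h5 : volume (E \ {x | 1 / 2 ≤ u x}) ≤ ENNReal.ofReal (2 * η) := by
      have h6 := mul_meas_ge_le_integral_of_nonneg (μ := volume)
        (ae_of_all _ fun x => abs_nonneg (u x - E.indicator (fun _ => (1 : ℝ)) x)) hint (1 / 2)
      have hsub : E \ {x | 1 / 2 ≤ u x} ⊆
          {x | 1 / 2 ≤ |u x - E.indicator (fun _ => (1 : ℝ)) x|} := by
        intro x hx
        have h7 : u x < 1 / 2 := by simpa using hx.2
        simp only [mem_setOf_eq, indicator_of_mem hx.1]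
        rw [abs_of_neg (by linarith)]; linarith
      have hfin : volume {x | 1 / 2 ≤ |u x - E.indicator (fun _ => (1 : ℝ)) x|} ≠ ⊤ :=
        (hint.measure_ge_lt_top (by norm_num)).ne
      refine (measure_mono hsub).trans ?_
      rw [ENNReal.le_ofReal_iff_toReal_le hfin (by positivity)]
      change 1 / 2 * (volume {x | 1 / 2 ≤ |u x - E.indicator (fun _ => (1 : ℝ)) x|}).toReal ≤ _ at h6
      linarith
    have h8 : volume E ≤ ENNReal.ofReal (A * P ^ p + 2 * η) := by
      rw [ENNReal.ofReal_add (by positivity) (by positivity)]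
      calc volume E ≤ volume ({x | 1 / 2 ≤ u x} ∪ (E \ {x | 1 / 2 ≤ u x})) :=
            measure_mono (by rw [union_diff_self]; exact subset_union_right)
        _ ≤ _ := (measure_union_le _ _).trans (add_le_add h4 h5)
    exact ENNReal.toReal_le_of_le_ofReal (by positivity) h8
  have key2 : volume.real E ≤ A * P ^ p := by
    refine le_of_forall_pos_le_add fun e he => ?_
    have := key (e / 2) (by positivity)
    linarith
  have hpn : 1 / p = (n - 1 : ℝ) / n := by
    rw [hp, Real.conjExponent]; field_simp
  have e1 : (volume.real E ^ (1 / (n : ℝ))) ^ (n - 1) = volume.real E ^ (1 / p) := by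
    rw [← Real.rpow_natCast, ← Real.rpow_mul measureReal_nonneg, hpn,
      Nat.cast_sub (by omega)]
    congr 1; push_cast; ring
  rw [e1]
  calc volume.real E ^ (1 / p) ≤ (A * P ^ p) ^ (1 / p) :=
        Real.rpow_le_rpow measureReal_nonneg key2 (by positivity)
    _ = _ := by
        rw [Real.mul_rpow hA0.le (by positivity), ← Real.rpow_mul hP0, mul_one_div_cancel hp0.ne',
          Real.rpow_one]

/-- Radial functions are smooth. -/
theorem contDiff_radial {n : ℕ} {F : ℝ → ℝ} (hF : ContDiff ℝ 1 F) {a : ℝ} (ha : 0 < a)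
    (h0 : ∀ y, y ≤ a → F y = 0) (x : EE n) : ContDiff ℝ 1 (fun y => F ‖y - x‖) := by
  rw [contDiff_iff_contDiffAt]
  intro y
  by_cases hy : y = x
  · have : (fun y => F ‖y - x‖) =ᶠ[𝓝 y] fun _ => 0 := by
      have hc : ContinuousAt (fun y => ‖y - x‖) y := by fun_prop
      have := hc.eventually (gt_mem_nhds (show ‖y - x‖ < a by simpa [hy] using ha))
      filter_upwards [this] with z hz using h0 _ hz.le
    exact contDiffAt_const.congr_of_eventuallyEq this
  · exact hF.contDiffAt.comp y
      ((contDiffAt_norm ℝ (sub_ne_zero.2 hy)).comp y (contDiffAt_id.sub contDiffAt_const))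

theorem norm_fderiv_radial_le {n : ℕ} {F : ℝ → ℝ} (hF : ContDiff ℝ 1 F) {a : ℝ} (ha : 0 < a)
    (h0 : ∀ y, y ≤ a → F y = 0) (x y : EE n) :
    ‖fderiv ℝ (fun y => F ‖y - x‖) y‖ ≤ |deriv F ‖y - x‖| := by
  by_cases hy : y = x
  · have : (fun y => F ‖y - x‖) =ᶠ[𝓝 y] fun _ => 0 := by
      have hc : ContinuousAt (fun y => ‖y - x‖) y := by fun_prop
      have := hc.eventually (gt_mem_nhds (show ‖y - x‖ < a by simpa [hy] using ha))
      filter_upwards [this] with z hz using h0 _ hz.le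
    rw [this.fderiv_eq]; simp
  · have hd : DifferentiableAt ℝ (fun y => ‖y - x‖) y :=
      ((contDiffAt_norm ℝ (sub_ne_zero.2 hy)).comp y
        (contDiffAt_id.sub contDiffAt_const)).differentiableAt (n := 1) (by norm_num)
    have h1 : HasFDerivAt (fun y => F ‖y - x‖)
        (deriv F ‖y - x‖ • fderiv ℝ (fun y => ‖y - x‖) y) y :=
      HasDerivAt.comp_hasFDerivAt y (hF.differentiable (by norm_num) _).hasDerivAt hd.hasFDerivAt
    rw [h1.fderiv, norm_smul, Real.norm_eq_abs]
    have h2 : ‖fderiv ℝ (fun y => ‖y - x‖) y‖ ≤ (1 : ℝ≥0) := by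
      refine norm_fderiv_le_of_lipschitz ℝ ?_
      refine LipschitzWith.of_dist_le_mul fun z w => ?_
      rw [NNReal.coe_one, one_mul, Real.dist_eq, dist_eq_norm]
      refine (abs_norm_sub_norm_le _ _).trans (le_of_eq ?_)
      congr 1; abel
    calc _ ≤ |deriv F ‖y - x‖| * (1 : ℝ≥0) := by gcongr
      _ = _ := by simp

/-- The key estimate for radial cutoffs. -/
theorem radial_integral_le {n : ℕ} {E : Set (EE n)} (hE : MeasurableSet E) {x : EE n}
    {F : ℝ → ℝ} (hF : ContDiff ℝ 1 F) {a b c : ℝ} (ha : 0 < a)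
    (h0 : ∀ y, y ≤ a → F y = 0) (hd0 : ∀ y, 0 ≤ deriv F y) (hd : ∀ y, deriv F y ≤ c)
    (hda : ∀ y, y ≤ a → deriv F y = 0) (hdb : ∀ y, b ≤ y → deriv F y = 0)
    {φ : EE n → EE n} (hφ : IsTest φ) :
    |∫ y in E, fderiv ℝ (fun y => F ‖y - x‖) y (φ y)| ≤
      c * volume.real (E ∩ (ball x b \ ball x a)) := by
  have hS : MeasurableSet (ball x b \ ball x a) := measurableSet_ball.diff measurableSet_ball
  have hfin : volume (E ∩ (ball x b \ ball x a)) < ⊤ :=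
    (measure_mono (inter_subset_right.trans diff_subset)).trans_lt measure_ball_lt_top
  have hbd : ∀ y, ‖fderiv ℝ (fun y => F ‖y - x‖) y (φ y)‖ ≤ deriv F ‖y - x‖ := by
    intro y
    refine (abs_fderiv_apply_le hφ.le_one y).trans ?_
    exact (norm_fderiv_radial_le hF ha h0 x y).trans (abs_of_nonneg (hd0 _)).le
  have e : ∫ y in E, fderiv ℝ (fun y => F ‖y - x‖) y (φ y)
      = ∫ y in E ∩ (ball x b \ ball x a), fderiv ℝ (fun y => F ‖y - x‖) y (φ y) := by
    refine setIntegral_eq_of_subset_of_forall_diff_eq_zero hE inter_subset_left fun y hy => ?_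
    have hy2 : y ∉ ball x b \ ball x a := fun h => hy.2 ⟨hy.1, h⟩
    have : deriv F ‖y - x‖ = 0 := by
      by_cases h : y ∈ ball x a
      · rw [mem_ball, dist_eq_norm] at h; exact hda _ h.le
      · have : y ∉ ball x b := fun h' => hy2 ⟨h', h⟩
        rw [mem_ball, dist_eq_norm, not_lt] at this; exact hdb _ this
    have h3 := hbd y
    rw [this] at h3
    exact norm_le_zero_iff.1 h3
  rw [e]
  exact norm_setIntegral_le_of_norm_le_const hfin fun y _ => (hbd y).trans (hd _)


/-! ### Cutting with balls -/

theorem hasCompactSupport_smul {n : ℕ} (g : EE n → ℝ) {φ : EE n → EE n}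
    (h : HasCompactSupport φ) : HasCompactSupport (fun y => g y • φ y) :=
  HasCompactSupport.intro h fun y hy => by rw [image_eq_zero_of_notMem_tsupport hy, smul_zero]

/-- Volume of `E` in a ball. -/
def bvol {n : ℕ} (E : Set (EE n)) (x : EE n) (r : ℝ) : ℝ := volume.real (E ∩ ball x r)

theorem bvol_nonneg {n : ℕ} (E : Set (EE n)) (x : EE n) (r : ℝ) : 0 ≤ bvol E x r :=
  measureReal_nonneg

theorem inter_ball_lt_top {n : ℕ} (E : Set (EE n)) (x : EE n) (r : ℝ) :
    volume (E ∩ ball x r) < ⊤ :=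
  (measure_mono inter_subset_right).trans_lt measure_ball_lt_top

theorem bvol_mono {n : ℕ} (E : Set (EE n)) (x : EE n) : Monotone (bvol E x) := fun _ _ h =>
  measureReal_mono (inter_subset_inter_right _ (ball_subset_ball h)) (inter_ball_lt_top E x _).ne

theorem shell_eq {n : ℕ} (E : Set (EE n)) (hE : MeasurableSet E) (x : EE n) {a b : ℝ}
    (hab : a ≤ b) :
    volume.real (E ∩ (ball x b \ ball x a)) = bvol E x b - bvol E x a := by
  have h : E ∩ (ball x b \ ball x a) = (E ∩ ball x b) \ (E ∩ ball x a) := by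
    ext y; simp only [mem_inter_iff, Set.mem_sdiff]; tauto
  rw [h, measureReal_sdiff (inter_subset_inter_right _ (ball_subset_ball hab))
    (hE.inter measurableSet_ball) (inter_ball_lt_top E x _).ne]
  rfl

/-- The outer shells of `E` around `ball x s` have density at most `D`. -/
def ShellBound {n : ℕ} (E : Set (EE n)) (x : EE n) (s D : ℝ) : Prop :=
  ∀ κ > 0, ∀ᶠ h in 𝓝[>] (0 : ℝ), volume.real (E ∩ (ball x (s + h) \ ball x s)) ≤ (D + κ) * h

theorem ShellBound.mono {n : ℕ} {E E' : Set (EE n)} (hE : E' ⊆ E) {x : EE n} {s D : ℝ}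
    (h : ShellBound E x s D) : ShellBound E' x s D := by
  intro κ hκ
  filter_upwards [h κ hκ] with k hk
  refine le_trans (measureReal_mono (inter_subset_inter_left _ hE) ?_) hk
  exact ((measure_mono (inter_subset_right.trans sdiff_subset)).trans_lt measure_ball_lt_top).ne

theorem deriv_est {m : ℝ → ℝ} {D s : ℝ} (h : HasDerivAt m D s) {κ : ℝ} (hκ : 0 < κ) :
    ∃ δ > 0, ∀ k, |k| < δ → |m (s + k) - m s - k * D| ≤ κ * |k| := by
  have h1 := (hasDerivAt_iff_isLittleO_nhds_zero.1 h).def hκ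
  obtain ⟨δ, hδ, h2⟩ := Metric.eventually_nhds_iff.1 h1
  refine ⟨δ, hδ, fun k hk => ?_⟩
  have := h2 (y := k) (by simpa using hk)
  simpa using this

theorem shellBound_of_hasDerivAt {n : ℕ} {E : Set (EE n)} (hE : MeasurableSet E) {x : EE n}
    {s D : ℝ} (h : HasDerivAt (bvol E x) D s) : ShellBound E x s D := by
  intro κ hκ
  obtain ⟨δ, hδ, h2⟩ := deriv_est h hκ
  filter_upwards [Ioo_mem_nhdsGT hδ] with k hk
  rw [shell_eq E hE x (by linarith [hk.1])]
  have := h2 k (by rw [abs_of_pos hk.1]; exact hk.2)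
  rw [abs_of_pos hk.1] at this
  have := (abs_le.1 this).2
  linarith

theorem cut_error {n : ℕ} {E : Set (EE n)} (hE : MeasurableSet E) {x : EE n}
    {F : ℝ → ℝ} (hFc : Continuous F) {a b s d : ℝ} (has : a ≤ s) (hsd : s ≤ d) (hbd : b ≤ d)
    (h0 : ∀ y, y ≤ a → F y = 0) (h1 : ∀ y, b ≤ y → F y = 1)
    (hF0 : ∀ y, 0 ≤ F y) (hF1 : ∀ y, F y ≤ 1)
    {φ : EE n → EE n} (hφ : IsTest φ) {C : ℝ} (hC : ∀ y, |vdiv φ y| ≤ C) :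
    |(∫ y in E \ ball x s, vdiv φ y) - ∫ y in E, F ‖y - x‖ * vdiv φ y| ≤
      C * volume.real (E ∩ (ball x d \ ball x a)) := by
  have hfin : volume (E ∩ (ball x d \ ball x a)) < ⊤ :=
    (measure_mono (inter_subset_right.trans sdiff_subset)).trans_lt measure_ball_lt_top
  have hint := integrable_vdiv hφ.smooth hφ.cpt
  have hint2 : Integrable (fun y => F ‖y - x‖ * vdiv φ y) :=
    integrable_mul_vdiv (by fun_prop) hφ.smooth hφ.cpt
  have hSm : MeasurableSet (ball x s)ᶜ := measurableSet_ball.compl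
  rw [sdiff_eq, ← setIntegral_indicator hSm, ← integral_sub
    ((hint.indicator hSm).integrableOn) hint2.integrableOn]
  have e : ∫ y in E, ((ball x s)ᶜ.indicator (vdiv φ) y - F ‖y - x‖ * vdiv φ y) =
      ∫ y in E ∩ (ball x d \ ball x a), ((ball x s)ᶜ.indicator (vdiv φ) y
        - F ‖y - x‖ * vdiv φ y) := by
    refine setIntegral_eq_of_subset_of_forall_sdiff_eq_zero hE inter_subset_left ?_
    intro y hy
    have hy2 : y ∉ ball x d \ ball x a := fun h => hy.2 ⟨hy.1, h⟩
    by_cases h : y ∈ ball x a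
    · have h' : y ∉ (ball x s)ᶜ := fun hh => hh (ball_subset_ball has h)
      rw [indicator_of_notMem h']
      rw [mem_ball, dist_eq_norm] at h
      rw [h0 _ h.le]; ring
    · have : y ∉ ball x d := fun h' => hy2 ⟨h', h⟩
      have h' : y ∈ (ball x s)ᶜ := fun hh => this (ball_subset_ball hsd hh)
      rw [indicator_of_mem h']
      rw [mem_ball, dist_eq_norm, not_lt] at this
      rw [h1 _ (hbd.trans this)]; ring
  rw [e]
  · rw [← Real.norm_eq_abs]
    refine norm_setIntegral_le_of_norm_le_const hfin fun y _ => ?_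
    by_cases hy : y ∈ (ball x s)ᶜ
    · rw [indicator_of_mem hy, Real.norm_eq_abs, show vdiv φ y - F ‖y - x‖ * vdiv φ y =
        (1 - F ‖y - x‖) * vdiv φ y by ring, abs_mul, abs_of_nonneg (by linarith [hF1 ‖y - x‖])]
      have := hF0 ‖y - x‖
      have := hF1 ‖y - x‖
      have := abs_nonneg (vdiv φ y)
      have := hC y
      nlinarith
    · rw [indicator_of_notMem hy, Real.norm_eq_abs, zero_sub, abs_neg, abs_mul,
        abs_of_nonneg (hF0 _)]
      have := hF0 ‖y - x‖
      have := hF1 ‖y - x‖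
      have := abs_nonneg (vdiv φ y)
      have := hC y
      nlinarith

theorem perimeter_inter_ball_le {n : ℕ} {E : Set (EE n)} (hE : MeasurableSet E) {x : EE n}
    {s D : ℝ} (hs : 0 < s) (hD : HasDerivAt (bvol E x) D s)
    (hR : relPerimeter E (ball x s) ≠ ⊤) :
    perimeter (E ∩ ball x s) ≤ ENNReal.ofReal ((relPerimeter E (ball x s)).toReal + D) := by
  refine relPerimeter_le fun φ hφ _ => ?_
  obtain ⟨C, hC0, hC⟩ := exists_bound_vdiv hφ.smooth hφ.cpt
  refine le_of_forall_pos_le_add fun e he => ?_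
  obtain ⟨κ, hκ, hκ1, hκe⟩ : ∃ κ : ℝ, 0 < κ ∧ κ ≤ 1 ∧ κ * (|D| + 6) ≤ e / 2 := by
    refine ⟨min 1 (e / 2 / (|D| + 6)), by positivity, min_le_left _ _, ?_⟩
    calc _ ≤ e / 2 / (|D| + 6) * (|D| + 6) := by gcongr; exact min_le_right _ _
      _ = _ := by field_simp
  obtain ⟨δ, hδ, hest⟩ := deriv_est hD hκ
  obtain ⟨h, hh, hhδ, hhs, hhe⟩ : ∃ h : ℝ, 0 < h ∧ 2 * h < δ ∧ 2 * h < s ∧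
      C * (2 * h * (|D| + 1)) ≤ e / 2 := by
    refine ⟨min (δ / 4) (min (s / 4) (e / 4 / (C * (|D| + 1)))), by positivity, ?_, ?_, ?_⟩
    · have := min_le_left (δ / 4) (min (s / 4) (e / 4 / (C * (|D| + 1)))); linarith
    · have := (min_le_right (δ / 4) (min (s / 4) (e / 4 / (C * (|D| + 1))))).trans
        (min_le_left _ _)
      linarith
    · have := (min_le_right (δ / 4) (min (s / 4) (e / 4 / (C * (|D| + 1))))).trans
        (min_le_right _ _)
      rw [le_div_iff₀ (by positivity)] at this
      linarith
  obtain ⟨F, hF, hF0, hF1, hFn, hFl, hd0, hd, hda, hdb⟩ :=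
    exists_cutoff (a := s - 2 * h) (b := s - h) (by linarith) hκ
  have ha : 0 < s - 2 * h := by linarith
  have e1 := hest (-h) (by rw [abs_neg, abs_of_pos hh]; linarith)
  have e2 := hest (-(2 * h)) (by rw [abs_neg, abs_of_pos (by linarith)]; linarith)
  rw [abs_neg, abs_of_pos hh, ← sub_eq_add_neg] at e1
  rw [abs_neg, abs_of_pos (by linarith : 0 < 2 * h), ← sub_eq_add_neg] at e2
  have e1' := abs_le.1 e1
  have e2' := abs_le.1 e2
  have hrad := radial_integral_le hE (x := x) hF ha hF0 hd0 hd hda hdb hφ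
  have hcut := cut_error hE (x := x) hF.continuous (a := s - 2 * h) (b := s - h) (s := s) (d := s)
    (by linarith) le_rfl (by linarith) hF0 hF1 hFn hFl hφ hC
  rw [shell_eq E hE x (by linarith)] at hrad hcut
  have hG := contDiff_radial hF ha hF0 x
  have hg : ContDiff ℝ 1 (fun y => 1 - F ‖y - x‖) := contDiff_const.sub hG
  have hT : IsTest (fun y => (1 - F ‖y - x‖) • φ y) := by
    refine ⟨hg.smul hφ.smooth, hasCompactSupport_smul _ hφ.cpt, fun y => ?_⟩
    rw [norm_smul, Real.norm_of_nonneg (by linarith [hFl ‖y - x‖])]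
    have := hFn ‖y - x‖
    have := hFl ‖y - x‖
    have := hφ.le_one y
    have := norm_nonneg (φ y)
    nlinarith
  have hTs : tsupport (fun y => (1 - F ‖y - x‖) • φ y) ⊆ ball x s := by
    refine (closure_minimal (t := closedBall x (s - h)) ?_ isClosed_closedBall).trans
      (closedBall_subset_ball (by linarith))
    intro y hy
    rw [mem_closedBall, dist_eq_norm]
    by_contra hcon
    refine hy ?_
    simp only
    rw [hF1 _ (by linarith)]; simp
  have hle := hT.le_toReal hTs hR
  have hfd : ∀ y, fderiv ℝ (fun y => 1 - F ‖y - x‖) y = - fderiv ℝ (fun y => F ‖y - x‖) y :=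
    fun y => fderiv_const_sub _
  have hint := integrable_vdiv hφ.smooth hφ.cpt
  have hint2 : Integrable (fun y => F ‖y - x‖ * vdiv φ y) :=
    integrable_mul_vdiv hG.continuous hφ.smooth hφ.cpt
  have hint3 := integrable_fderiv_apply hG hφ.smooth hφ.cpt
  have hexp : ∫ y in E, vdiv (fun y => (1 - F ‖y - x‖) • φ y) y =
      (∫ y in E, vdiv φ y) - (∫ y in E, F ‖y - x‖ * vdiv φ y)
        - ∫ y in E, fderiv ℝ (fun y => F ‖y - x‖) y (φ y) := by
    have hs2 : Integrable (fun y => vdiv φ y - F ‖y - x‖ * vdiv φ y) := hint.sub hint2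
    rw [← integral_sub hint.integrableOn hint2.integrableOn,
      ← integral_sub hs2.integrableOn hint3.integrableOn]
    refine integral_congr_ae (ae_of_all _ fun y => ?_)
    simp only
    rw [vdiv_smul hg hφ.smooth, hfd]
    simp; ring
  have hsplit := integral_inter_add_sdiff (μ := volume) (s := E) (t := ball x s) (f := vdiv φ)
    measurableSet_ball hint.integrableOn
  have hq : (1 + κ) / (s - h - (s - 2 * h)) * (bvol E x (s - h) - bvol E x (s - 2 * h)) ≤
      (1 + κ) * (D + 3 * κ) := by
    rw [show s - h - (s - 2 * h) = h by ring, div_mul_eq_mul_div, div_le_iff₀ hh, mul_assoc]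
    gcongr
    linarith
  have hr : C * (bvol E x s - bvol E x (s - 2 * h)) ≤ C * (2 * h * (|D| + 1)) := by
    gcongr
    have : D ≤ |D| := le_abs_self D
    nlinarith
  have hDD : D ≤ |D| := le_abs_self D
  have hq2 : (1 + κ) * (D + 3 * κ) ≤ D + κ * (|D| + 6) := by nlinarith
  have := abs_le.1 hrad
  have := abs_le.1 hcut
  linarith

theorem perimeter_sdiff_ball {n : ℕ} {E : Set (EE n)} (hE : MeasurableSet E) {x : EE n}
    {s D : ℝ} (hs : 0 < s) (hD : ShellBound E x s D)
    (hP : perimeter E ≠ ⊤) :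
    perimeter (E \ ball x s) ≠ ⊤ ∧
    (perimeter (E \ ball x s)).toReal + (relPerimeter E (ball x s)).toReal ≤
      (perimeter E).toReal + D := by
  have key : ∀ φ : EE n → EE n, IsTest φ → tsupport φ ⊆ univ → ∫ y in E \ ball x s, vdiv φ y ≤
      (perimeter E).toReal - (relPerimeter E (ball x s)).toReal + D := by
    intro φ hφ _
    obtain ⟨C, hC0, hC⟩ := exists_bound_vdiv hφ.smooth hφ.cpt
    refine le_of_forall_pos_le_add fun e he => ?_
    obtain ⟨κ, hκ, hκ1, hκe⟩ : ∃ κ : ℝ, 0 < κ ∧ κ ≤ 1 ∧ κ * (|D| + 4) ≤ e := by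
      refine ⟨min 1 (e / (|D| + 4)), by positivity, min_le_left _ _, ?_⟩
      calc _ ≤ e / (|D| + 4) * (|D| + 4) := by gcongr; exact min_le_right _ _
        _ = _ := by field_simp
    obtain ⟨h, hsh, hh, hhe⟩ := ((hD κ hκ).and (Ioo_mem_nhdsGT
      (show (0 : ℝ) < κ / (C * (|D| + 1)) by positivity))).exists
    rw [lt_div_iff₀ (by positivity)] at hhe
    obtain ⟨ψ, hψ, hψs, hψe⟩ := exists_test E (ball x s) hκ
    obtain ⟨F, hF, hF0, hF1, hFn, hFl, hd0, hd, hda, hdb⟩ :=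
      exists_cutoff (a := s) (b := s + h) (by linarith) hκ
    have hrad := radial_integral_le hE (x := x) hF hs hF0 hd0 hd hda hdb hφ
    have hcut := cut_error hE (x := x) hF.continuous (a := s) (b := s + h) (s := s) (d := s + h)
      le_rfl (by linarith) le_rfl hF0 hF1 hFn hFl hφ hC
    have hG := contDiff_radial hF hs hF0 x
    have hT : IsTest (fun y => F ‖y - x‖ • φ y + ψ y) := by
      refine ⟨(hG.smul hφ.smooth).add hψ.smooth, (hasCompactSupport_smul _ hφ.cpt).add hψ.cpt, fun y => ?_⟩
      by_cases hy : y ∈ ball x s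
      · rw [mem_ball, dist_eq_norm] at hy
        rw [hF0 _ hy.le]; simpa using hψ.le_one y
      · have : ψ y = 0 := image_eq_zero_of_notMem_tsupport fun h => hy (hψs h)
        rw [this, add_zero, norm_smul, Real.norm_of_nonneg (hFn _)]
        have := hFn ‖y - x‖
        have := hFl ‖y - x‖
        have := hφ.le_one y
        have := norm_nonneg (φ y)
        nlinarith
    have hle := hT.le_toReal (subset_univ _) hP
    have hint2 : Integrable (fun y => F ‖y - x‖ * vdiv φ y) :=
      integrable_mul_vdiv hG.continuous hφ.smooth hφ.cpt
    have hint3 := integrable_fderiv_apply hG hφ.smooth hφ.cpt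
    have hint4 := integrable_vdiv hψ.smooth hψ.cpt
    have hexp : ∫ y in E, vdiv (fun y => F ‖y - x‖ • φ y + ψ y) y =
        (∫ y in E, F ‖y - x‖ * vdiv φ y)
          + (∫ y in E, fderiv ℝ (fun y => F ‖y - x‖) y (φ y)) + ∫ y in E, vdiv ψ y := by
      have hs2 : Integrable (fun y => F ‖y - x‖ * vdiv φ y +
        fderiv ℝ (fun y => F ‖y - x‖) y (φ y)) := hint2.add hint3
      rw [← integral_add hint2.integrableOn hint3.integrableOn,
        ← integral_add hs2.integrableOn hint4.integrableOn]
      refine integral_congr_ae (ae_of_all _ fun y => ?_)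
      simp only
      have hsm : ContDiff ℝ 1 (fun y => F ‖y - x‖ • φ y) := hG.smul hφ.smooth
      rw [vdiv_add hsm hψ.smooth, vdiv_smul hG hφ.smooth]
    have hq : (1 + κ) / (s + h - s) * volume.real (E ∩ (ball x (s + h) \ ball x s)) ≤
        (1 + κ) * (D + κ) := by
      rw [show s + h - s = h by ring, div_mul_eq_mul_div, div_le_iff₀ hh, mul_assoc]
      gcongr
    have hDD : D ≤ |D| := le_abs_self D
    have hr : C * volume.real (E ∩ (ball x (s + h) \ ball x s)) ≤ κ := by
      calc _ ≤ C * ((D + κ) * h) := by gcongr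
        _ ≤ C * ((|D| + 1) * h) := by gcongr
        _ ≤ κ := by linarith
    have hq2 : (1 + κ) * (D + κ) + 2 * κ ≤ D + κ * (|D| + 4) := by nlinarith
    have := abs_le.1 hrad
    have := abs_le.1 hcut
    change _ ≤ (perimeter E).toReal at hle
    linarith
  have h0 : IsTest (fun _ : EE n => (0 : EE n)) :=
    ⟨contDiff_const, HasCompactSupport.zero, by simp⟩
  have h1 := key _ h0 (subset_univ _)
  have h2 : ∫ y in E \ ball x s, vdiv (fun _ : EE n => (0 : EE n)) y = 0 := by simp [vdiv]
  rw [h2] at h1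
  have h3 : perimeter (E \ ball x s) ≤ _ := relPerimeter_le key
  refine ⟨(h3.trans_lt ENNReal.ofReal_lt_top).ne, ?_⟩
  have := ENNReal.toReal_le_of_le_ofReal h1 h3
  linarith

theorem relPerimeter_congr {n : ℕ} {E E' W : Set (EE n)} (hE : MeasurableSet E)
    (hE' : MeasurableSet E') (h : E ∩ W = E' ∩ W) : relPerimeter E W = relPerimeter E' W := by
  unfold relPerimeter
  refine iSup_congr fun φ => iSup_congr fun h1 => iSup_congr fun h2 => iSup_congr fun h3 =>
    iSup_congr fun h4 => ?_
  have key : ∀ A : Set (EE n), MeasurableSet A →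
      ∫ x in A, vdiv φ x = ∫ x in A ∩ W, vdiv φ x := by
    intro A hA
    refine setIntegral_eq_of_subset_of_forall_sdiff_eq_zero hA inter_subset_left fun y hy => ?_
    exact vdiv_eq_zero fun h => hy.2 ⟨hy.1, h3 h⟩
  rw [key E hE, key E' hE', h]

/-- Removing finitely many disjoint balls. -/
theorem perimeter_sdiff_balls {n : ℕ} {ι : Type*} {E : Set (EE n)} (hE : MeasurableSet E)
    (hP : perimeter E ≠ ⊤) (c : ι → EE n) (s D : ι → ℝ) (J : Finset ι)
    (hs : ∀ i ∈ J, 0 < s i) (hD : ∀ i ∈ J, ShellBound E (c i) (s i) (D i))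
    (hdisj : (J : Set ι).PairwiseDisjoint fun i => ball (c i) (s i)) :
    perimeter (E \ ⋃ i ∈ J, ball (c i) (s i)) ≠ ⊤ ∧
    (perimeter (E \ ⋃ i ∈ J, ball (c i) (s i))).toReal +
      ∑ i ∈ J, ((relPerimeter E (ball (c i) (s i))).toReal - D i) ≤ (perimeter E).toReal := by
  classical
  induction J using Finset.induction_on with
  | empty => simpa using hP
  | insert i J hi ih =>
    obtain ⟨h1, h2⟩ := ih (fun j hj => hs j (Finset.mem_insert_of_mem hj))
      (fun j hj => hD j (Finset.mem_insert_of_mem hj))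
      (hdisj.subset (by simp))
    have hmeas : MeasurableSet (E \ ⋃ i ∈ J, ball (c i) (s i)) :=
      hE.diff (J.measurableSet_biUnion fun _ _ => measurableSet_ball)
    have e : E \ ⋃ j ∈ insert i J, ball (c j) (s j) =
        (E \ ⋃ j ∈ J, ball (c j) (s j)) \ ball (c i) (s i) := by
      ext y; simp; tauto
    have h3 := perimeter_sdiff_ball hmeas (hs i (Finset.mem_insert_self _ _))
      ((hD i (Finset.mem_insert_self _ _)).mono sdiff_subset) h1
    have e2 : relPerimeter (E \ ⋃ j ∈ J, ball (c j) (s j)) (ball (c i) (s i)) =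
        relPerimeter E (ball (c i) (s i)) := by
      refine relPerimeter_congr hmeas hE ?_
      ext y
      simp only [mem_inter_iff, Set.mem_sdiff, mem_iUnion, not_exists]
      refine ⟨fun h => ⟨h.1.1, h.2⟩, fun h => ⟨⟨h.1, fun j hj hy => ?_⟩, h.2⟩⟩
      have hij : i ≠ j := fun h => hi (h ▸ hj)
      exact disjoint_left.1 (hdisj (by simp) (by simp [hj]) hij) h.2 hy
    rw [e2] at h3
    rw [e, Finset.sum_insert hi]
    exact ⟨h3.1, by linarith [h3.2]⟩


/-! ### The relative isoperimetric engine and the covering argument -/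

/-- Small density implies a good radius for cutting. -/
def Engine (n : ℕ) (γ c : ℝ) : Prop :=
  ∀ E : Set (EE n), MeasurableSet E → perimeter E ≠ ⊤ → ∀ (x : EE n) (s0 : ℝ), 0 < s0 →
    bvol E x (2 * s0) ≤ (γ * s0) ^ n →
    ∃ s ∈ Ioo s0 (2 * s0), ∃ D : ℝ, ShellBound E x s D ∧
      c * (bvol E x s0 ^ (1 / (n : ℝ))) ^ (n - 1) ≤ (relPerimeter E (ball x s)).toReal - D

theorem exists_engine (n : ℕ) (hn : 2 ≤ n) : ∃ γ c : ℝ, 0 < γ ∧ 0 < c ∧ γ ≤ 1 ∧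
    γ ≤ volume.real (ball (0 : EE n) 1) ∧ Engine n γ c := by
  obtain ⟨C, hC0, hC⟩ := exists_isoperimetric n hn
  have hn0 : (0 : ℝ) < n := by exact_mod_cast (by omega : 0 < n)
  have hω : 0 < volume.real (ball (0 : EE n) 1) :=
    ENNReal.toReal_pos (measure_ball_pos _ _ one_pos).ne' measure_ball_lt_top.ne
  set γ := min (1 / (3 * n * C)) (min 1 (volume.real (ball (0 : EE n) 1))) with hγ
  have hγ0 : 0 < γ := by positivity
  have hγ1 : γ ≤ 1 / (3 * n * C) := min_le_left _ _
  refine ⟨γ, 1 / (3 * C), hγ0, by positivity, (min_le_right _ _).trans (min_le_left _ _),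
    (min_le_right _ _).trans (min_le_right _ _), ?_⟩
  intro E hE hP x s0 hs0 hsm
  set g : ℝ → ℝ := fun r => bvol E x r ^ (1 / (n : ℝ)) with hg
  have hg0 : ∀ r, 0 ≤ g r := fun r => Real.rpow_nonneg (bvol_nonneg _ _ _) _
  have hgm : Monotone g := fun a b hab =>
    Real.rpow_le_rpow (bvol_nonneg _ _ _) (bvol_mono E x hab) (by positivity)
  have hgn : ∀ r, g r ^ n = bvol E x r := by
    intro r
    rw [hg]; simp only
    rw [← Real.rpow_natCast, ← Real.rpow_mul (bvol_nonneg _ _ _), one_div_mul_cancel hn0.ne',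
      Real.rpow_one]
  have hg2 : g (2 * s0) ≤ γ * s0 := by
    refine le_of_pow_le_pow_left₀ (n := n) (by omega) (by positivity) ?_
    rw [hgn]; exact hsm
  obtain ⟨t, ht, -, hdiff, hder⟩ := exists_deriv_le (M := g) (a := s0) (b := 2 * s0)
    (by linarith) (hgm.monotoneOn _) (N := ∅) (by simp)
  have hder2 : deriv g t ≤ γ := by
    refine hder.trans ?_
    rw [div_le_iff₀ (by linarith)]
    nlinarith [hg0 s0]
  have hder0 : 0 ≤ deriv g t := hgm.deriv_nonneg
  have hD : HasDerivAt (bvol E x) (n * g t ^ (n - 1) * deriv g t) t := by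
    have := hdiff.hasDerivAt.fun_pow n
    refine this.congr_of_eventuallyEq (Eventually.of_forall fun r => (hgn r).symm)
  have hRtop : relPerimeter E (ball x t) ≠ ⊤ :=
    ((relPerimeter_mono (subset_univ _)).trans_lt (lt_top_iff_ne_top.2 hP)).ne
  refine ⟨t, ht, _, shellBound_of_hasDerivAt hE hD, ?_⟩
  have ht0 : 0 < t := hs0.trans ht.1
  have h1 := perimeter_inter_ball_le hE ht0 hD hRtop
  have h2 := hC (E ∩ ball x t) (hE.inter measurableSet_ball)
    (isBounded_ball.subset inter_subset_right) (h1.trans_lt ENNReal.ofReal_lt_top).ne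
  have hgt : 0 ≤ g t ^ (n - 1) := pow_nonneg (hg0 t) _
  have h3 := ENNReal.toReal_le_of_le_ofReal (by positivity) h1
  set R := (relPerimeter E (ball x t)).toReal
  change g t ^ (n - 1) ≤ _ at h2
  have h4 : n * g t ^ (n - 1) * deriv g t ≤ g t ^ (n - 1) / (3 * C) := by
    calc n * g t ^ (n - 1) * deriv g t ≤ n * g t ^ (n - 1) * (1 / (3 * n * C)) := by
          gcongr; exact hder2.trans hγ1
      _ = _ := by field_simp
  have h5 : g t ^ (n - 1) ≤ C * (R + n * g t ^ (n - 1) * deriv g t) := h2.trans (by gcongr)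
  have h6 : g t ^ (n - 1) / C ≤ R + n * g t ^ (n - 1) * deriv g t := by
    rw [div_le_iff₀ hC0]; linarith
  have h7 : g s0 ^ (n - 1) ≤ g t ^ (n - 1) := pow_le_pow_left₀ (hg0 _) (hgm ht.1.le) _
  have h8 : g t ^ (n - 1) / C = 3 * (g t ^ (n - 1) / (3 * C)) := by field_simp
  calc 1 / (3 * C) * g s0 ^ (n - 1) ≤ 1 / (3 * C) * g t ^ (n - 1) := by gcongr
    _ = g t ^ (n - 1) / (3 * C) := by ring
    _ ≤ _ := by linarith

theorem covering {n : ℕ} (hn : 2 ≤ n) {γ c : ℝ} (hγ : 0 < γ) (hc : 0 < c) (hEng : Engine n γ c)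
    {α : ℝ} (hα : 0 < α) : ∃ K > 0, ∀ E : Set (EE n), MeasurableSet E → perimeter E ≠ ⊤ →
    ∀ ε > 0, ∀ (A : Set (EE n)) (s0 : EE n → ℝ),
    (∀ x ∈ A, 0 < s0 x ∧ s0 x ≤ ε ∧ bvol E x (2 * s0 x) ≤ (γ * s0 x) ^ n ∧
      α * s0 x ^ n ≤ bvol E x (s0 x)) →
    ∀ L : ℝ, (∀ E' : Set (EE n), MeasurableSet E' → E' ⊆ E →
      volume (E \ E') ≤ ENNReal.ofReal (K * ε * (perimeter E).toReal) → perimeter E' ≠ ⊤ →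
      L ≤ (perimeter E').toReal) →
    ∃ u ⊆ A, u.Countable ∧ A ⊆ ⋃ x ∈ u, closedBall x (10 * s0 x) ∧
      ∑' x : u, ENNReal.ofReal (s0 x ^ (n - 1)) ≤
        ENNReal.ofReal (K * ((perimeter E).toReal - L)) := by
  have hn0 : (0 : ℝ) < n := by exact_mod_cast (by omega : 0 < n)
  set c1 : ℝ := c * (α ^ (1 / (n : ℝ))) ^ (n - 1) with hc1
  have hc10 : 0 < c1 := by positivity
  set K : ℝ := (1 + γ ^ n) / c1 with hK
  have hK0 : 0 < K := by positivity
  refine ⟨K, hK0, ?_⟩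
  intro E hE hP ε hε A s0 hA L hL
  obtain ⟨u, huA, hdisj, hcov⟩ := Vitali.exists_disjoint_subfamily_covering_enlargement_closedBall
    A (fun x => x) (fun x => 2 * s0 x) (2 * ε) (fun x hx => by have := (hA x hx).2.1; linarith)
    5 (by norm_num)
  have hcnt : u.Countable := by
    refine (hdisj.mono_on fun x hx => ball_subset_closedBall).countable_of_isOpen
      (fun x _ => isOpen_ball) fun x hx => ?_
    exact nonempty_ball.2 (by have := (hA x (huA hx)).1; linarith)
  refine ⟨u, huA, hcnt, ?_, ?_⟩
  · intro x hx
    obtain ⟨b, hb, hsub⟩ := hcov x hx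
    refine mem_iUnion₂.2 ⟨b, hb, ?_⟩
    have := hsub (mem_closedBall_self (by have := (hA x hx).1; linarith))
    rwa [show 5 * (2 * s0 b) = 10 * s0 b by ring] at this
  have hE' : ∀ x ∈ A, ∃ s ∈ Ioo (s0 x) (2 * s0 x), ∃ D : ℝ, ShellBound E x s D ∧
      c1 * s0 x ^ (n - 1) ≤ (relPerimeter E (ball x s)).toReal - D := by
    intro x hx
    obtain ⟨h0, h1, h2, h3⟩ := hA x hx
    obtain ⟨s, hs, D, hD, hR⟩ := hEng E hE hP x (s0 x) h0 h2
    refine ⟨s, hs, D, hD, le_trans ?_ hR⟩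
    have e : α ^ (1 / (n : ℝ)) * s0 x = (α * s0 x ^ n) ^ (1 / (n : ℝ)) := by
      rw [Real.mul_rpow hα.le (by positivity), ← Real.rpow_natCast, ← Real.rpow_mul h0.le,
        mul_one_div_cancel hn0.ne', Real.rpow_one]
    rw [hc1, mul_assoc, ← mul_pow, e]
    gcongr
  choose! s hs D hD hR using hE'
  rw [ENNReal.tsum_eq_iSup_sum]
  refine iSup_le fun J => ?_
  rw [← ENNReal.ofReal_sum_of_nonneg fun (i : u) _ => pow_nonneg (hA i (huA i.2)).1.le _]
  refine ENNReal.ofReal_le_ofReal ?_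
  have hs2 : ∀ x ∈ A, 0 < s x := fun x hx => (hA x hx).1.trans (hs x hx).1
  obtain ⟨g1, g2⟩ := perimeter_sdiff_balls hE hP (fun i : u => (i : EE n)) (fun i => s i)
    (fun i => D i) J (fun i _ => hs2 i (huA i.2)) (fun i _ => hD i (huA i.2)) (by
      intro i _ j _ hij
      refine (hdisj i.2 j.2 (fun h => hij (Subtype.ext h))).mono ?_ ?_
      · exact (ball_subset_ball (hs i (huA i.2)).2.le).trans ball_subset_closedBall
      · exact (ball_subset_ball (hs j (huA j.2)).2.le).trans ball_subset_closedBall)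
  set E' := E \ ⋃ i ∈ J, ball (i : EE n) (s i) with hE'
  have hE'm : MeasurableSet E' := hE.diff (J.measurableSet_biUnion fun _ _ => measurableSet_ball)
  have hsum : c1 * ∑ i ∈ J, s0 i ^ (n - 1) ≤ (perimeter E).toReal - (perimeter E').toReal := by
    rw [Finset.mul_sum]
    have := Finset.sum_le_sum (s := J) fun (i : u) _ => hR i (huA i.2)
    linarith
  have hsum0 : 0 ≤ ∑ i ∈ J, s0 i ^ (n - 1) :=
    Finset.sum_nonneg fun (i : u) _ => pow_nonneg (hA i (huA i.2)).1.le _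
  have hP0 : 0 ≤ (perimeter E').toReal := ENNReal.toReal_nonneg
  have hvol : volume (E \ E') ≤ ENNReal.ofReal (K * ε * (perimeter E).toReal) := by
    have h1 : E \ E' ⊆ ⋃ i ∈ J, (E ∩ ball (i : EE n) (2 * s0 i)) := by
      intro y hy
      have : y ∈ ⋃ i ∈ J, ball (i : EE n) (s i) := by
        by_contra hcon; exact hy.2 ⟨hy.1, hcon⟩
      obtain ⟨i, hi, hyi⟩ := mem_iUnion₂.1 this
      exact mem_iUnion₂.2 ⟨i, hi, hy.1, ball_subset_ball (hs i (huA i.2)).2.le hyi⟩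
    have h2 : ∀ i ∈ J, volume (E ∩ ball (i : EE n) (2 * s0 i)) ≤
        ENNReal.ofReal (γ ^ n * ε * s0 i ^ (n - 1)) := by
      intro i _
      obtain ⟨k0, k1, k2, k3⟩ := hA i (huA i.2)
      rw [ENNReal.le_ofReal_iff_toReal_le (inter_ball_lt_top _ _ _).ne (by positivity)]
      refine le_trans k2 ?_
      rw [mul_pow, mul_assoc]
      gcongr
      calc s0 i ^ n = s0 i * s0 i ^ (n - 1) := by rw [mul_pow_sub_one (by omega)]
        _ ≤ _ := by gcongr
    refine (measure_mono h1).trans ((measure_biUnion_finset_le _ _).trans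
      ((Finset.sum_le_sum h2).trans ?_))
    rw [← ENNReal.ofReal_sum_of_nonneg fun (i : u) _ => by
      have := (hA i (huA i.2)).1; positivity]
    refine ENNReal.ofReal_le_ofReal ?_
    rw [← Finset.mul_sum]
    have h3 : ∑ i ∈ J, s0 i ^ (n - 1) ≤ (perimeter E).toReal / c1 := by
      rw [le_div_iff₀ hc10]; linarith
    calc γ ^ n * ε * ∑ i ∈ J, s0 i ^ (n - 1) ≤ (1 + γ ^ n) * ε * ((perimeter E).toReal / c1) := by
          gcongr; linarith
      _ = _ := by rw [hK]; ring
  have hLL := hL E' hE'm sdiff_subset hvol g1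
  have h4 : ∑ i ∈ J, s0 i ^ (n - 1) ≤ ((perimeter E).toReal - L) / c1 := by
    rw [le_div_iff₀ hc10]; linarith
  have h5 : 0 ≤ ((perimeter E).toReal - L) / c1 := hsum0.trans h4
  calc _ ≤ ((perimeter E).toReal - L) / c1 := h4
    _ ≤ (1 + γ ^ n) * (((perimeter E).toReal - L) / c1) := by
        have : 0 < γ ^ n := by positivity
        nlinarith
    _ = _ := by rw [hK]; ring


/-! ### Densities, transition scales, Hausdorff measure -/

theorem volReal_ball {n : ℕ} (x : EE n) {s : ℝ} (hs : 0 < s) :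
    volume.real (ball x s) = volume.real (ball (0 : EE n) 1) * s ^ n := by
  rw [measureReal_def, Measure.addHaar_ball_of_pos _ _ hs, ENNReal.toReal_mul, ENNReal.toReal_ofReal
    (by positivity), measureReal_def]
  simp [mul_comm]

theorem volReal_ball_pos (n : ℕ) : 0 < volume.real (ball (0 : EE n) 1) :=
  ENNReal.toReal_pos (measure_ball_pos _ _ one_pos).ne' measure_ball_lt_top.ne

theorem mem_densityPts_zero {n : ℕ} {Ω : Set (EE n)} {x : EE n} :
    x ∈ densityPts Ω 0 ↔ ∀ c > 0, ∀ᶠ s in 𝓝[>] (0 : ℝ), bvol Ω x s ≤ c * s ^ n := by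
  have hω := volReal_ball_pos n
  set ω := volume.real (ball (0 : EE n) 1) with hω'
  have key : ∀ s : ℝ, 0 < s → volume (Ω ∩ ball x s) / volume (ball x s) =
      ENNReal.ofReal (bvol Ω x s / (ω * s ^ n)) := by
    intro s hs
    rw [ENNReal.ofReal_div_of_pos (by positivity), ← volReal_ball x hs, bvol, measureReal_def,
      measureReal_def, ENNReal.ofReal_toReal (inter_ball_lt_top _ _ _).ne,
      ENNReal.ofReal_toReal measure_ball_lt_top.ne]
  change Tendsto _ _ _ ↔ _
  rw [ENNReal.tendsto_nhds_zero]
  constructor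
  · intro h c hc
    filter_upwards [h (ENNReal.ofReal (c / ω)) (by simp; positivity), self_mem_nhdsWithin]
      with s hs hs0
    have hs0 : 0 < s := hs0
    rw [key s hs0, ENNReal.ofReal_le_ofReal_iff (by positivity), div_le_div_iff₀ (by positivity) hω]
      at hs
    have : (bvol Ω x s) * ω ≤ (c * s ^ n) * ω := by linarith
    exact le_of_mul_le_mul_right this hω
  · intro h e he
    have hm0 : (0 : ℝ) < (min e 1).toReal :=
      ENNReal.toReal_pos (by simp [he.ne']) (by simp)
    filter_upwards [h ((min e 1).toReal * ω) (by positivity), self_mem_nhdsWithin] with s hs hs0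
    have hs0 : 0 < s := hs0
    rw [key s hs0]
    refine le_trans ?_ (min_le_left e 1)
    rw [← ENNReal.ofReal_toReal (show min e 1 ≠ ⊤ by simp)]
    refine ENNReal.ofReal_le_ofReal ?_
    rw [div_le_iff₀ (by positivity)]; linarith

theorem transition {n : ℕ} {m : ℝ → ℝ} (hm : Monotone m) {γ s ε : ℝ} (hγ : 0 < γ) (hs : 0 < s)
    (hsε : s ≤ ε) (h1 : m ε ≤ (γ * ε / 4) ^ n) (h2 : (γ * s / 2) ^ n < m s) :
    ∃ s0, 0 < s0 ∧ s0 ≤ ε ∧ m (2 * s0) ≤ (γ * s0) ^ n ∧ (γ / 2) ^ n * s0 ^ n ≤ m s0 := by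
  classical
  have hex : ∃ i : ℕ, s * 2 ^ i ≤ ε ∧ m (s * 2 ^ i) ≤ (γ * (s * 2 ^ i) / 2) ^ n := by
    obtain ⟨i, hi1, hi2⟩ := exists_nat_pow_near (show 1 ≤ ε / s by rwa [one_le_div hs])
      (show (1 : ℝ) < 2 by norm_num)
    rw [le_div_iff₀ hs] at hi1
    rw [div_lt_iff₀ hs, pow_succ] at hi2
    have hi1' : s * 2 ^ i ≤ ε := by linarith
    refine ⟨i, hi1', (hm hi1').trans (h1.trans ?_)⟩
    refine pow_le_pow_left₀ (by have := hs.trans_le hsε; positivity) ?_ _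
    nlinarith
  have hsp := Nat.find_spec hex
  set k := Nat.find hex with hk
  have hk0 : k ≠ 0 := by
    intro h0
    rw [h0] at hsp
    simp only [pow_zero, mul_one] at hsp
    linarith [hsp.2]
  obtain ⟨j, hj⟩ := Nat.exists_eq_succ_of_ne_zero hk0
  have hmin : ¬ _ := Nat.find_min hex (m := j) (by omega)
  rw [hj, Nat.succ_eq_add_one, pow_succ] at hsp
  have hp : 0 < s * 2 ^ j := by positivity
  have hle : s * 2 ^ j ≤ ε := by nlinarith [hsp.1]
  push Not at hmin
  refine ⟨s * 2 ^ j, hp, hle, ?_, ?_⟩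
  · rw [show 2 * (s * 2 ^ j) = s * (2 ^ j * 2) by ring]
    refine hsp.2.trans (le_of_eq ?_)
    congr 1; ring
  · refine le_trans (le_of_eq ?_) (hmin hle).le
    rw [← mul_pow]; congr 1; ring

theorem hausdorff_zero_of_cover {n : ℕ} (hn : 2 ≤ n) {A : Set (EE n)}
    (h : ∀ η > 0, ∃ (u : Set (EE n)) (r : EE n → ℝ), u.Countable ∧
      (∀ x ∈ u, 0 < r x ∧ r x ≤ η) ∧ A ⊆ ⋃ x ∈ u, closedBall x (10 * r x) ∧
      ∑' x : u, ENNReal.ofReal (r x ^ (n - 1)) ≤ ENNReal.ofReal η) :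
    μH[(n : ℝ) - 1] A = 0 := by
  have h' : ∀ k : ℕ, ∃ (u : Set (EE n)) (r : EE n → ℝ), u.Countable ∧
      (∀ x ∈ u, 0 < r x ∧ r x ≤ 1 / ((k : ℝ) + 1)) ∧ A ⊆ ⋃ x ∈ u, closedBall x (10 * r x) ∧
      ∑' x : u, ENNReal.ofReal (r x ^ (n - 1)) ≤ ENNReal.ofReal (1 / ((k : ℝ) + 1)) :=
    fun k => h _ (by positivity)
  choose u r hc hr hcov hsum using h'
  have : ∀ k, Countable (u k) := fun k => (hc k).to_subtype
  have hlim : Tendsto (fun k : ℕ => ENNReal.ofReal (1 / ((k : ℝ) + 1))) atTop (𝓝 0) := by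
    have := ENNReal.tendsto_ofReal (tendsto_one_div_add_atTop_nhds_zero_nat (𝕜 := ℝ))
    simpa using this
  have hdiam : ∀ k (x : u k), ediam (closedBall (x : EE n) (10 * r k x)) ≤
      ENNReal.ofReal (20 * r k x) := by
    intro k x
    rw [← Metric.closedEBall_ofReal (by have := (hr k x x.2).1; positivity)]
    refine ediam_closedEBall_le.trans (le_of_eq ?_)
    rw [show 20 * r k x = 2 * (10 * r k x) by ring, ENNReal.ofReal_mul (p := 2) (by norm_num)]
    simp
  have hle := Measure.hausdorffMeasure_le_liminf_tsum ((n : ℝ) - 1) A (l := atTop)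
    (fun k : ℕ => ENNReal.ofReal 20 * ENNReal.ofReal (1 / ((k : ℝ) + 1)))
    (by
      simpa using ENNReal.Tendsto.const_mul (a := ENNReal.ofReal 20) hlim
        (Or.inr ENNReal.ofReal_ne_top))
    (fun k (x : u k) => closedBall (x : EE n) (10 * r k x))
    (Eventually.of_forall fun k x => by
      refine (hdiam k x).trans ?_
      rw [← ENNReal.ofReal_mul (by norm_num)]
      refine ENNReal.ofReal_le_ofReal ?_
      have := (hr k x x.2).2
      linarith)
    (Eventually.of_forall fun k => by
      refine (hcov k).trans (le_of_eq ?_)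
      rw [biUnion_eq_iUnion])
  refine le_antisymm (hle.trans ?_) (zero_le)
  have hb : ∀ k, ∑' x : u k, ediam (closedBall (x : EE n) (10 * r k x)) ^ ((n : ℝ) - 1) ≤
      ENNReal.ofReal (20 ^ (n - 1)) * ENNReal.ofReal (1 / ((k : ℝ) + 1)) := by
    intro k
    calc _ ≤ ∑' x : u k, ENNReal.ofReal (20 ^ (n - 1)) * ENNReal.ofReal (r k x ^ (n - 1)) := by
          refine ENNReal.tsum_le_tsum fun x => ?_
          have hx := (hr k x x.2).1
          have e : (n : ℝ) - 1 = ((n - 1 : ℕ) : ℝ) := by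
            rw [Nat.cast_sub (by omega)]; simp
          rw [e, ENNReal.rpow_natCast, ← ENNReal.ofReal_mul (by positivity), ← mul_pow,
            ENNReal.ofReal_pow (by positivity)]
          exact pow_le_pow_left₀ (zero_le) (hdiam k x) _
      _ ≤ _ := by
          rw [ENNReal.tsum_mul_left]
          gcongr
          exact hsum k
  refine (liminf_le_liminf (Eventually.of_forall hb)).trans ?_
  have := ENNReal.Tendsto.const_mul (a := ENNReal.ofReal (20 ^ (n - 1))) hlim
    (Or.inr ENNReal.ofReal_ne_top)
  rw [mul_zero] at this
  exact this.liminf_eq.le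


/-! ### Exterior approximation implies that the exterior boundary is negligible -/

theorem volume_symm_le {n : ℕ} {Ω E E' : Set (EE n)} (hE' : E' ⊆ E) {a b δ : ℝ}
    (ha : 0 ≤ a) (hb : 0 ≤ b) (hδ : a + b ≤ δ)
    (h1 : volume ((E \ Ω) ∪ (Ω \ E)) ≤ ENNReal.ofReal a)
    (h2 : volume (E \ E') ≤ ENNReal.ofReal b) :
    volume ((E' \ Ω) ∪ (Ω \ E')) ≤ ENNReal.ofReal δ := by
  calc volume ((E' \ Ω) ∪ (Ω \ E')) ≤ volume (((E \ Ω) ∪ (Ω \ E)) ∪ (E \ E')) := by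
        refine measure_mono fun y hy => ?_
        have := @hE' y
        simp only [mem_union, Set.mem_sdiff] at hy ⊢
        tauto
    _ ≤ ENNReal.ofReal a + ENNReal.ofReal b := (measure_union_le _ _).trans (add_le_add h1 h2)
    _ = ENNReal.ofReal (a + b) := (ENNReal.ofReal_add ha hb).symm
    _ ≤ _ := ENNReal.ofReal_le_ofReal hδ

theorem necessity_aux {n : ℕ} (hn : 2 ≤ n) {γ c : ℝ} (hγ : 0 < γ) (hc : 0 < c) (hγ1 : γ ≤ 1)
    (hγω : γ ≤ volume.real (ball (0 : EE n) 1)) (hEng : Engine n γ c)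
    {Ω : Set (EE n)} (hm : MeasurableSet Ω) (hper : perimeter Ω ≠ ⊤)
    {E : ℕ → Set (EE n)} (hopen : ∀ k, IsOpen (E k)) (hsub : ∀ k, closure Ω ⊆ E k)
    (hL1 : TendstoL1 E Ω) (hlim : Tendsto (fun k => perimeter (E k)) atTop (𝓝 (perimeter Ω)))
    {r0 : ℝ} (hr0 : 0 < r0) :
    μH[(n : ℝ) - 1] {x | x ∈ closure Ω ∧ ∀ s, 0 < s → s < r0 →
      bvol Ω x s ≤ 1 / 2 * (γ * s / 4) ^ n} = 0 := by
  obtain ⟨K, hK0, hK⟩ := covering hn hγ hc hEng (α := (γ / 2) ^ n) (by positivity)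
  refine hausdorff_zero_of_cover hn fun η hη => ?_
  set P := (perimeter Ω).toReal with hP
  have hP0 : 0 ≤ P := ENNReal.toReal_nonneg
  set η1 : ℝ := η / (2 * K) with hη1
  have hη10 : 0 < η1 := by positivity
  obtain ⟨δ, hδ, hlsc⟩ := perimeter_lsc hm hη10
  obtain ⟨ε, hε, hεr, hεη, hεδ⟩ : ∃ ε : ℝ, 0 < ε ∧ ε < r0 ∧ ε ≤ η ∧
      K * ε * (P + 1) ≤ δ / 2 := by
    refine ⟨min (r0 / 2) (min η (δ / 2 / (K * (P + 1)))), by positivity, ?_, ?_, ?_⟩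
    · exact (min_le_left _ _).trans_lt (by linarith)
    · exact (min_le_right _ _).trans (min_le_left _ _)
    · calc _ ≤ K * (δ / 2 / (K * (P + 1))) * (P + 1) := by
            gcongr; exact (min_le_right _ _).trans (min_le_right _ _)
        _ = _ := by field_simp
  have e1 : ∀ᶠ k in atTop, volume ((E k \ Ω) ∪ (Ω \ E k)) ≤
      ENNReal.ofReal (min (δ / 2) (1 / 2 * (γ * ε / 4) ^ n)) :=
    ENNReal.tendsto_nhds_zero.1 hL1 _ (ENNReal.ofReal_pos.2 (by positivity))
  have e2 : ∀ᶠ k in atTop, perimeter (E k) < ENNReal.ofReal (P + min 1 η1) := by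
    refine hlim.eventually (gt_mem_nhds ?_)
    rw [← ENNReal.ofReal_toReal hper, ENNReal.ofReal_lt_ofReal_iff (by positivity)]
    have : 0 < min 1 η1 := by positivity
    linarith
  obtain ⟨k, hk1, hk2⟩ := (e1.and e2).exists
  have hEm := (hopen k).measurableSet
  have hPk : perimeter (E k) ≠ ⊤ := (hk2.trans ENNReal.ofReal_lt_top).ne
  have hPk2 : (perimeter (E k)).toReal ≤ P + min 1 η1 :=
    ENNReal.toReal_le_of_le_ofReal (by positivity) hk2.le
  set A : Set (EE n) := {x | x ∈ closure Ω ∧ ∀ s, 0 < s → s < r0 →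
      bvol Ω x s ≤ 1 / 2 * (γ * s / 4) ^ n} with hA
  have hω := volReal_ball_pos n
  have hscale : ∀ x ∈ A, ∃ s0, 0 < s0 ∧ s0 ≤ ε ∧ bvol (E k) x (2 * s0) ≤ (γ * s0) ^ n ∧
      (γ / 2) ^ n * s0 ^ n ≤ bvol (E k) x s0 := by
    intro x hx
    obtain ⟨ρ, hρ, hball⟩ := Metric.isOpen_iff.1 (hopen k) x (hsub k hx.1)
    set s := min ρ ε with hs
    have hs0 : 0 < s := by positivity
    refine transition (bvol_mono (E k) x) hγ hs0 (min_le_right _ _) ?_ ?_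
    · have h1 : E k ∩ ball x ε ⊆ (Ω ∩ ball x ε) ∪ ((E k \ Ω) ∪ (Ω \ E k)) := by
        intro y hy
        by_cases hyΩ : y ∈ Ω
        · exact Or.inl ⟨hyΩ, hy.2⟩
        · exact Or.inr (Or.inl ⟨hy.1, hyΩ⟩)
      have h2 : volume ((E k \ Ω) ∪ (Ω \ E k)) ≤ ENNReal.ofReal (1 / 2 * (γ * ε / 4) ^ n) :=
        hk1.trans (ENNReal.ofReal_le_ofReal (min_le_right _ _))
      have h3 : volume (Ω ∩ ball x ε) ≤ ENNReal.ofReal (1 / 2 * (γ * ε / 4) ^ n) := by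
        rw [ENNReal.le_ofReal_iff_toReal_le (inter_ball_lt_top _ _ _).ne (by positivity)]
        exact hx.2 ε hε hεr
      refine ENNReal.toReal_le_of_le_ofReal (by positivity) ?_
      refine (measure_mono h1).trans ((measure_union_le _ _).trans ((add_le_add h3 h2).trans ?_))
      rw [← ENNReal.ofReal_add (by positivity) (by positivity)]
      exact ENNReal.ofReal_le_ofReal (by linarith)
    · have h1 : E k ∩ ball x s = ball x s :=
        inter_eq_right.2 ((ball_subset_ball (min_le_left _ _)).trans hball)
      rw [bvol, h1, volReal_ball x hs0, show γ * s / 2 = γ / 2 * s by ring, mul_pow]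
      gcongr
      calc (γ / 2) ^ n ≤ (γ / 2) ^ 1 :=
            pow_le_pow_of_le_one (by positivity) (by linarith) (by omega)
        _ < γ := by rw [pow_one]; linarith
        _ ≤ _ := hγω
  choose! s0 h1 h2 h3 h4 using hscale
  obtain ⟨u, huA, hcnt, hcov, hsum⟩ := hK (E k) hEm hPk ε hε A s0
    (fun x hx => ⟨h1 x hx, h2 x hx, h3 x hx, h4 x hx⟩) (P - η1) (by
      intro E' hE' hsub' hvol hfin
      refine hlsc E' hE' ?_ hfin
      refine volume_symm_le hsub' (a := δ / 2) (b := δ / 2) (by positivity) (by positivity)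
        (by linarith) (hk1.trans (ENNReal.ofReal_le_ofReal (min_le_left _ _))) (hvol.trans ?_)
      refine ENNReal.ofReal_le_ofReal (le_trans ?_ hεδ)
      have : min 1 η1 ≤ 1 := min_le_left _ _
      gcongr; linarith)
  refine ⟨u, s0, hcnt, fun x hx => ⟨h1 x (huA hx), (h2 x (huA hx)).trans hεη⟩, hcov,
    hsum.trans (ENNReal.ofReal_le_ofReal ?_)⟩
  have : min 1 η1 ≤ η1 := min_le_right _ _
  calc K * ((perimeter (E k)).toReal - (P - η1)) ≤ K * (2 * η1) := by gcongr; linarith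
    _ = η := by rw [hη1]; field_simp

theorem necessity {n : ℕ} (hn : 2 ≤ n)
    {Ω : Set (EE n)} (hm : MeasurableSet Ω) (hper : perimeter Ω ≠ ⊤)
    {E : ℕ → Set (EE n)} (hopen : ∀ k, IsOpen (E k)) (hsub : ∀ k, closure Ω ⊆ E k)
    (hL1 : TendstoL1 E Ω) (hlim : Tendsto (fun k => perimeter (E k)) atTop (𝓝 (perimeter Ω))) :
    μH[(n : ℝ) - 1] (frontier Ω ∩ densityPts Ω 0) = 0 := by
  obtain ⟨γ, c, hγ, hc, hγ1, hγω, hEng⟩ := exists_engine n hn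
  refine measure_mono_null (t := ⋃ j : ℕ, {x | x ∈ closure Ω ∧ ∀ s, 0 < s → s < 1 / ((j : ℝ) + 1) →
      bvol Ω x s ≤ 1 / 2 * (γ * s / 4) ^ n}) ?_ (measure_iUnion_null fun j =>
        necessity_aux hn hγ hc hγ1 hγω hEng hm hper hopen hsub hL1 hlim (by positivity))
  rintro x ⟨hx, hx0⟩
  have := mem_densityPts_zero.1 hx0 (1 / 2 * (γ / 4) ^ n) (by positivity)
  obtain ⟨δ, hδ, h⟩ := mem_nhdsGT_iff_exists_Ioo_subset.1 this
  obtain ⟨j, hj⟩ := exists_nat_one_div_lt (show (0 : ℝ) < δ from hδ)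
  refine mem_iUnion.2 ⟨j, frontier_subset_closure hx, fun s hs hsj => ?_⟩
  have h1 : bvol Ω x s ≤ 1 / 2 * (γ / 4) ^ n * s ^ n := h ⟨hs, hsj.trans hj⟩
  refine h1.trans (le_of_eq ?_)
  rw [mul_assoc, ← mul_pow]; congr 2; ring


/-! ### Small coverings -/

/-- `A` is covered by balls with small total `(n-1)`-dimensional content. -/
def SmallCover {n : ℕ} (A : Set (EE n)) (η : ℝ) : Prop :=
  ∃ (ι : Type) (c : ι → EE n) (r : ι → ℝ), (∀ i, 0 < r i ∧ r i ≤ η) ∧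
    A ⊆ (⋃ i, ball (c i) (r i)) ∧ ∑' i, ENNReal.ofReal (r i ^ (n - 1)) ≤ ENNReal.ofReal η

theorem SmallCover.mono {n : ℕ} {A B : Set (EE n)} {η : ℝ} (h : SmallCover B η) (hAB : A ⊆ B) :
    SmallCover A η := by
  obtain ⟨ι, c, r, h1, h2, h3⟩ := h
  exact ⟨ι, c, r, h1, hAB.trans h2, h3⟩

theorem SmallCover.union {n : ℕ} {A B : Set (EE n)} {η η' : ℝ} (hA : SmallCover A η)
    (hB : SmallCover B η') (h0 : 0 ≤ η) (h0' : 0 ≤ η') : SmallCover (A ∪ B) (η + η') := by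
  obtain ⟨ι, c, r, h1, h2, h3⟩ := hA
  obtain ⟨ι', c', r', h1', h2', h3'⟩ := hB
  refine ⟨ι ⊕ ι', Sum.elim c c', Sum.elim r r', ?_, ?_, ?_⟩
  · rintro (i | i)
    · exact ⟨(h1 i).1, (h1 i).2.trans (by linarith)⟩
    · exact ⟨(h1' i).1, (h1' i).2.trans (by linarith)⟩
  · rintro x (hx | hx)
    · obtain ⟨i, hi⟩ := mem_iUnion.1 (h2 hx)
      exact mem_iUnion.2 ⟨Sum.inl i, hi⟩
    · obtain ⟨i, hi⟩ := mem_iUnion.1 (h2' hx)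
      exact mem_iUnion.2 ⟨Sum.inr i, hi⟩
  · rw [ENNReal.summable.tsum_sum ENNReal.summable, ENNReal.ofReal_add h0 h0']
    exact add_le_add h3 h3'

theorem SmallCover.finite {n : ℕ} {A : Set (EE n)} {η : ℝ} (h : SmallCover A η)
    (hA : IsCompact A) (hη : 0 ≤ η) : ∃ J : Finset (EE n × ℝ), (∀ p ∈ J, 0 < p.2 ∧ p.2 ≤ η) ∧
      A ⊆ (⋃ p ∈ J, ball p.1 p.2) ∧ ∑ p ∈ J, p.2 ^ (n - 1) ≤ η := by
  classical
  obtain ⟨ι, c, r, h1, h2, h3⟩ := h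
  obtain ⟨J, hJ⟩ := hA.elim_finite_subcover (fun i => ball (c i) (r i)) (fun i => isOpen_ball) h2
  refine ⟨J.image fun i => (c i, r i), ?_, ?_, ?_⟩
  · intro p hp
    obtain ⟨i, _, rfl⟩ := Finset.mem_image.1 hp
    exact h1 i
  · intro x hx
    obtain ⟨i, hi, hxi⟩ := mem_iUnion₂.1 (hJ hx)
    exact mem_iUnion₂.2 ⟨_, Finset.mem_image_of_mem _ hi, hxi⟩
  · have h4 : ∑ i ∈ J, r i ^ (n - 1) ≤ η := by
      have := (ENNReal.sum_le_tsum (f := fun i => ENNReal.ofReal (r i ^ (n - 1))) J).trans h3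
      rw [← ENNReal.ofReal_sum_of_nonneg fun i _ => pow_nonneg (h1 i).1.le _,
        ENNReal.ofReal_le_ofReal_iff hη] at this
      exact this
    refine le_trans ?_ h4
    refine Finset.sum_image_le_of_nonneg fun p hp => ?_
    obtain ⟨i, _, rfl⟩ := Finset.mem_image.1 hp
    exact pow_nonneg (h1 i).1.le _

theorem smallCover_of_vitali {n : ℕ} (hn : 2 ≤ n) {A u : Set (EE n)} {r : EE n → ℝ} {η : ℝ}
    (hη : 0 ≤ η)
    (hr : ∀ x ∈ u, 0 < r x ∧ r x ≤ η) (hcov : A ⊆ ⋃ x ∈ u, closedBall x (10 * r x))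
    (hs : ∑' x : u, ENNReal.ofReal (r x ^ (n - 1)) ≤ ENNReal.ofReal η) :
    SmallCover A (11 ^ (n - 1) * η) := by
  refine ⟨u, fun x => x, fun x => 11 * r x, ?_, ?_, ?_⟩
  · intro x
    have hx := hr x x.2
    refine ⟨by linarith, ?_⟩
    have : (11 : ℝ) ^ 1 ≤ 11 ^ (n - 1) := pow_le_pow_right₀ (by norm_num) (by omega)
    rw [pow_one] at this
    exact mul_le_mul this hx.2 hx.1.le (by positivity)
  · intro y hy
    obtain ⟨x, hx, hyx⟩ := mem_iUnion₂.1 (hcov hy)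
    refine mem_iUnion.2 ⟨⟨x, hx⟩, ?_⟩
    exact closedBall_subset_ball (by linarith [(hr x hx).1]) hyx
  · rw [ENNReal.ofReal_mul (by positivity)]
    calc _ = ∑' x : u, ENNReal.ofReal (11 ^ (n - 1)) * ENNReal.ofReal (r x ^ (n - 1)) := by
          refine tsum_congr fun x => ?_
          rw [← ENNReal.ofReal_mul (by positivity), mul_pow]
      _ ≤ _ := by
          rw [ENNReal.tsum_mul_left]
          gcongr

theorem smallCover_of_hausdorff {n : ℕ} (hn : 2 ≤ n) {A : Set (EE n)}
    (hA : μH[(n : ℝ) - 1] A = 0) {η : ℝ} (hη : 0 < η) : SmallCover A η := by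
  rw [Measure.hausdorffMeasure_apply] at hA
  have h1 := (ENNReal.iSup_eq_zero.1 hA) (ENNReal.ofReal (η / 2))
  have h2 := (ENNReal.iSup_eq_zero.1 h1) (ENNReal.ofReal_pos.2 (by positivity))
  have h3 : (⨅ (t : ℕ → Set (EE n)) (_ : A ⊆ ⋃ n, t n) (_ : ∀ n, ediam (t n) ≤
      ENNReal.ofReal (η / 2)), ∑' i, ⨆ _ : (t i).Nonempty, ediam (t i) ^ ((n : ℝ) - 1))
      < ENNReal.ofReal (η / 2) := by
    rw [h2]; exact ENNReal.ofReal_pos.2 (by positivity)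
  simp only [iInf_lt_iff] at h3
  obtain ⟨t, hcov, hdiam, hsum⟩ := h3
  obtain ⟨e, he0, hes⟩ := ENNReal.exists_pos_sum_of_countable (ε := ENNReal.ofReal (η / 2))
    (ENNReal.ofReal_pos.2 (by positivity)).ne' ℕ
  set d : ℕ → ℝ := fun i => (ediam (t i)).toReal with hd
  have hd0 : ∀ i, 0 ≤ d i := fun i => ENNReal.toReal_nonneg
  have hdtop : ∀ i, ediam (t i) ≠ ⊤ := fun i => ((hdiam i).trans_lt ENNReal.ofReal_lt_top).ne
  have hdη : ∀ i, d i ≤ η / 2 := fun i =>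
    ENNReal.toReal_le_of_le_ofReal (by positivity) (hdiam i)
  have hr : ∀ i, ∃ r : ℝ, d i < r ∧ r ≤ η ∧ r ^ (n - 1) ≤ d i ^ (n - 1) + e i := by
    intro i
    have hc : ContinuousAt (fun r : ℝ => r ^ (n - 1)) (d i) := by fun_prop
    have h5 : ∀ᶠ r in 𝓝 (d i), r ^ (n - 1) < d i ^ (n - 1) + e i :=
      hc.eventually (gt_mem_nhds (by have : (0 : ℝ) < e i := he0 i; linarith))
    have h6 : ∀ᶠ r in 𝓝 (d i), r < η := gt_mem_nhds (by linarith [hdη i])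
    obtain ⟨r, h7, h8, h9⟩ := ((h5.filter_mono nhdsWithin_le_nhds).and
      ((h6.filter_mono nhdsWithin_le_nhds).and (self_mem_nhdsWithin (s := Ioi (d i))))).exists
    exact ⟨r, h9, h8.le, h7.le⟩
  choose r hrd hrη hre using hr
  have hc : ∀ i, ∃ x : EE n, (t i).Nonempty → x ∈ t i := by
    intro i
    by_cases h : (t i).Nonempty
    · exact ⟨h.some, fun _ => h.some_mem⟩
    · exact ⟨0, fun h' => absurd h' h⟩
  choose c hc using hc
  refine ⟨ℕ, c, r, fun i => ⟨(hd0 i).trans_lt (hrd i), hrη i⟩, ?_, ?_⟩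
  · intro y hy
    obtain ⟨i, hi⟩ := mem_iUnion.1 (hcov hy)
    refine mem_iUnion.2 ⟨i, ?_⟩
    have h5 : edist y (c i) ≤ ediam (t i) := edist_le_ediam_of_mem hi (hc i ⟨y, hi⟩)
    rw [mem_ball]
    refine lt_of_le_of_lt ?_ (hrd i)
    rw [dist_edist]
    exact ENNReal.toReal_mono (hdtop i) h5
  · have en : (n : ℝ) - 1 = ((n - 1 : ℕ) : ℝ) := by
      rw [Nat.cast_sub (by omega)]; simp
    calc ∑' i, ENNReal.ofReal (r i ^ (n - 1)) ≤
        ∑' i, ((⨆ _ : (t i).Nonempty, ediam (t i) ^ ((n : ℝ) - 1)) + (e i : ℝ≥0∞)) := by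
          refine ENNReal.tsum_le_tsum fun i => ?_
          refine (ENNReal.ofReal_le_ofReal (hre i)).trans ?_
          rw [ENNReal.ofReal_add (pow_nonneg (hd0 i) _) (e i).coe_nonneg, ENNReal.ofReal_coe_nnreal]
          gcongr
          by_cases h : (t i).Nonempty
          · rw [iSup_pos h, en, ENNReal.rpow_natCast, ENNReal.ofReal_pow (hd0 i),
              ENNReal.ofReal_toReal (hdtop i)]
          · have : d i = 0 := by
              rw [hd]; simp [not_nonempty_iff_eq_empty.1 h]
            rw [this, zero_pow (by omega)]
            simp
      _ ≤ ENNReal.ofReal (η / 2) + ENNReal.ofReal (η / 2) := by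
          rw [ENNReal.tsum_add]
          exact add_le_add hsum.le hes.le
      _ = _ := by
          rw [← ENNReal.ofReal_add (by positivity) (by positivity)]; congr 1; ring


/-! ### Covering the thin part of the closure -/

theorem thin_cover {n : ℕ} (hn : 2 ≤ n) {γ c : ℝ} (hγ : 0 < γ) (hc : 0 < c)
    (hEng : Engine n γ c) {Ω : Set (EE n)} (hm : MeasurableSet Ω) (hper : perimeter Ω ≠ ⊤)
    {α : ℝ} (hα : 0 < α) {η : ℝ} (hη : 0 < η) :
    ∃ ε0 > 0, ε0 ≤ η ∧ ∀ ε, 0 < ε → ε ≤ ε0 → ∀ (A : Set (EE n)),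
      (∀ x ∈ A, ∃ s, 0 < s ∧ s ≤ ε ∧ bvol Ω x (2 * s) ≤ (γ * s) ^ n ∧ α * s ^ n ≤ bvol Ω x s) →
      ∃ (u : Set (EE n)) (r : EE n → ℝ), u.Countable ∧ (∀ x ∈ u, 0 < r x ∧ r x ≤ η) ∧
        A ⊆ (⋃ x ∈ u, closedBall x (10 * r x)) ∧
        ∑' x : u, ENNReal.ofReal (r x ^ (n - 1)) ≤ ENNReal.ofReal η := by
  obtain ⟨K, hK0, hK⟩ := covering hn hγ hc hEng hα
  set P := (perimeter Ω).toReal with hP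
  have hP0 : 0 ≤ P := ENNReal.toReal_nonneg
  obtain ⟨δ, hδ, hlsc⟩ := perimeter_lsc hm (η := η / K) (by positivity)
  refine ⟨min η (δ / (K * (P + 1))), by positivity, min_le_left _ _, fun ε hε hε1 A hA => ?_⟩
  have hεδ : K * ε * P ≤ δ := by
    calc K * ε * P ≤ K * (δ / (K * (P + 1))) * (P + 1) := by
          gcongr
          · exact hε1.trans (min_le_right _ _)
          · linarith
      _ = _ := by field_simp
  choose! s0 h1 h2 h3 h4 using hA
  obtain ⟨u, huA, hcnt, hcov, hsum⟩ := hK Ω hm hper ε hε A s0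
    (fun x hx => ⟨h1 x hx, h2 x hx, h3 x hx, h4 x hx⟩) (P - η / K) (by
      intro E' hE' hsub' hvol hfin
      refine hlsc E' hE' ?_ hfin
      refine volume_symm_le hsub' (a := 0) (b := δ) le_rfl (by positivity)
        (by linarith) (by simp) (hvol.trans (ENNReal.ofReal_le_ofReal hεδ)))
  refine ⟨u, s0, hcnt, fun x hx => ⟨h1 x (huA hx), (h2 x (huA hx)).trans
    (hε1.trans (min_le_left _ _))⟩, hcov, hsum.trans (ENNReal.ofReal_le_ofReal (le_of_eq ?_))⟩
  rw [← hP]; field_simp; ring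

theorem thin_null {n : ℕ} (hn : 2 ≤ n) {γ c : ℝ} (hγ : 0 < γ) (hc : 0 < c)
    (hEng : Engine n γ c) {Ω : Set (EE n)} (hm : MeasurableSet Ω) (hper : perimeter Ω ≠ ⊤)
    {α : ℝ} (hα : 0 < α) {r : ℝ} (hr : 0 < r) :
    μH[(n : ℝ) - 1] {x | (∀ s, 0 < s → s < r → bvol Ω x s ≤ (γ * s / 2) ^ n) ∧
      ∃ᶠ s in 𝓝[>] (0 : ℝ), α * s ^ n < bvol Ω x s} = 0 := by
  refine hausdorff_zero_of_cover hn fun η hη => ?_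
  obtain ⟨ε0, hε0, -, h⟩ := thin_cover hn hγ hc hEng hm hper hα hη
  refine h (min ε0 (r / 3)) (by positivity) (min_le_left _ _) _ ?_
  rintro x ⟨hx1, hx2⟩
  have h5 : ∀ᶠ s in 𝓝[>] (0 : ℝ), 0 < s ∧ s < min ε0 (r / 3) :=
    Ioo_mem_nhdsGT (by positivity)
  obtain ⟨s, hs1, hs2, hs3⟩ := (hx2.and_eventually h5).exists
  refine ⟨s, hs2, hs3.le, ?_, hs1.le⟩
  have := hx1 (2 * s) (by linarith) (by linarith [min_le_right ε0 (r / 3)])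
  rwa [show γ * (2 * s) / 2 = γ * s by ring] at this

theorem thin_closure_null {n : ℕ} (hn : 2 ≤ n) {γ c : ℝ} (hγ : 0 < γ) (hc : 0 < c)
    (hEng : Engine n γ c) {Ω : Set (EE n)} (hm : MeasurableSet Ω) (hper : perimeter Ω ≠ ⊤)
    (hH : μH[(n : ℝ) - 1] (frontier Ω ∩ densityPts Ω 0) = 0) {r : ℝ} (hr : 0 < r) :
    μH[(n : ℝ) - 1] {x | x ∈ closure Ω ∧
      ∀ s, 0 < s → s < r → bvol Ω x s ≤ (γ * s / 2) ^ n} = 0 := by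
  refine measure_mono_null (t := (frontier Ω ∩ densityPts Ω 0) ∪ ⋃ j : ℕ,
    {x | (∀ s, 0 < s → s < r → bvol Ω x s ≤ (γ * s / 2) ^ n) ∧
      ∃ᶠ s in 𝓝[>] (0 : ℝ), 1 / ((j : ℝ) + 1) * s ^ n < bvol Ω x s}) ?_
    (measure_union_null hH (measure_iUnion_null fun j =>
      thin_null hn hγ hc hEng hm hper (by positivity) hr))
  rintro x ⟨hx, hxs⟩
  by_cases h0 : x ∈ densityPts Ω 0
  · left
    refine ⟨⟨hx, fun hxi => ?_⟩, h0⟩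
    obtain ⟨ρ, hρ, hball⟩ := Metric.isOpen_iff.1 isOpen_interior x hxi
    have hω := volReal_ball_pos n
    have h1 := mem_densityPts_zero.1 h0 (volume.real (ball (0 : EE n) 1) / 2) (by positivity)
    obtain ⟨s, hs1, hs2, hs3⟩ := (h1.and (Ioo_mem_nhdsGT hρ)).exists
    have h2 : Ω ∩ ball x s = ball x s :=
      inter_eq_right.2 ((ball_subset_ball hs3.le).trans (hball.trans interior_subset))
    rw [bvol, h2, volReal_ball x hs2] at hs1
    have : 0 < s ^ n := by positivity
    nlinarith
  · right
    rw [mem_densityPts_zero] at h0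
    push Not at h0
    obtain ⟨a, ha, h1⟩ := h0
    obtain ⟨j, hj⟩ := exists_nat_one_div_lt ha
    refine mem_iUnion.2 ⟨j, hxs, ?_⟩
    have h2 : ∀ᶠ s in 𝓝[>] (0 : ℝ), 0 < s := self_mem_nhdsWithin
    refine (h1.and_eventually h2).mono fun s hs => lt_of_le_of_lt ?_ hs.1
    have := hs.2
    gcongr

theorem thin_smallCover {n : ℕ} (hn : 2 ≤ n) {γ c : ℝ} (hγ : 0 < γ) (hc : 0 < c)
    (hEng : Engine n γ c) {Ω : Set (EE n)} (hm : MeasurableSet Ω) (hper : perimeter Ω ≠ ⊤)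
    (hH : μH[(n : ℝ) - 1] (frontier Ω ∩ densityPts Ω 0) = 0) {η : ℝ} (hη : 0 < η) :
    ∃ ε0 > 0, ∀ ε, 0 < ε → ε < ε0 →
      SmallCover {x | x ∈ closure Ω ∧ bvol Ω x ε ≤ (γ * ε / 4) ^ n} η := by
  set η1 : ℝ := η / (2 * 11 ^ (n - 1)) with hη1
  have hη10 : 0 < η1 := by positivity
  obtain ⟨ε0, hε0, -, h⟩ := thin_cover hn hγ hc hEng hm hper (α := (γ / 2) ^ n) (by positivity) hη10
  refine ⟨ε0, hε0, fun ε hε hεε => ?_⟩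
  obtain ⟨u, r, -, hr, hcov, hs⟩ := h ε hε hεε.le
    {x | bvol Ω x ε ≤ (γ * ε / 4) ^ n ∧ ∃ s, 0 < s ∧ s < ε ∧ (γ * s / 2) ^ n < bvol Ω x s} (by
      rintro x ⟨hx, s, hs, hsε, h2⟩
      exact transition (bvol_mono Ω x) hγ hs hsε.le hx h2)
  have c1 := smallCover_of_vitali hn hη10.le hr hcov hs
  have c2 := smallCover_of_hausdorff hn
    (thin_closure_null hn hγ hc hEng hm hper hH hε) (η := η / 2) (by positivity)
  have c3 := c1.union c2 (by positivity) (by positivity)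
  rw [show 11 ^ (n - 1) * η1 + η / 2 = η by rw [hη1]; field_simp; ring] at c3
  refine c3.mono ?_
  rintro x ⟨hx1, hx2⟩
  by_cases h3 : ∃ s, 0 < s ∧ s < ε ∧ (γ * s / 2) ^ n < bvol Ω x s
  · exact Or.inl ⟨hx2, h3⟩
  · push Not at h3
    exact Or.inr ⟨hx1, h3⟩


/-! ### Selection of a good level -/

theorem integrable_norm_fderiv {n : ℕ} {v : EE n → ℝ} (hv : ContDiff ℝ 1 v)
    (hc : HasCompactSupport v) : Integrable (fun x => ‖fderiv ℝ v x‖) := by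
  have hv' : Continuous (fderiv ℝ v) := hv.continuous_fderiv (by norm_num)
  exact hv'.norm.integrable_of_hasCompactSupport (hc.fderiv ℝ).norm

theorem comp_div_le {n : ℕ} {v : EE n → ℝ} (hv : ContDiff ℝ 1 v) (hc : HasCompactSupport v)
    {F : ℝ → ℝ} (hF : ContDiff ℝ 1 F) {φ : EE n → EE n} (hφ : IsTest φ) {S : Set (EE n)}
    (hS : MeasurableSet S) {L : ℝ} (h0 : ∀ x, x ∉ S → deriv F (v x) = 0)
    (h1 : ∀ y, 0 ≤ deriv F y) (h2 : ∀ y, deriv F y ≤ L) :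
    ∫ x, F (v x) * vdiv φ x ≤ L * ∫ x in S, ‖fderiv ℝ v x‖ := by
  have hFv : ContDiff ℝ 1 (fun x => F (v x)) := hF.comp hv
  have hI := integrable_norm_fderiv hv hc
  rw [integral_mul_vdiv hFv hφ.smooth hφ.cpt, ← integral_neg, ← integral_indicator hS,
    ← integral_const_mul]
  have hf : ∀ x, fderiv ℝ (fun x => F (v x)) x = deriv F (v x) • fderiv ℝ v x := fun x =>
    (((hF.differentiable (by norm_num)) (v x)).hasDerivAt.comp_hasFDerivAt x
      ((hv.differentiable (by norm_num)) x).hasFDerivAt).fderiv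
  refine integral_mono (integrable_fderiv_apply hFv hφ.smooth hφ.cpt).neg
    ((hI.indicator hS).const_mul L) fun x => ?_
  have h3 := abs_fderiv_apply_le (g := v) hφ.le_one x
  simp only [hf x, smul_apply, smul_eq_mul]
  by_cases hx : x ∈ S
  · rw [indicator_of_mem hx]
    calc -(deriv F (v x) * fderiv ℝ v x (φ x)) = deriv F (v x) * (-(fderiv ℝ v x (φ x))) := by ring
      _ ≤ deriv F (v x) * ‖fderiv ℝ v x‖ := by
          have := h1 (v x)
          gcongr; exact (neg_le_abs _).trans h3
      _ ≤ _ := by gcongr; exact h2 _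
  · rw [indicator_of_notMem hx, h0 x hx]; simp

theorem perimeter_level_le {n : ℕ} {v : EE n → ℝ} (hv : ContDiff ℝ 1 v) (hc : HasCompactSupport v)
    {t D : ℝ} (hD : HasDerivAt (fun t => ∫ x in {x | v x ≤ t}, ‖fderiv ℝ v x‖) D t) :
    perimeter {x | t < v x} ≤ ENNReal.ofReal D := by
  refine relPerimeter_le fun φ hφ _ => ?_
  set M : ℝ → ℝ := fun t => ∫ x in {x | v x ≤ t}, ‖fderiv ℝ v x‖ with hM
  have hvm : Measurable v := hv.continuous.measurable
  have hI := integrable_norm_fderiv hv hc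
  have hk : ∀ k : ℕ, (0 : ℝ) < 1 / ((k : ℝ) + 1) := fun k => by positivity
  have hF := fun k : ℕ => exists_cutoff (show t < t + 1 / ((k : ℝ) + 1) by linarith [hk k]) (hk k)
  choose F hF1 hF2 hF3 hF4 hF5 hF6 hF7 hF8 hF9 using hF
  have htend := tendsto_one_div_add_atTop_nhds_zero_nat (𝕜 := ℝ)
  have hub : ∀ k : ℕ, ∫ x, F k (v x) * vdiv φ x ≤
      (1 + 1 / ((k : ℝ) + 1)) * ((1 / ((k : ℝ) + 1))⁻¹ * (M (t + 1 / ((k : ℝ) + 1)) - M t)) := by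
    intro k
    have hS : MeasurableSet {x | t < v x ∧ v x ≤ t + 1 / ((k : ℝ) + 1)} :=
      (measurableSet_lt measurable_const hvm).inter (measurableSet_le hvm measurable_const)
    refine (comp_div_le hv hc (hF1 k) hφ hS (fun x hx => ?_) (hF6 k) (hF7 k)).trans (le_of_eq ?_)
    · by_cases h : v x ≤ t
      · exact hF8 k _ h
      · refine hF9 k _ ?_
        by_contra h'
        exact hx ⟨not_le.1 h, (not_le.1 h').le⟩
    · have : M (t + 1 / ((k : ℝ) + 1)) - M t =
          ∫ x in {x | t < v x ∧ v x ≤ t + 1 / ((k : ℝ) + 1)}, ‖fderiv ℝ v x‖ := by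
        rw [hM]
        simp only
        rw [← setIntegral_sdiff (measurableSet_le hvm measurable_const) hI.integrableOn
          (show {x | v x ≤ t} ⊆ {x | v x ≤ t + 1 / ((k : ℝ) + 1)} from
            fun x (hx : v x ≤ t) => hx.trans (by linarith [hk k]))]
        congr 2
        ext x
        simp only [Set.mem_sdiff, mem_ofPred_eq, not_le]
        tauto
      rw [this, add_sub_cancel_left]; ring
  have hlim1 : Tendsto (fun k : ℕ => ∫ x, F k (v x) * vdiv φ x) atTop
      (𝓝 (∫ x in {x | t < v x}, vdiv φ x)) := by
    rw [← integral_indicator (measurableSet_lt measurable_const hvm)]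
    refine tendsto_integral_of_dominated_convergence (fun x => |vdiv φ x|) (fun k =>
      (integrable_mul_vdiv ((hF1 k).continuous.comp hv.continuous) hφ.smooth hφ.cpt).1)
      (integrable_vdiv hφ.smooth hφ.cpt).abs (fun k => Eventually.of_forall fun x => ?_)
      (Eventually.of_forall fun x => ?_)
    · rw [Real.norm_eq_abs, abs_mul, abs_of_nonneg (hF4 k _)]
      exact mul_le_of_le_one_left (abs_nonneg _) (hF5 k _)
    · by_cases hx : t < v x
      · rw [indicator_of_mem (show x ∈ {x | t < v x} from hx)]
        refine tendsto_const_nhds.congr' ?_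
        have : ∀ᶠ k : ℕ in atTop, 1 / ((k : ℝ) + 1) < v x - t :=
          htend.eventually (gt_mem_nhds (by linarith))
        filter_upwards [this] with k hk'
        rw [hF3 k _ (by linarith), one_mul]
      · rw [indicator_of_notMem (show x ∉ {x | t < v x} from hx)]
        refine tendsto_const_nhds.congr fun k => ?_
        rw [hF2 k _ (not_lt.1 hx), zero_mul]
  have hlim2 : Tendsto (fun k : ℕ => (1 + 1 / ((k : ℝ) + 1)) *
      ((1 / ((k : ℝ) + 1))⁻¹ * (M (t + 1 / ((k : ℝ) + 1)) - M t))) atTop (𝓝 ((1 + 0) * D)) := by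
    refine (htend.const_add 1).mul ?_
    have h1 := hD.tendsto_slope_zero
    have h2 : Tendsto (fun k : ℕ => 1 / ((k : ℝ) + 1)) atTop (𝓝[≠] 0) :=
      tendsto_nhdsWithin_iff.2 ⟨htend, Eventually.of_forall fun k => (hk k).ne'⟩
    exact h1.comp h2
  have := le_of_tendsto_of_tendsto' hlim1 hlim2 hub
  simpa using this

theorem level_lower {n : ℕ} {v : EE n → ℝ} (hv : ContDiff ℝ 1 v) (hc : HasCompactSupport v)
    {Ω : Set (EE n)} (hm : MeasurableSet Ω) (hb : Bornology.IsBounded Ω)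
    {φ : EE n → EE n} (hφ : IsTest φ) {C : ℝ} (hC0 : 0 < C) (hC : ∀ x, |vdiv φ x| ≤ C)
    {a b : ℝ} (ha : 0 ≤ a) (hab : a < b) (hb1 : b ≤ 1) :
    (b - a) * ∫ x in Ω, vdiv φ x ≤ (∫ x in {x | a < v x ∧ v x < b}, ‖fderiv ℝ v x‖) +
      C * ∫ x, |v x - Ω.indicator (fun _ => (1 : ℝ)) x| := by
  have hvm : Measurable v := hv.continuous.measurable
  have hI := integrable_norm_fderiv hv hc
  have hvi : Integrable v := hv.continuous.integrable_of_hasCompactSupport hc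
  have hχ := integrable_indicator_one hm hb
  set A := ∫ x in {x | a < v x ∧ v x < b}, ‖fderiv ℝ v x‖ with hA
  set B := ∫ x, |v x - Ω.indicator (fun _ => (1 : ℝ)) x| with hB
  have hba : 0 < b - a := by linarith
  have key : ∀ κ : ℝ, 0 < κ → (b - a) * ∫ x in Ω, vdiv φ x ≤ (1 + κ) * (A + C * B) := by
    intro κ hκ
    obtain ⟨F, hF1, hF2, hF3, hF4, hF5, hF6, hF7, hF8, hF9⟩ := exists_cutoff hab hκ
    have h1 : ∫ x, F (v x) * vdiv φ x ≤ (1 + κ) / (b - a) * A := by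
      refine comp_div_le hv hc hF1 hφ ((measurableSet_lt measurable_const hvm).inter
        (measurableSet_lt hvm measurable_const)) (fun x hx => ?_) hF6 hF7
      by_cases h : v x ≤ a
      · exact hF8 _ h
      · refine hF9 _ ?_
        by_contra h'
        exact hx ⟨not_le.1 h, not_le.1 h'⟩
    have hlip : ∀ y z, |F y - F z| ≤ (1 + κ) / (b - a) * |y - z| := by
      intro y z
      exact convex_univ.norm_image_sub_le_of_norm_deriv_le
        (fun x _ => (hF1.differentiable (by norm_num)) x)
        (fun x _ => by rw [Real.norm_eq_abs, abs_of_nonneg (hF6 x)]; exact hF7 x)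
        (mem_univ z) (mem_univ y)
    have hFχ : ∀ x, F (Ω.indicator (fun _ => (1 : ℝ)) x) = Ω.indicator (fun _ => (1 : ℝ)) x := by
      intro x
      by_cases hx : x ∈ Ω
      · rw [indicator_of_mem hx, hF3 1 hb1]
      · rw [indicator_of_notMem hx, hF2 0 ha]
    have i1 : Integrable (fun x => F (v x) * vdiv φ x) :=
      integrable_mul_vdiv (hF1.continuous.comp hv.continuous) hφ.smooth hφ.cpt
    have i2 : Integrable (Ω.indicator (vdiv φ)) := (integrable_vdiv hφ.smooth hφ.cpt).indicator hm
    have h2 : (∫ x in Ω, vdiv φ x) - ∫ x, F (v x) * vdiv φ x ≤ (1 + κ) / (b - a) * C * B := by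
      rw [← integral_indicator hm, ← integral_sub i2 i1, hB, ← integral_const_mul]
      refine integral_mono (i2.sub i1) ((hvi.sub hχ).abs.const_mul _) fun x => ?_
      have h3 : Ω.indicator (vdiv φ) x = Ω.indicator (fun _ => (1 : ℝ)) x * vdiv φ x := by
        by_cases hx : x ∈ Ω
        · rw [indicator_of_mem hx, indicator_of_mem hx, one_mul]
        · rw [indicator_of_notMem hx, indicator_of_notMem hx, zero_mul]
      have h4 := hlip (Ω.indicator (fun _ => (1 : ℝ)) x) (v x)
      rw [hFχ, abs_sub_comm (Ω.indicator (fun _ => (1 : ℝ)) x) (v x)] at h4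
      simp only [h3, ← sub_mul]
      calc _ ≤ |(Ω.indicator (fun _ => (1 : ℝ)) x - F (v x)) * vdiv φ x| := le_abs_self _
        _ ≤ ((1 + κ) / (b - a) * |v x - Ω.indicator (fun _ => (1 : ℝ)) x|) * C := by
            rw [abs_mul]; gcongr; exact hC x
        _ = _ := by ring
    calc (b - a) * ∫ x in Ω, vdiv φ x ≤
        (b - a) * ((1 + κ) / (b - a) * A + (1 + κ) / (b - a) * C * B) := by
          gcongr; linarith
      _ = _ := by field_simp
  have ht : Tendsto (fun κ : ℝ => (1 + κ) * (A + C * B)) (𝓝[>] 0) (𝓝 ((1 + 0) * (A + C * B))) := by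
    refine Tendsto.mono_left ?_ nhdsWithin_le_nhds
    exact ((continuous_const.add continuous_id).mul continuous_const).tendsto 0
  have := ge_of_tendsto ht (by filter_upwards [self_mem_nhdsWithin] with κ hκ using key κ hκ)
  simpa using this

theorem level_select {n : ℕ} {Ω : Set (EE n)} (hm : MeasurableSet Ω)
    (hb : Bornology.IsBounded Ω) {τ : ℝ} (hτ : 0 < τ) (hτ1 : τ ≤ 1 / 3) {η : ℝ} (hη : 0 < η) :
    ∃ δ > 0, ∀ v : EE n → ℝ, ContDiff ℝ 1 v → HasCompactSupport v →
      ∫ x, ‖fderiv ℝ v x‖ ≤ (perimeter Ω).toReal + δ →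
      ∫ x, |v x - Ω.indicator (fun _ => (1 : ℝ)) x| ≤ δ → ∀ N : Set ℝ, volume N = 0 →
      ∃ t, τ < t ∧ t < 2 * τ ∧ t ∉ N ∧
        perimeter {x | t < v x} ≤ ENNReal.ofReal ((perimeter Ω).toReal + η) ∧
        volume (({x | t < v x} \ Ω) ∪ (Ω \ {x | t < v x})) ≤ ENNReal.ofReal η := by
  set P := (perimeter Ω).toReal with hP
  obtain ⟨φ, hφ, -, hφP⟩ := exists_test Ω univ (η := η * τ / 2) (by positivity)
  obtain ⟨C, hC0, hC⟩ := exists_bound_vdiv hφ.smooth hφ.cpt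
  replace hφP : P - η * τ / 2 ≤ ∫ x in Ω, vdiv φ x := hφP.le
  refine ⟨min (η * τ / (2 * (1 + 2 * C))) (η * τ), by positivity, ?_⟩
  intro v hv hc h1 h2 N hN
  set δ := min (η * τ / (2 * (1 + 2 * C))) (η * τ) with hδ
  have hδ1 : δ * (1 + 2 * C) ≤ η * τ / 2 := by
    calc _ ≤ η * τ / (2 * (1 + 2 * C)) * (1 + 2 * C) := by gcongr; exact min_le_left _ _
      _ = _ := by field_simp
  have hvm : Measurable v := hv.continuous.measurable
  have hI := integrable_norm_fderiv hv hc
  set M : ℝ → ℝ := fun t => ∫ x in {x | v x ≤ t}, ‖fderiv ℝ v x‖ with hM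
  have hmono : Monotone M := by
    intro s t hst
    exact setIntegral_mono_set hI.integrableOn (Eventually.of_forall fun x => norm_nonneg _)
      (Eventually.of_forall fun x (hx : v x ≤ s) => hx.trans hst)
  obtain ⟨t, ht, htN, hdiff, hder⟩ := exists_deriv_le (show τ < 2 * τ by linarith)
    (hmono.monotoneOn _) hN
  refine ⟨t, ht.1, ht.2, htN, ?_, ?_⟩
  · refine (perimeter_level_le hv hc hdiff.hasDerivAt).trans (ENNReal.ofReal_le_ofReal ?_)
    refine hder.trans ?_
    have l1 := level_lower hv hc hm hb hφ hC0 hC le_rfl hτ (by linarith)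
    have l2 := level_lower hv hc hm hb hφ hC0 hC (show 0 ≤ 2 * τ by linarith)
      (show 2 * τ < 1 by linarith) le_rfl
    have m1 : MeasurableSet {x | (0 : ℝ) < v x ∧ v x < τ} :=
      (measurableSet_lt measurable_const hvm).inter (measurableSet_lt hvm measurable_const)
    have m2 : MeasurableSet {x | 2 * τ < v x ∧ v x < 1} :=
      (measurableSet_lt measurable_const hvm).inter (measurableSet_lt hvm measurable_const)
    have m3 : ∀ t, MeasurableSet {x | v x ≤ t} := fun t => measurableSet_le hvm measurable_const
    have hsum : M (2 * τ) - M τ + (∫ x in {x | 0 < v x ∧ v x < τ}, ‖fderiv ℝ v x‖) +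
        (∫ x in {x | 2 * τ < v x ∧ v x < 1}, ‖fderiv ℝ v x‖) ≤ ∫ x, ‖fderiv ℝ v x‖ := by
      rw [hM]
      simp only
      rw [← integral_indicator m1, ← integral_indicator m2, ← integral_indicator (m3 _),
        ← integral_indicator (m3 _), ← integral_sub' (hI.indicator (m3 _)) (hI.indicator (m3 _)),
        ← integral_add' ((hI.indicator (m3 _)).sub (hI.indicator (m3 _))) (hI.indicator m1),
        ← integral_add' (((hI.indicator (m3 _)).sub (hI.indicator (m3 _))).add (hI.indicator m1))
          (hI.indicator m2)]
      refine integral_mono ((((hI.indicator (m3 _)).sub (hI.indicator (m3 _))).add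
        (hI.indicator m1)).add (hI.indicator m2)) hI fun x => ?_
      have h0 := norm_nonneg (fderiv ℝ v x)
      simp only [indicator, mem_ofPred_eq, Pi.add_apply, Pi.sub_apply]
      split_ifs <;> linarith
    have hint0 : 0 ≤ ∫ x, |v x - Ω.indicator (fun _ => (1 : ℝ)) x| :=
      integral_nonneg fun x => abs_nonneg _
    rw [show 2 * τ - τ = τ by ring, div_le_iff₀ hτ]
    have l3 : C * ∫ x, |v x - Ω.indicator (fun _ => (1 : ℝ)) x| ≤ C * δ := by gcongr
    have l4 : (1 - τ) * (P - η * τ / 2) ≤ (1 - τ) * ∫ x in Ω, vdiv φ x := by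
      have : 0 ≤ 1 - τ := by linarith
      gcongr
    nlinarith [mul_pos hη hτ, mul_pos (mul_pos hη hτ) hτ]
  · have hvi : Integrable v := hv.continuous.integrable_of_hasCompactSupport hc
    have hi : Integrable (fun x => |v x - Ω.indicator (fun _ => (1 : ℝ)) x|) :=
      (hvi.sub (integrable_indicator_one hm hb)).abs
    have h3 := mul_meas_ge_le_integral_of_nonneg (Eventually.of_forall fun x => abs_nonneg _) hi τ
    have hfin : volume {x | τ ≤ |v x - Ω.indicator (fun _ => (1 : ℝ)) x|} ≠ ⊤ :=
      (hi.measure_ge_lt_top hτ).ne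
    refine (measure_mono (t := {x | τ ≤ |v x - Ω.indicator (fun _ => (1 : ℝ)) x|}) ?_).trans ?_
    · rintro x (⟨hx1, hx2⟩ | ⟨hx1, hx2⟩)
      · have hx1 : t < v x := hx1
        rw [mem_ofPred_eq, indicator_of_notMem hx2, sub_zero]
        exact le_trans (by linarith [ht.1]) (le_abs_self _)
      · have hx2 : ¬ t < v x := hx2
        rw [mem_ofPred_eq, indicator_of_mem hx1, abs_sub_comm]
        exact le_trans (by linarith [ht.2]) (le_abs_self _)
    · rw [ENNReal.le_ofReal_iff_toReal_le hfin hη.le]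
      have h4 : τ * (volume {x | τ ≤ |v x - Ω.indicator (fun _ => (1 : ℝ)) x|}).toReal ≤ η * τ :=
        h3.trans (h2.trans (min_le_right _ _))
      nlinarith


/-! ### Perturbation to a function with countably many critical values -/

theorem exists_good_direction {n : ℕ} {w : EE n → ℝ} (hw : ContDiff ℝ (⊤ : ℕ∞) w) {ρ : ℝ}
    (hρ : 0 < ρ) :
    ∃ a : EE n, ‖a‖ < ρ ∧ {x | fderiv ℝ w x = innerSL ℝ a}.Countable := by
  have hDw : ContDiff ℝ 1 (fderiv ℝ w) :=
    (hw.of_le (m := 2) (WithTop.coe_le_coe.2 le_top)).fderiv_right (m := 1) (by norm_num)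
  set L := (InnerProductSpace.toDual ℝ (EE n)).symm with hL
  set G : EE n → EE n := fun x => L (fderiv ℝ w x) with hG
  have hGd : Differentiable ℝ G :=
    L.differentiable.comp (hDw.differentiable (by norm_num))
  set S : Set (EE n) := {x | (fderiv ℝ G x).det = 0} with hS
  have h0 : volume (G '' S) = 0 :=
    addHaar_image_eq_zero_of_det_fderivWithin_eq_zero volume
      (fun x _ => (hGd x).hasFDerivAt.hasFDerivWithinAt) (fun x hx => hx)
  obtain ⟨a, ha1, ha2⟩ : ∃ a, a ∈ ball (0 : EE n) ρ ∧ a ∉ G '' S := by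
    by_contra! hcon
    have h1 : volume (ball (0 : EE n) ρ) ≤ volume (G '' S) := measure_mono hcon
    rw [h0] at h1
    exact absurd h1 (not_le.2 (measure_ball_pos _ _ hρ))
  refine ⟨a, by simpa using ha1, ?_⟩
  have hZ : {x | fderiv ℝ w x = innerSL ℝ a} = {x | G x = a} := by
    ext x
    simp only [mem_ofPred_eq, hG, hL]
    rw [LinearIsometryEquiv.symm_apply_eq]
    rfl
  rw [hZ]
  have hdisc : DiscreteTopology {x | G x = a} := by
    rw [discreteTopology_subtype_iff]
    intro x hx
    have hx' : G x = a := hx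
    have hdet : (fderiv ℝ G x).det ≠ 0 := fun h => ha2 ⟨x, h, hx'⟩
    have h1 : ∃ C, AntilipschitzWith C (fderiv ℝ G x) := by
      have := ((fderiv ℝ G x).toContinuousLinearEquivOfDetNeZero hdet).antilipschitz
      exact ⟨_, this⟩
    have h2 := (hGd x).hasFDerivAt.eventually_ne (c := a) h1
    rw [← disjoint_iff, disjoint_principal_right]
    exact h2
  exact TopologicalSpace.separableSpace_iff_countable.1 inferInstance

theorem morse {n : ℕ} {w : EE n → ℝ} (hw : ContDiff ℝ (⊤ : ℕ∞) w) (hc : HasCompactSupport w)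
    {η : ℝ} (hη : 0 < η) : ∃ v : EE n → ℝ, ContDiff ℝ (⊤ : ℕ∞) v ∧ HasCompactSupport v ∧
      ∫ x, ‖fderiv ℝ v x‖ ≤ (∫ x, ‖fderiv ℝ w x‖) + η ∧ ∫ x, |v x - w x| ≤ η ∧
      (∀ x, |v x - w x| ≤ η) ∧ ∃ N : Set ℝ, volume N = 0 ∧
        ∀ x, η < v x → v x ∉ N → fderiv ℝ v x ≠ 0 := by
  obtain ⟨R, hR⟩ := hc.isCompact.isBounded.subset_ball 0
  set R' := max R 1 with hR'
  have hR'0 : 0 < R' := lt_of_lt_of_le one_pos (le_max_right _ _)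
  have hsub : tsupport w ⊆ ball 0 R' := hR.trans (ball_subset_ball (le_max_left _ _))
  let χ : ContDiffBump (0 : EE n) := ⟨R', R' + 1, hR'0, by linarith⟩
  have hχs : ContDiff ℝ (⊤ : ℕ∞) (χ : EE n → ℝ) := χ.contDiff
  have hχ1 : ContDiff ℝ 1 (χ : EE n → ℝ) := χ.contDiff
  have hχc : HasCompactSupport (χ : EE n → ℝ) := χ.hasCompactSupport
  have hDχ : Continuous (fderiv ℝ (χ : EE n → ℝ)) := hχ1.continuous_fderiv (by norm_num)
  have i1 : Integrable (fun x => χ x + ‖x‖ * ‖fderiv ℝ χ x‖) := by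
    refine (χ.continuous.integrable_of_hasCompactSupport hχc).add ?_
    refine (continuous_norm.mul hDχ.norm).integrable_of_hasCompactSupport ?_
    exact HasCompactSupport.intro (hχc.fderiv ℝ) fun x hx => by
      simp only [Pi.mul_apply]; rw [image_eq_zero_of_notMem_tsupport hx]; simp
  have i2 : Integrable (fun x => χ x * ‖x‖) := by
    refine (χ.continuous.mul continuous_norm).integrable_of_hasCompactSupport ?_
    exact HasCompactSupport.intro hχc fun x hx => by
      rw [Pi.mul_apply, image_eq_zero_of_notMem_tsupport hx]; simp
  set C1 := ∫ x, (χ x + ‖x‖ * ‖fderiv ℝ χ x‖) with hC1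
  set C2 := ∫ x, χ x * ‖x‖ with hC2
  have hC10 : 0 ≤ C1 := integral_nonneg fun x => add_nonneg χ.nonneg (by positivity)
  have hC20 : 0 ≤ C2 := integral_nonneg fun x => mul_nonneg χ.nonneg (norm_nonneg _)
  set B := C1 + C2 + (R' + 1) with hB
  have hB0 : 0 < B := by positivity
  obtain ⟨a, ha, hcount⟩ := exists_good_direction hw (ρ := η / B) (by positivity)
  have haB : ‖a‖ * B ≤ η := by
    calc _ ≤ η / B * B := by gcongr
      _ = η := by field_simp
  have ha0 := norm_nonneg a
  set p : EE n → ℝ := fun x => χ x * innerSL ℝ a x with hp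
  have hps : ContDiff ℝ (⊤ : ℕ∞) p := hχs.mul (innerSL ℝ a).contDiff
  have hpc : HasCompactSupport p := HasCompactSupport.intro hχc fun x hx => by
    rw [hp]; simp only; rw [image_eq_zero_of_notMem_tsupport hx, zero_mul]
  have hpd : ∀ x, fderiv ℝ p x = χ x • innerSL ℝ a + (innerSL ℝ a x) • fderiv ℝ χ x := fun x =>
    (((hχ1.differentiable (by norm_num)) x).hasFDerivAt.mul (innerSL ℝ a).hasFDerivAt).fderiv
  have hin : ∀ x, |innerSL ℝ a x| ≤ ‖a‖ * ‖x‖ := fun x => abs_real_inner_le_norm a x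
  have hpb : ∀ x, |p x| ≤ ‖a‖ * (χ x * ‖x‖) := by
    intro x
    rw [hp]; simp only
    rw [abs_mul, abs_of_nonneg χ.nonneg]
    calc χ x * |innerSL ℝ a x| ≤ χ x * (‖a‖ * ‖x‖) := by
          have := χ.nonneg (x := x)
          gcongr; exact hin x
      _ = _ := by ring
  have hpη : ∀ x, |p x| ≤ η := by
    intro x
    refine (hpb x).trans ?_
    have h1 : χ x * ‖x‖ ≤ R' + 1 := by
      by_cases hx : R' + 1 ≤ dist x 0
      · rw [χ.zero_of_le_dist hx]; simp; linarith
      · rw [dist_zero_right, not_le] at hx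
        exact (mul_le_of_le_one_left (norm_nonneg _) χ.le_one).trans hx.le
    refine le_trans ?_ haB
    gcongr
    linarith
  have hpdb : ∀ x, ‖fderiv ℝ p x‖ ≤ ‖a‖ * (χ x + ‖x‖ * ‖fderiv ℝ χ x‖) := by
    intro x
    rw [hpd]
    calc _ ≤ ‖χ x • innerSL ℝ a‖ + ‖(innerSL ℝ a x) • fderiv ℝ χ x‖ := norm_add_le _ _
      _ ≤ χ x * ‖a‖ + (‖a‖ * ‖x‖) * ‖fderiv ℝ χ x‖ := by
          rw [norm_smul, norm_smul, innerSL_apply_norm, Real.norm_eq_abs,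
            abs_of_nonneg χ.nonneg, Real.norm_eq_abs]
          gcongr
          exact hin x
      _ = _ := by ring
  have hw1 : ContDiff ℝ 1 w := hw.of_le (WithTop.coe_le_coe.2 le_top)
  have hp1 : ContDiff ℝ 1 p := hps.of_le (WithTop.coe_le_coe.2 le_top)
  have hvc : HasCompactSupport (fun x => w x - p x) := hc.sub hpc
  have hvd : ∀ x, fderiv ℝ (fun x => w x - p x) x = fderiv ℝ w x - fderiv ℝ p x := fun x =>
    fderiv_fun_sub ((hw1.differentiable (by norm_num)) x) ((hp1.differentiable (by norm_num)) x)
  refine ⟨fun x => w x - p x, hw.sub hps, hvc, ?_, ?_, ?_, (fun x => w x - p x) ''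
    {x | fderiv ℝ w x = innerSL ℝ a}, (hcount.image _).measure_zero _, ?_⟩
  · calc ∫ x, ‖fderiv ℝ (fun x => w x - p x) x‖ ≤
        ∫ x, (‖fderiv ℝ w x‖ + ‖a‖ * (χ x + ‖x‖ * ‖fderiv ℝ χ x‖)) := by
          refine integral_mono (integrable_norm_fderiv (hw1.sub hp1) hvc)
            ((integrable_norm_fderiv hw1 hc).add (i1.const_mul _)) fun x => ?_
          simp only [hvd x]
          exact (norm_sub_le _ _).trans (by gcongr; exact hpdb x)
      _ = (∫ x, ‖fderiv ℝ w x‖) + ‖a‖ * C1 := by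
          rw [integral_add (integrable_norm_fderiv hw1 hc) (i1.const_mul _), integral_const_mul]
      _ ≤ _ := by
          gcongr
          refine le_trans ?_ haB
          gcongr; linarith
  · calc ∫ x, |w x - p x - w x| ≤ ∫ x, ‖a‖ * (χ x * ‖x‖) := by
          refine integral_mono_of_nonneg (Eventually.of_forall fun x => abs_nonneg _)
            (i2.const_mul _) (Eventually.of_forall fun x => ?_)
          simp only
          rw [show w x - p x - w x = - p x by ring, abs_neg]
          exact hpb x
      _ = ‖a‖ * C2 := integral_const_mul _ _
      _ ≤ _ := by
          refine le_trans ?_ haB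
          gcongr; linarith
  · intro x
    rw [show w x - p x - w x = - p x by ring, abs_neg]
    exact hpη x
  · intro x hx hxN hcrit
    refine hxN ⟨x, ?_, rfl⟩
    have hwx : w x ≠ 0 := by
      intro h
      have := hpη x
      simp only [h] at hx
      have h2 := neg_le_abs (p x)
      linarith
    have hxb : x ∈ ball (0 : EE n) R' := hsub (subset_tsupport _ hwx)
    have h1 : (χ : EE n → ℝ) =ᶠ[𝓝 x] 1 := χ.eventuallyEq_one_of_mem_ball hxb
    have h2 : fderiv ℝ χ x = 0 := by
      rw [h1.fderiv_eq]; simp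
    rw [hvd, hpd, h2, h1.eq_of_nhds] at hcrit
    simpa [sub_eq_zero] using hcrit


/-! ### Sums of bump functions -/

theorem exists_bump {n : ℕ} (hn : 2 ≤ n) : ∃ C > 0, ∀ (x : EE n) (r : ℝ), 0 < r →
    ∃ ψ : EE n → ℝ, ContDiff ℝ (⊤ : ℕ∞) ψ ∧ HasCompactSupport ψ ∧ (∀ y, 0 ≤ ψ y) ∧
      (∀ y ∈ ball x r, ψ y = 1) ∧ ∫ y, ‖fderiv ℝ ψ y‖ ≤ C * r ^ (n - 1) ∧
      ∫ y, ψ y ≤ C * r ^ n := by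
  let β : ContDiffBump (0 : EE n) := ⟨1, 2, one_pos, by norm_num⟩
  have hβ1 : ContDiff ℝ 1 (β : EE n → ℝ) := β.contDiff
  set A := ∫ y, ‖fderiv ℝ β y‖ with hA
  set B := ∫ y, β y with hB
  have hA0 : 0 ≤ A := integral_nonneg fun y => norm_nonneg _
  have hB0 : 0 ≤ B := integral_nonneg fun y => β.nonneg
  refine ⟨A + B + 1, by positivity, fun x r hr => ?_⟩
  have hcv : ∀ f : EE n → ℝ, ∫ y, f (r⁻¹ • (y - x)) = r ^ n * ∫ y, f y := by
    intro f
    rw [integral_sub_right_eq_self (fun y => f (r⁻¹ • y)) x, Measure.integral_comp_smul]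
    simp [abs_of_pos hr]
  have hlin : ContDiff ℝ (⊤ : ℕ∞) (fun y : EE n => r⁻¹ • (y - x)) := by fun_prop
  have hdlin : ∀ y, HasFDerivAt (fun y : EE n => r⁻¹ • (y - x))
      (r⁻¹ • ContinuousLinearMap.id ℝ (EE n)) y := fun y =>
    ((hasFDerivAt_id y).sub_const x).const_smul r⁻¹
  refine ⟨fun y => β (r⁻¹ • (y - x)), β.contDiff.comp hlin, ?_, fun y => β.nonneg, ?_, ?_, ?_⟩
  · refine HasCompactSupport.intro (isCompact_closedBall x (2 * r)) fun y hy => ?_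
    refine β.zero_of_le_dist ?_
    rw [mem_closedBall, dist_eq_norm, not_le] at hy
    rw [dist_zero_right, norm_smul, norm_inv, Real.norm_of_nonneg hr.le, inv_mul_eq_div]
    change 2 ≤ _
    rw [le_div_iff₀ hr]; exact hy.le
  · intro y hy
    refine β.one_of_mem_closedBall ?_
    rw [mem_ball, dist_eq_norm] at hy
    rw [mem_closedBall, dist_zero_right, norm_smul, norm_inv, Real.norm_of_nonneg hr.le,
      inv_mul_eq_div]
    change _ ≤ 1
    rw [div_le_one hr]; exact hy.le
  · have h1 : ∀ y, ‖fderiv ℝ (fun y => β (r⁻¹ • (y - x))) y‖ =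
        r⁻¹ * ‖fderiv ℝ β (r⁻¹ • (y - x))‖ := by
      intro y
      have h2 : HasFDerivAt (fun y => β (r⁻¹ • (y - x)))
          ((fderiv ℝ β (r⁻¹ • (y - x))).comp (r⁻¹ • ContinuousLinearMap.id ℝ (EE n))) y :=
        ((hβ1.differentiable (by norm_num)) _).hasFDerivAt.comp y (hdlin y)
      rw [h2.fderiv, ContinuousLinearMap.comp_smul, ContinuousLinearMap.comp_id, norm_smul,
        norm_inv, Real.norm_of_nonneg hr.le]
    simp only [h1]
    rw [integral_const_mul, hcv (fun y => ‖fderiv ℝ β y‖), ← hA]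
    have : r ^ n = r * r ^ (n - 1) := by rw [← pow_succ']; congr 1; omega
    rw [this]
    calc r⁻¹ * (r * r ^ (n - 1) * A) = A * r ^ (n - 1) := by field_simp
      _ ≤ _ := by gcongr; linarith
  · rw [hcv (fun y => β y), ← hB, mul_comm]
    gcongr; linarith

theorem exists_bumps {n : ℕ} (hn : 2 ≤ n) : ∃ C > 0, ∀ J : Finset (EE n × ℝ),
    (∀ p ∈ J, 0 < p.2) → ∃ q : EE n → ℝ, ContDiff ℝ (⊤ : ℕ∞) q ∧ HasCompactSupport q ∧
      (∀ y, 0 ≤ q y) ∧ (∀ y ∈ ⋃ p ∈ J, ball p.1 p.2, 1 ≤ q y) ∧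
      ∫ y, ‖fderiv ℝ q y‖ ≤ C * ∑ p ∈ J, p.2 ^ (n - 1) ∧
      ∫ y, q y ≤ C * ∑ p ∈ J, p.2 ^ n := by
  classical
  obtain ⟨C, hC0, hC⟩ := exists_bump hn
  refine ⟨C, hC0, fun J => ?_⟩
  induction J using Finset.induction_on with
  | empty =>
    intro _
    exact ⟨fun _ => 0, contDiff_const, HasCompactSupport.zero, fun _ => le_rfl, by simp, by simp,
      by simp⟩
  | insert p J hp ih =>
    intro hJ
    obtain ⟨q, q1, q2, q3, q4, q5, q6⟩ := ih fun p hp => hJ p (Finset.mem_insert_of_mem hp)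
    obtain ⟨ψ, s1, s2, s3, s4, s5, s6⟩ := hC p.1 p.2 (hJ p (Finset.mem_insert_self _ _))
    have q11 : ContDiff ℝ 1 q := q1.of_le (WithTop.coe_le_coe.2 le_top)
    have s11 : ContDiff ℝ 1 ψ := s1.of_le (WithTop.coe_le_coe.2 le_top)
    refine ⟨fun y => ψ y + q y, s1.add q1, s2.add q2, fun y => add_nonneg (s3 y) (q3 y), ?_, ?_, ?_⟩
    · intro y hy
      obtain ⟨p', hp', hy'⟩ := mem_iUnion₂.1 hy
      rcases Finset.mem_insert.1 hp' with rfl | h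
      · linarith [s4 y hy', q3 y]
      · have := q4 y (mem_iUnion₂.2 ⟨p', h, hy'⟩)
        linarith [s3 y]
    · rw [Finset.sum_insert hp, mul_add]
      refine le_trans ?_ (add_le_add s5 q5)
      rw [← integral_add (integrable_norm_fderiv s11 s2) (integrable_norm_fderiv q11 q2)]
      refine integral_mono (integrable_norm_fderiv (s11.add q11) (s2.add q2))
        ((integrable_norm_fderiv s11 s2).add (integrable_norm_fderiv q11 q2)) fun y => ?_
      have : fderiv ℝ (fun y => ψ y + q y) y = fderiv ℝ ψ y + fderiv ℝ q y :=
        fderiv_fun_add ((s11.differentiable (by norm_num)) y)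
          ((q11.differentiable (by norm_num)) y)
      change ‖fderiv ℝ (fun y => ψ y + q y) y‖ ≤ _
      rw [this]
      exact norm_add_le _ _
    · rw [Finset.sum_insert hp, mul_add, integral_add
        (s1.continuous.integrable_of_hasCompactSupport s2)
        (q1.continuous.integrable_of_hasCompactSupport q2)]
      exact add_le_add s6 q6


/-! ### Construction of the exterior approximation -/

theorem isSmoothSet_superlevel {n : ℕ} {v : EE n → ℝ} (hv : ContDiff ℝ (⊤ : ℕ∞) v)
    (hc : HasCompactSupport v) {t : ℝ} (ht : 0 < t) (hreg : ∀ x, v x = t → fderiv ℝ v x ≠ 0) :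
    IsSmoothSet {x | t < v x} := by
  have hfd : ∀ x, fderiv ℝ (fun x => t - v x) x = - fderiv ℝ v x := fun x => fderiv_const_sub t
  have hopen : IsOpen {x | t < v x} := isOpen_lt continuous_const hv.continuous
  have hfr : frontier {x | t < v x} = {x | t - v x = 0} := by
    ext x
    constructor
    · intro hx
      have h1 : t = v x := frontier_lt_subset_eq continuous_const hv.continuous hx
      rw [mem_ofPred_eq, ← h1, sub_self]
    · intro hx
      have hx' : v x = t := by
        rw [mem_ofPred_eq] at hx; linarith
      rw [hopen.frontier_eq]
      refine ⟨?_, fun h => ?_⟩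
      · by_contra hcl
        have h1 : ∀ᶠ y in 𝓝 x, y ∈ (closure {x | t < v x})ᶜ :=
          isClosed_closure.isOpen_compl.mem_nhds hcl
        have h2 : IsLocalMax v x := by
          filter_upwards [h1] with y hy
          rw [hx']
          by_contra h
          exact hy (subset_closure (not_le.1 h))
        exact hreg x hx' h2.fderiv_eq_zero
      · have h' : t < v x := h
        linarith
  refine ⟨hopen, ?_, fun x => t - v x, contDiff_const.sub hv, ?_, hfr, ?_⟩
  · refine hc.isCompact.isBounded.subset fun x hx => subset_tsupport _ ?_
    have h' : t < v x := hx
    exact (ht.trans h').ne'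
  · ext x
    simp only [mem_ofPred_eq, sub_neg]
  · intro x hx
    rw [hfr, mem_ofPred_eq] at hx
    rw [hfd, neg_ne_zero]
    exact hreg x (by linarith)

theorem exists_approx {n : ℕ} (hn : 2 ≤ n) {Ω : Set (EE n)} (hb : Bornology.IsBounded Ω)
    (hm : MeasurableSet Ω) (hper : perimeter Ω ≠ ⊤)
    (hH : μH[(n : ℝ) - 1] (frontier Ω ∩ densityPts Ω 0) = 0) {η : ℝ} (hη : 0 < η) :
    ∃ E : Set (EE n), IsSmoothSet E ∧ closure Ω ⊆ E ∧
      perimeter E ≤ ENNReal.ofReal ((perimeter Ω).toReal + η) ∧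
      volume ((E \ Ω) ∪ (Ω \ E)) ≤ ENNReal.ofReal η := by
  obtain ⟨γ, c, hγ, hc, hγ1, hγω, hEng⟩ := exists_engine n hn
  have hω := volReal_ball_pos n
  set ω := volume.real (ball (0 : EE n) 1) with hωdef
  set t0 := (γ / 4) ^ n / (ω * 2 ^ n) with ht0
  have ht00 : 0 < t0 := by positivity
  set τ := min (t0 / 4) (1 / 4) with hτ
  have hτ0 : 0 < τ := by positivity
  have hτ1 : τ ≤ 1 / 4 := min_le_right _ _
  have hτ2 : τ ≤ t0 / 4 := min_le_left _ _
  obtain ⟨δ, hδ, hsel⟩ := level_select hm hb hτ0 (by linarith) hη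
  obtain ⟨C, hC0, hC⟩ := exists_bumps hn
  set η1 := min 1 (δ / 3 / C) with hη1
  have hη10 : 0 < η1 := by positivity
  have hCη : C * η1 ≤ δ / 3 := by
    calc _ ≤ C * (δ / 3 / C) := by gcongr; exact min_le_right _ _
      _ = _ := by field_simp
  obtain ⟨ε0, hε0, hthin⟩ := thin_smallCover hn hγ hc hEng hm hper hH hη10
  obtain ⟨ε1, hε1, hmoll⟩ := exists_moll hm hb hper (η := δ / 3) (by positivity)
  set ε := min ε0 ε1 / 2 with hε
  have hεpos : 0 < ε := by positivity
  have hmin : 0 < min ε0 ε1 := by positivity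
  have hεε0 : ε < ε0 := by linarith [min_le_left ε0 ε1]
  have hεε1 : ε < ε1 := by linarith [min_le_right ε0 ε1]
  obtain ⟨u, us, uc, uD, uL, u0, ub⟩ := hmoll ε hεpos hεε1
  set A : Set (EE n) := {x | x ∈ closure Ω ∧ u x ≤ t0} with hA
  have hAc : IsCompact A := by
    have : A = closure Ω ∩ {x | u x ≤ t0} := rfl
    rw [this]
    exact hb.isCompact_closure.inter_right (isClosed_le us.continuous continuous_const)
  have hAcov : SmallCover A η1 := by
    refine (hthin ε hεpos hεε0).mono ?_
    rintro x ⟨hx1, hx2⟩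
    refine ⟨hx1, ?_⟩
    have h1 := ub x
    rw [volReal_ball 0 (show 0 < 2 * ε by positivity), ← hωdef] at h1
    calc bvol Ω x ε ≤ u x * (ω * (2 * ε) ^ n) := h1
      _ ≤ t0 * (ω * (2 * ε) ^ n) := by gcongr
      _ = (γ * ε / 4) ^ n := by
          rw [ht0, mul_pow, show γ * ε / 4 = γ / 4 * ε by ring, mul_pow (γ / 4)]
          field_simp
  obtain ⟨J, hJ1, hJ2, hJ3⟩ := hAcov.finite hAc hη10.le
  obtain ⟨q, qs, qc, q0, q1, qD, qL⟩ := hC J fun p hp => (hJ1 p hp).1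
  have hJ4 : ∑ p ∈ J, p.2 ^ n ≤ η1 := by
    refine le_trans (Finset.sum_le_sum fun p hp => ?_) hJ3
    exact pow_le_pow_of_le_one (hJ1 p hp).1.le ((hJ1 p hp).2.trans (min_le_left _ _)) (by omega)
  have qD' : ∫ y, ‖fderiv ℝ q y‖ ≤ δ / 3 := qD.trans (le_trans (by gcongr) hCη)
  have qL' : ∫ y, q y ≤ δ / 3 := qL.trans (le_trans (by gcongr) hCη)
  have us1 : ContDiff ℝ 1 u := us.of_le (WithTop.coe_le_coe.2 le_top)
  have qs1 : ContDiff ℝ 1 q := qs.of_le (WithTop.coe_le_coe.2 le_top)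
  have wc : HasCompactSupport (fun x => u x + q x) := uc.add qc
  obtain ⟨v, vs, vc, vD, vL, vb, N, hN, hreg⟩ := morse (us.add qs) wc
    (η := min τ (δ / 3)) (by positivity)
  have vs1 : ContDiff ℝ 1 v := vs.of_le (WithTop.coe_le_coe.2 le_top)
  have wD : ∫ x, ‖fderiv ℝ (fun x => u x + q x) x‖ ≤ (perimeter Ω).toReal + δ / 3 := by
    refine le_trans ?_ (add_le_add uD qD')
    rw [← integral_add (integrable_norm_fderiv us1 uc) (integrable_norm_fderiv qs1 qc)]
    refine integral_mono (integrable_norm_fderiv (us1.add qs1) wc)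
      ((integrable_norm_fderiv us1 uc).add (integrable_norm_fderiv qs1 qc)) fun y => ?_
    have : fderiv ℝ (fun y => u y + q y) y = fderiv ℝ u y + fderiv ℝ q y :=
      fderiv_fun_add ((us1.differentiable (by norm_num)) y)
        ((qs1.differentiable (by norm_num)) y)
    simp only [this]
    exact norm_add_le _ _
  have hmin2 : min τ (δ / 3) ≤ δ / 3 := min_le_right _ _
  have hmin1 : min τ (δ / 3) ≤ τ := min_le_left _ _
  have vD' : ∫ x, ‖fderiv ℝ v x‖ ≤ (perimeter Ω).toReal + δ := by linarith
  have iu : Integrable u := us.continuous.integrable_of_hasCompactSupport uc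
  have iq : Integrable q := qs.continuous.integrable_of_hasCompactSupport qc
  have iv : Integrable v := vs.continuous.integrable_of_hasCompactSupport vc
  have iχ := integrable_indicator_one hm hb
  have vL' : ∫ x, |v x - Ω.indicator (fun _ => (1 : ℝ)) x| ≤ δ := by
    have j1 : Integrable (fun x => |v x - (u x + q x)|) := (iv.sub (iu.add iq)).abs
    have j2 : Integrable (fun x => |u x - Ω.indicator (fun _ => (1 : ℝ)) x|) := (iu.sub iχ).abs
    have j3 : Integrable (fun x => |v x - (u x + q x)| + q x) := j1.add iq
    calc ∫ x, |v x - Ω.indicator (fun _ => (1 : ℝ)) x| ≤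
        ∫ x, (|v x - (u x + q x)| + q x + |u x - Ω.indicator (fun _ => (1 : ℝ)) x|) := by
          refine integral_mono (iv.sub iχ).abs (j3.add j2) fun x => ?_
          simp only
          have h1 := abs_add_three (v x - (u x + q x)) (q x)
            (u x - Ω.indicator (fun _ => (1 : ℝ)) x)
          rw [abs_of_nonneg (q0 x)] at h1
          refine le_trans (le_of_eq ?_) h1
          congr 1; ring
      _ = (∫ x, |v x - (u x + q x)|) + (∫ x, q x) +
          ∫ x, |u x - Ω.indicator (fun _ => (1 : ℝ)) x| := by
          rw [integral_add j3 j2, integral_add j1 iq]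
      _ ≤ δ := by
          linarith
  obtain ⟨t, ht1, ht2, htN, hPt, hVt⟩ := hsel v vs1 vc vD' vL' N hN
  refine ⟨{x | t < v x}, isSmoothSet_superlevel vs vc (hτ0.trans ht1) ?_, ?_, hPt, hVt⟩
  · intro x hx
    exact hreg x (by linarith) (by rwa [hx])
  · intro x hx
    have h1 := (abs_le.1 (vb x)).1
    have h2 : 4 * τ ≤ u x + q x := by
      by_cases hxA : u x ≤ t0
      · have := q1 x (hJ2 ⟨hx, hxA⟩)
        linarith [u0 x]
      · linarith [q0 x]
    change t < v x
    linarith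

theorem sufficiency {n : ℕ} (hn : 2 ≤ n) {Ω : Set (EE n)} (hb : Bornology.IsBounded Ω)
    (hm : MeasurableSet Ω) (hper : perimeter Ω ≠ ⊤)
    (hH : μH[(n : ℝ) - 1] (frontier Ω ∩ densityPts Ω 0) = 0) :
    ∃ E : ℕ → Set (EE n), (∀ k, IsSmoothSet (E k)) ∧ (∀ k, closure Ω ⊆ E k) ∧
      TendstoL1 E Ω ∧ Tendsto (fun k => perimeter (E k)) atTop (𝓝 (perimeter Ω)) := by
  have h := fun k : ℕ => exists_approx hn hb hm hper hH (η := 1 / ((k : ℝ) + 1)) (by positivity)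
  choose E h1 h2 h3 h4 using h
  have htend := tendsto_one_div_add_atTop_nhds_zero_nat (𝕜 := ℝ)
  have hL1 : TendstoL1 E Ω := by
    refine tendsto_of_tendsto_of_tendsto_of_le_of_le tendsto_const_nhds ?_ (fun k => zero_le) h4
    have := ENNReal.tendsto_ofReal htend
    rwa [ENNReal.ofReal_zero] at this
  refine ⟨E, h1, h2, hL1, ?_⟩
  have hfin : ∀ k, perimeter (E k) ≠ ⊤ := fun k => ((h3 k).trans_lt ENNReal.ofReal_lt_top).ne
  rw [← ENNReal.tendsto_toReal_iff hfin hper]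
  rw [Metric.tendsto_atTop]
  intro η hη
  obtain ⟨δ, hδ, hlsc⟩ := perimeter_lsc hm (half_pos hη)
  have e1 := ENNReal.tendsto_nhds_zero.1 hL1 (ENNReal.ofReal δ) (ENNReal.ofReal_pos.2 hδ)
  have e2 : ∀ᶠ k : ℕ in atTop, 1 / ((k : ℝ) + 1) < η := htend.eventually (gt_mem_nhds hη)
  obtain ⟨K, hK⟩ := eventually_atTop.1 (e1.and e2)
  refine ⟨K, fun k hk => ?_⟩
  obtain ⟨k1, k2⟩ := hK k hk
  have l1 := hlsc (E k) (h1 k).1.measurableSet k1 (hfin k)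
  have l2 := ENNReal.toReal_le_of_le_ofReal (by positivity) (h3 k)
  rw [Real.dist_eq, abs_lt]
  constructor <;> linarith

/-- For a bounded set of finite perimeter `Ω ⊆ ℝⁿ` (`n ≥ 2`),
`H^{n-1}(∂Ω ∩ Ω⁰) = 0` iff there are smooth bounded open sets `E k` with `closure Ω ⊆ E k`,
`E k → Ω` in `L¹` and `P(E k) → P(Ω)`. -/
theorem smooth_exterior_approx_iff (n : ℕ) (hn : 2 ≤ n)
    (Ω : Set (EuclideanSpace ℝ (Fin n)))
    (hb : Bornology.IsBounded Ω) (hm : MeasurableSet Ω) (hper : perimeter Ω ≠ ⊤) :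
    μH[(n : ℝ) - 1] (frontier Ω ∩ densityPts Ω 0) = 0 ↔
      ∃ E : ℕ → Set (EuclideanSpace ℝ (Fin n)),
        (∀ k, IsSmoothSet (E k)) ∧
        (∀ k, closure Ω ⊆ E k) ∧
        TendstoL1 E Ω ∧
        Tendsto (fun k => perimeter (E k)) atTop (𝓝 (perimeter Ω)) := by
  constructor
  · intro hH
    exact sufficiency hn hb hm hper hH
  · rintro ⟨E, h1, h2, h3, h4⟩
    exact necessity hn hm hper (fun k => (h1 k).1) h2 h3 h4
end
end

section
/- In ℝ², let R = (−1,1) × (−1,1), S = (−1,1) × {0}, and Ω = R \ S = R₁ ∪ R₂, where R₁ = (−1,1) × (0,1) and R₂ = (−1,1) × (−1,0). Then for every sequence of Lebesgue measurable sets E_k with E_k ⋐ Ω for all k and E_k → Ω in L¹, one has liminf_{k→∞} P(E_k) ≥ P(R₁) + P(R₂) = P(Ω) + 2·H¹(S) > P(Ω). -/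
open MeasureTheory Metric Filter Set
open scoped ENNReal Topology NNReal

noncomputable section

/-- The open upper rectangle `R₁ = (-1,1) × (0,1)` in `ℝ²`. -/
def Rup : Set (EuclideanSpace ℝ (Fin 2)) :=
  {x | x 0 ∈ Set.Ioo (-1 : ℝ) 1 ∧ x 1 ∈ Set.Ioo (0 : ℝ) 1}

/-- The open lower rectangle `R₂ = (-1,1) × (-1,0)` in `ℝ²`. -/
def Rdown : Set (EuclideanSpace ℝ (Fin 2)) :=
  {x | x 0 ∈ Set.Ioo (-1 : ℝ) 1 ∧ x 1 ∈ Set.Ioo (-1 : ℝ) 0}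

/-- The slit `S = (-1,1) × {0}` in `ℝ²`. -/
def slitS : Set (EuclideanSpace ℝ (Fin 2)) :=
  {x | x 0 ∈ Set.Ioo (-1 : ℝ) 1 ∧ x 1 = 0}


def boxR (a b c d : ℝ) : Set (EuclideanSpace ℝ (Fin 2)) :=
  {x | x 0 ∈ Set.Ioo a b ∧ x 1 ∈ Set.Ioo c d}

def e2 : (ℝ × ℝ) ≃L[ℝ] (EuclideanSpace ℝ (Fin 2)) :=
  (ContinuousLinearEquiv.finTwoArrow ℝ ℝ).symm.trans (EuclideanSpace.equiv (Fin 2) ℝ).symm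

lemma e2_zero (p : ℝ × ℝ) : e2 p 0 = p.1 := by
  simp [e2]

lemma e2_one (p : ℝ × ℝ) : e2 p 1 = p.2 := by
  simp [e2]

lemma e2_single0 : e2 (1, 0) = EuclideanSpace.single 0 1 := by
  ext i; fin_cases i <;> simp [e2_zero, e2_one]

lemma e2_single1 : e2 (0, 1) = EuclideanSpace.single 1 1 := by
  ext i; fin_cases i <;> simp [e2_zero, e2_one]

lemma e2_mp : MeasurePreserving e2 volume volume := by
  have h1 := (volume_preserving_finTwoArrow ℝ).symm _
  have h2 := (EuclideanSpace.volume_preserving_symm_measurableEquiv_toLp (Fin 2)).symm _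
  exact h2.comp h1

lemma vdiv_eq (φ : (EuclideanSpace ℝ (Fin 2)) → (EuclideanSpace ℝ (Fin 2))) (x : (EuclideanSpace ℝ (Fin 2))) : vdiv φ x =
    fderiv ℝ φ x (e2 (1, 0)) 0 + fderiv ℝ φ x (e2 (0, 1)) 1 := by
  simp [vdiv, Fin.sum_univ_two, e2_single0, e2_single1]

lemma vdiv_continuous {φ : (EuclideanSpace ℝ (Fin 2)) → (EuclideanSpace ℝ (Fin 2))} (h : ContDiff ℝ 1 φ) : Continuous (vdiv φ) := by
  have : Continuous (fderiv ℝ φ) := h.continuous_fderiv (by norm_num)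
  have h2 : vdiv φ = fun x => fderiv ℝ φ x (e2 (1, 0)) 0 + fderiv ℝ φ x (e2 (0, 1)) 1 :=
    funext (vdiv_eq φ)
  rw [h2]
  fun_prop

lemma vdiv_hcs {φ : (EuclideanSpace ℝ (Fin 2)) → (EuclideanSpace ℝ (Fin 2))} (h : HasCompactSupport φ) : HasCompactSupport (vdiv φ) := by
  have h1 : HasCompactSupport (fderiv ℝ φ) := h.fderiv ℝ
  refine h1.mono ?_
  intro x hx hx'
  apply hx
  rw [vdiv_eq, hx']; simp

lemma vdiv_integrable {φ : (EuclideanSpace ℝ (Fin 2)) → (EuclideanSpace ℝ (Fin 2))} (h : ContDiff ℝ 1 φ) (h' : HasCompactSupport φ) :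
    Integrable (vdiv φ) :=
  (vdiv_continuous h).integrable_of_hasCompactSupport (vdiv_hcs h')

lemma boxR_ae (a b c d : ℝ) : e2 ⁻¹' (boxR a b c d) =ᵐ[volume] Icc (a, c) (b, d) := by
  have : e2 ⁻¹' (boxR a b c d) = Ioo a b ×ˢ Ioo c d := by
    ext p; simp [boxR, e2_zero, e2_one]
  rw [this, ← Icc_prod_Icc]
  exact Measure.set_prod_ae_eq Ioo_ae_eq_Icc Ioo_ae_eq_Icc

lemma box_div {φ : (EuclideanSpace ℝ (Fin 2)) → (EuclideanSpace ℝ (Fin 2))} (h : ContDiff ℝ 1 φ) {a b c d : ℝ} (hab : a ≤ b) (hcd : c ≤ d) :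
    ∫ x in boxR a b c d, vdiv φ x =
      (((∫ x in a..b, φ (e2 (x, d)) 1) - ∫ x in a..b, φ (e2 (x, c)) 1) +
          ∫ y in c..d, φ (e2 (b, y)) 0) - ∫ y in c..d, φ (e2 (a, y)) 0 := by
  rw [← e2_mp.setIntegral_preimage_emb e2.toHomeomorph.measurableEmbedding,
    setIntegral_congr_set (boxR_ae a b c d)]
  have hd : ∀ (i : Fin 2) (p : ℝ × ℝ), HasFDerivAt (fun p => φ (e2 p) i)
      ((EuclideanSpace.proj (𝕜 := ℝ) i : (EuclideanSpace ℝ (Fin 2)) →L[ℝ] ℝ) ∘L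
        (fderiv ℝ φ (e2 p) ∘L (e2 : (ℝ × ℝ) →L[ℝ] (EuclideanSpace ℝ (Fin 2))))) p := by
    intro i p
    have h1 : HasFDerivAt φ (fderiv ℝ φ (e2 p)) (e2 p) :=
      (h.differentiable (by norm_num) _).hasFDerivAt
    exact (EuclideanSpace.proj (𝕜 := ℝ) i : (EuclideanSpace ℝ (Fin 2)) →L[ℝ] ℝ).hasFDerivAt.comp p
      (h1.comp p e2.hasFDerivAt)
  have hc : ∀ i : Fin 2, Continuous (fun p => φ (e2 p) i) := fun i =>
    continuous_iff_continuousAt.2 fun p => (hd i p).continuousAt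
  have key := integral_divergence_prod_Icc_of_hasFDerivAt_off_countable_of_le
    (fun p => φ (e2 p) 0) (fun p => φ (e2 p) 1) _ _ (a, c) (b, d) ⟨hab, hcd⟩ ∅ countable_empty
    (hc 0).continuousOn (hc 1).continuousOn (fun x _ => hd 0 x) (fun x _ => hd 1 x) (by
      refine Continuous.integrableOn_Icc ?_
      have := (vdiv_continuous h).comp e2.continuous
      refine this.congr fun x => ?_
      simp [vdiv_eq])
  rw [← key]
  refine setIntegral_congr_fun measurableSet_Icc fun x _ => ?_
  simp [vdiv_eq]

lemma intervalIntegral_abs_le {f : ℝ → ℝ} {a b : ℝ} (hab : a ≤ b) (h : ∀ x, |f x| ≤ 1) :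
    |∫ x in a..b, f x| ≤ b - a := by
  have := intervalIntegral.norm_integral_le_of_norm_le_const (a := a) (b := b) (f := f) (C := 1)
    (fun x _ => h x)
  rw [abs_of_nonneg (sub_nonneg.2 hab)] at this
  simpa using this

lemma le_perimeter {E : Set (EuclideanSpace ℝ (Fin 2))} {φ : (EuclideanSpace ℝ (Fin 2)) → (EuclideanSpace ℝ (Fin 2))} (h : ContDiff ℝ 1 φ) (h' : HasCompactSupport φ)
    (h1 : ∀ x, ‖φ x‖ ≤ 1) : ENNReal.ofReal (∫ x in E, vdiv φ x) ≤ perimeter E := by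
  unfold perimeter relPerimeter
  exact le_iSup_of_le φ (le_iSup_of_le h (le_iSup_of_le h' (le_iSup_of_le (subset_univ _)
    (le_iSup_of_le h1 le_rfl))))

lemma perimeter_le {E : Set (EuclideanSpace ℝ (Fin 2))} {C : ℝ≥0∞} (H : ∀ φ : (EuclideanSpace ℝ (Fin 2)) → (EuclideanSpace ℝ (Fin 2)), ContDiff ℝ 1 φ →
    HasCompactSupport φ → (∀ x, ‖φ x‖ ≤ 1) → ENNReal.ofReal (∫ x in E, vdiv φ x) ≤ C) :
    perimeter E ≤ C := by
  unfold perimeter relPerimeter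
  exact iSup_le fun φ => iSup_le fun h => iSup_le fun h' => iSup_le fun _ => iSup_le fun h1 =>
    H φ h h' h1

lemma lt_perimeter {E : Set (EuclideanSpace ℝ (Fin 2))} {r : ℝ≥0∞} (hr : r < perimeter E) : ∃ φ : (EuclideanSpace ℝ (Fin 2)) → (EuclideanSpace ℝ (Fin 2)),
    ContDiff ℝ 1 φ ∧ HasCompactSupport φ ∧ (∀ x, ‖φ x‖ ≤ 1) ∧
      r < ENNReal.ofReal (∫ x in E, vdiv φ x) := by
  by_contra! H
  exact absurd (perimeter_le H) (not_le.2 hr)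

lemma perimeter_box_le {a b c d : ℝ} (hab : a ≤ b) (hcd : c ≤ d) :
    perimeter (boxR a b c d) ≤ ENNReal.ofReal (2 * (b - a) + 2 * (d - c)) := by
  refine perimeter_le fun φ h _ h1 => ENNReal.ofReal_le_ofReal ?_
  rw [box_div h hab hcd]
  have hb : ∀ x i, |φ x i| ≤ 1 := fun x i => (PiLp.norm_apply_le (φ x) i).trans (h1 x)
  have i1 := abs_le.1 (intervalIntegral_abs_le hab (fun x => hb (e2 (x, d)) 1))
  have i2 := abs_le.1 (intervalIntegral_abs_le hab (fun x => hb (e2 (x, c)) 1))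
  have i3 := abs_le.1 (intervalIntegral_abs_le hcd (fun x => hb (e2 (b, x)) 0))
  have i4 := abs_le.1 (intervalIntegral_abs_le hcd (fun x => hb (e2 (a, x)) 0))
  linarith [i1.2, i2.1, i3.2, i4.1]

/-- plateau cutoff -/
lemma exists_plateau {a b ε : ℝ} (hε : 0 < ε) (hab : 4 * ε < b - a) : ∃ p : ℝ → ℝ,
    ContDiff ℝ 1 p ∧ (∀ x, 0 ≤ p x) ∧ (∀ x, p x ≤ 1) ∧ (∀ x, p x ≠ 0 → a + ε < x ∧ x < b - ε) ∧
    b - a - 4 * ε ≤ ∫ x in a..b, p x := by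
  let B : ContDiffBump ((a + b) / 2) := ⟨(b - a) / 2 - 2 * ε, (b - a) / 2 - ε, by linarith,
    by linarith⟩
  refine ⟨B, B.contDiff, fun x => B.nonneg, fun x => B.le_one, fun x hx => ?_, ?_⟩
  · have : x ∈ Function.support B := hx
    rw [B.support_eq, mem_ball, Real.dist_eq, abs_lt] at this
    change _ ∧ _ < (b - a) / 2 - ε at this
    have h1 := this.1
    change - ((b - a) / 2 - ε) < _ at h1
    constructor <;> linarith [this.2]
  · have hi : ∀ u v : ℝ, IntervalIntegrable B volume u v := fun u v =>
      B.continuous.intervalIntegrable u v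
    have h1 : ∫ x in (a + 2 * ε)..(b - 2 * ε), B x = ∫ x in (a + 2 * ε)..(b - 2 * ε), (1:ℝ) := by
      refine intervalIntegral.integral_congr fun x hx => ?_
      rw [uIcc_of_le (by linarith)] at hx
      apply B.one_of_mem_closedBall
      rw [mem_closedBall, Real.dist_eq, abs_le]
      change - ((b - a) / 2 - 2 * ε) ≤ _ ∧ _ ≤ (b - a) / 2 - 2 * ε
      constructor <;> linarith [hx.1, hx.2]
    have h2 : ∫ x in (a + 2 * ε)..(b - 2 * ε), B x ≤ ∫ x in a..b, B x :=
      intervalIntegral.integral_mono_interval (by linarith) (by linarith) (by linarith)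
        (Eventually.of_forall fun x => B.nonneg) (hi _ _)
    simp only [intervalIntegral.integral_const, smul_eq_mul, mul_one] at h1
    linarith

/-- odd end-point function -/
lemma exists_ends {a b ε : ℝ} (hε : 0 < ε) (hab : 4 * ε < b - a) : ∃ f : ℝ → ℝ,
    ContDiff ℝ 1 f ∧ (∀ x, |f x| ≤ 1) ∧
    (∀ x, f x ≠ 0 → a - ε < x ∧ x < b + ε ∧ ¬ (a + ε < x ∧ x < b - ε)) ∧ f a = -1 ∧ f b = 1 := by
  let B : ∀ t : ℝ, ContDiffBump t := fun t => ⟨ε / 2, ε, by linarith, by linarith⟩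
  have hB : ∀ t x, B t x ≠ 0 → t - ε < x ∧ x < t + ε := by
    intro t x hx
    have : x ∈ Function.support (B t) := hx
    rw [(B t).support_eq, mem_ball, Real.dist_eq, abs_lt] at this
    have h1 : -ε < _ := this.1
    have h2 : _ < ε := this.2
    constructor <;> linarith
  have hB0 : ∀ t x, ε ≤ |x - t| → B t x = 0 := fun t x h => (B t).zero_of_le_dist h
  have hB1 : ∀ t, B t t = 1 := fun t => (B t).one_of_mem_closedBall
    (mem_closedBall_self (by change 0 ≤ ε / 2; linarith))
  refine ⟨fun x => B b x - B a x, (B b).contDiff.sub (B a).contDiff, fun x => ?_, fun x hx => ?_,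
    ?_, ?_⟩
  · have := (B b).nonneg (x := x); have := (B b).le_one (x := x)
    have := (B a).nonneg (x := x); have := (B a).le_one (x := x)
    rw [abs_le]; constructor <;> linarith
  · by_cases h : B b x = 0
    · have h2 : B a x ≠ 0 := by
        intro h2; apply hx; simp [h, h2]
      have := hB _ _ h2
      refine ⟨by linarith, by linarith, fun h => by linarith⟩
    · have := hB _ _ h
      refine ⟨by linarith, by linarith, fun h => by linarith⟩
  · simp only [hB1]
    rw [hB0 b a (by rw [abs_of_neg] <;> linarith)]; norm_num
  · simp only [hB1]
    rw [hB0 a b (by rw [abs_of_pos] <;> linarith)]; norm_num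

lemma le_perimeter_box_eps {a b c d ε : ℝ} (hε : 0 < ε) (hab : 4 * ε < b - a)
    (hcd : 4 * ε < d - c) :
    ENNReal.ofReal (2 * (b - a) + 2 * (d - c) - 16 * ε) ≤ perimeter (boxR a b c d) := by
  obtain ⟨p, pc, p0, p1, ps, pI⟩ := exists_plateau hε hab
  obtain ⟨q, qc, q0, q1, qs, qI⟩ := exists_plateau hε hcd
  obtain ⟨f, fc, f1, fs, fa, fb⟩ := exists_ends hε hab
  obtain ⟨g, gc, g1, gs, ga, gb⟩ := exists_ends hε hcd
  let φ : (EuclideanSpace ℝ (Fin 2)) → (EuclideanSpace ℝ (Fin 2)) := fun x => e2 (f (x 0) * q (x 1), p (x 0) * g (x 1))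
  have hφ0 : ∀ x, φ x 0 = f (x 0) * q (x 1) := fun x => e2_zero _
  have hφ1 : ∀ x, φ x 1 = p (x 0) * g (x 1) := fun x => e2_one _
  have hc : ContDiff ℝ 1 φ := by
    have h0 : ContDiff ℝ 1 (fun x : (EuclideanSpace ℝ (Fin 2)) => x 0) :=
      (EuclideanSpace.proj (𝕜 := ℝ) 0 : (EuclideanSpace ℝ (Fin 2)) →L[ℝ] ℝ).contDiff
    have h1 : ContDiff ℝ 1 (fun x : (EuclideanSpace ℝ (Fin 2)) => x 1) :=
      (EuclideanSpace.proj (𝕜 := ℝ) 1 : (EuclideanSpace ℝ (Fin 2)) →L[ℝ] ℝ).contDiff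
    exact e2.contDiff.comp (((fc.comp h0).mul (qc.comp h1)).prodMk ((pc.comp h0).mul (gc.comp h1)))
  have hs : HasCompactSupport φ := by
    have hK : IsCompact (e2 '' (Icc (a - ε, c - ε) (b + ε, d + ε))) :=
      isCompact_Icc.image e2.continuous
    refine HasCompactSupport.intro hK fun x hx => ?_
    by_contra hne
    apply hx
    refine ⟨(x 0, x 1), ?_, ?_⟩
    · by_cases h0 : f (x 0) * q (x 1) = 0
      · have h1 : p (x 0) * g (x 1) ≠ 0 := by
          intro h1; apply hne; change e2 _ = 0; rw [h0, h1]; exact map_zero e2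
        have := ps _ (left_ne_zero_of_mul h1); have := gs _ (right_ne_zero_of_mul h1)
        refine ⟨⟨?_, ?_⟩, ⟨?_, ?_⟩⟩ <;> simp only <;> linarith
      · have := fs _ (left_ne_zero_of_mul h0); have := qs _ (right_ne_zero_of_mul h0)
        refine ⟨⟨?_, ?_⟩, ⟨?_, ?_⟩⟩ <;> simp only <;> linarith
    · ext i; fin_cases i
      · exact e2_zero _
      · exact e2_one _
  have hn : ∀ x, ‖φ x‖ ≤ 1 := by
    intro x
    rw [EuclideanSpace.norm_eq, Real.sqrt_le_iff, Fin.sum_univ_two, hφ0, hφ1]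
    refine ⟨by norm_num, ?_⟩
    simp only [Real.norm_eq_abs, sq_abs, one_pow]
    have hp := p0 (x 0); have hp1 := p1 (x 0); have hq := q0 (x 1); have hq1 := q1 (x 1)
    have hf := f1 (x 0); have hg := g1 (x 1)
    have sp : p (x 0) ^ 2 ≤ 1 := by nlinarith
    have sq : q (x 1) ^ 2 ≤ 1 := by nlinarith
    have sf : f (x 0) ^ 2 ≤ 1 := (sq_le_one_iff_abs_le_one _).2 hf
    have sg : g (x 1) ^ 2 ≤ 1 := (sq_le_one_iff_abs_le_one _).2 hg
    by_cases h : p (x 0) = 0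
    · rw [h, mul_pow]; nlinarith [sq_nonneg (f (x 0)), sq_nonneg (q (x 1))]
    · have : f (x 0) = 0 := by
        by_contra h2
        exact (fs _ h2).2.2 (ps _ h)
      rw [this, mul_pow, mul_pow]; nlinarith [sq_nonneg (p (x 0)), sq_nonneg (g (x 1))]
  refine le_trans (ENNReal.ofReal_le_ofReal ?_) (le_perimeter hc hs hn)
  rw [box_div hc (by linarith) (by linarith)]
  simp only [hφ0, hφ1, e2_zero, e2_one, fa, fb, ga, gb, intervalIntegral.integral_mul_const,
    intervalIntegral.integral_const_mul]
  linarith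

lemma perimeter_box {a b c d : ℝ} (hab : a < b) (hcd : c < d) :
    perimeter (boxR a b c d) = ENNReal.ofReal (2 * (b - a) + 2 * (d - c)) := by
  refine le_antisymm (perimeter_box_le hab.le hcd.le) ?_
  have ht : Tendsto (fun ε : ℝ => ENNReal.ofReal (2 * (b - a) + 2 * (d - c) - 16 * ε)) (𝓝[>] 0)
      (𝓝 (ENNReal.ofReal (2 * (b - a) + 2 * (d - c)))) := by
    have : Continuous (fun ε : ℝ => ENNReal.ofReal (2 * (b - a) + 2 * (d - c) - 16 * ε)) :=
      ENNReal.continuous_ofReal.comp (by fun_prop)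
    have h := (this.tendsto 0).mono_left (nhdsWithin_le_nhds (s := Ioi 0))
    simpa using h
  refine le_of_tendsto ht ?_
  have e1 : ∀ᶠ ε : ℝ in 𝓝[>] 0, ε < (b - a) / 4 :=
    nhdsWithin_le_nhds (Iio_mem_nhds (by linarith))
  have e2 : ∀ᶠ ε : ℝ in 𝓝[>] 0, ε < (d - c) / 4 :=
    nhdsWithin_le_nhds (Iio_mem_nhds (by linarith))
  filter_upwards [e1, e2, self_mem_nhdsWithin] with ε h1 h2 h3
  exact le_perimeter_box_eps h3 (by linarith) (by linarith)

lemma Rup_eq : Rup = boxR (-1) 1 0 1 := rfl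
lemma Rdown_eq : Rdown = boxR (-1) 1 (-1) 0 := rfl

lemma Rup_per : perimeter Rup = 6 := by
  rw [Rup_eq, perimeter_box (by norm_num) (by norm_num)]; norm_num

lemma Rdown_per : perimeter Rdown = 6 := by
  rw [Rdown_eq, perimeter_box (by norm_num) (by norm_num)]; norm_num

lemma Omega_ae : (Rup ∪ Rdown : Set (EuclideanSpace ℝ (Fin 2))) =ᵐ[volume] boxR (-1) 1 (-1) 1 := by
  have h0 : volume {x : (EuclideanSpace ℝ (Fin 2)) | x 1 = 0} = 0 := by
    rw [← e2_mp.measure_preimage_emb e2.toHomeomorph.measurableEmbedding]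
    have : e2 ⁻¹' {x : (EuclideanSpace ℝ (Fin 2)) | x 1 = 0} = univ ×ˢ {(0:ℝ)} := by
      ext p; simp [e2_one]
    rw [this, Measure.volume_eq_prod, Measure.prod_prod]; simp
  have h1 : ∀ᵐ x : (EuclideanSpace ℝ (Fin 2)), x 1 ≠ 0 := by
    rw [ae_iff]; simpa using h0
  filter_upwards [h1] with x hx
  apply propext
  change ((_ ∧ _ ∧ _) ∨ (_ ∧ _ ∧ _)) ↔ (_ ∧ _ ∧ _)
  constructor
  · rintro (⟨h, h2, h3⟩ | ⟨h, h2, h3⟩)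
    · exact ⟨h, by linarith, h3⟩
    · exact ⟨h, h2, by linarith⟩
  · rintro ⟨h, h2, h3⟩
    rcases lt_or_gt_of_ne hx with h4 | h4
    · exact Or.inr ⟨h, h2, h4⟩
    · exact Or.inl ⟨h, h4, h3⟩

lemma perimeter_congr {E F : Set (EuclideanSpace ℝ (Fin 2))} (h : E =ᵐ[volume] F) : perimeter E = perimeter F := by
  unfold perimeter relPerimeter
  simp only [setIntegral_congr_set h]

lemma Omega_per : perimeter (Rup ∪ Rdown) = 8 := by
  rw [perimeter_congr Omega_ae, perimeter_box (by norm_num) (by norm_num)]; norm_num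

lemma slit_meas : μH[(1 : ℝ)] slitS = 2 := by
  have : slitS = (fun t : ℝ => (EuclideanSpace.single 0 t : (EuclideanSpace ℝ (Fin 2)))) '' Ioo (-1) 1 := by
    ext x
    constructor
    · rintro ⟨h, h2⟩
      refine ⟨x 0, h, ?_⟩
      ext i; fin_cases i <;> simp [h2]
    · rintro ⟨t, ht, rfl⟩
      exact ⟨by simpa using ht, by simp⟩
  rw [this, Isometry.hausdorffMeasure_image _ (Or.inl (by norm_num)), hausdorffMeasure_real,
    Real.volume_Ioo]
  · norm_num
  · exact Isometry.of_dist_eq fun x y => by simp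

lemma vdiv_congr {φ ψ : (EuclideanSpace ℝ (Fin 2)) → (EuclideanSpace ℝ (Fin 2))} {x : (EuclideanSpace ℝ (Fin 2))} (h : φ =ᶠ[𝓝 x] ψ) : vdiv φ x = vdiv ψ x := by
  unfold vdiv; rw [h.fderiv_eq]

lemma meas_box (a b c d : ℝ) : MeasurableSet (boxR a b c d) := by
  have h : ∀ i : Fin 2, Measurable (fun x : (EuclideanSpace ℝ (Fin 2)) => x i) := fun i =>
    (EuclideanSpace.proj (𝕜 := ℝ) i : (EuclideanSpace ℝ (Fin 2)) →L[ℝ] ℝ).continuous.measurable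
  exact (h 0 measurableSet_Ioo).inter (h 1 measurableSet_Ioo)

lemma exists_step {δ : ℝ} (hδ : 0 < δ) : ∃ s : ℝ → ℝ, ContDiff ℝ 1 s ∧ (∀ t ≤ 0, s t = 0) ∧
    (∀ t, δ / 2 ≤ t → s t = 1) ∧ (∀ t, 0 ≤ s t) ∧ (∀ t, s t ≤ 1) :=
  ⟨fun t => Real.smoothTransition (t / (δ / 2)),
   (Real.smoothTransition.contDiff (n := 1)).comp (contDiff_id.div_const _),
   fun _ ht => Real.smoothTransition.zero_of_nonpos
    (div_nonpos_of_nonpos_of_nonneg ht (by linarith)),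
   fun _ ht => Real.smoothTransition.one_of_one_le ((one_le_div (by linarith)).2 ht),
   fun _ => Real.smoothTransition.nonneg _, fun _ => Real.smoothTransition.le_one _⟩

lemma glue {E : Set (EuclideanSpace ℝ (Fin 2))} (hE : MeasurableSet E) (hcc : CpctContained E (Rup ∪ Rdown))
    {φ ψ : (EuclideanSpace ℝ (Fin 2)) → (EuclideanSpace ℝ (Fin 2))} (hφ : ContDiff ℝ 1 φ) (hφs : HasCompactSupport φ) (hφ1 : ∀ x, ‖φ x‖ ≤ 1)
    (hψ : ContDiff ℝ 1 ψ) (hψs : HasCompactSupport ψ) (hψ1 : ∀ x, ‖ψ x‖ ≤ 1) :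
    ENNReal.ofReal ((∫ x in Rup ∩ E, vdiv φ x) + ∫ x in Rdown ∩ E, vdiv ψ x) ≤ perimeter E := by
  have h1 : ContDiff ℝ 1 (fun x : (EuclideanSpace ℝ (Fin 2)) => x 1) :=
    (EuclideanSpace.proj (𝕜 := ℝ) 1 : (EuclideanSpace ℝ (Fin 2)) →L[ℝ] ℝ).contDiff
  obtain ⟨δ, hδ, hδE⟩ := hcc.1.exists_forall_le' (f := fun x : (EuclideanSpace ℝ (Fin 2)) => |x 1|) (a := 0)
    (h1.continuous.abs.continuousOn) (by
      intro x hx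
      rcases hcc.2 hx with h | h
      · exact abs_pos.2 h.2.1.ne'
      · exact abs_pos.2 h.2.2.ne)
  obtain ⟨s, sc, s0, s1, sn, sl⟩ := exists_step hδ
  obtain ⟨Φ, hΦ⟩ : ∃ Φ : (EuclideanSpace ℝ (Fin 2)) → (EuclideanSpace ℝ (Fin 2)), Φ = fun x => s (x 1) • φ x + s (- x 1) • ψ x := ⟨_, rfl⟩
  have Φc : ContDiff ℝ 1 Φ := by
    have b1 : ContDiff ℝ 1 (fun x : (EuclideanSpace ℝ (Fin 2)) => s (x 1)) := sc.comp h1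
    have b2 : ContDiff ℝ 1 (fun x : (EuclideanSpace ℝ (Fin 2)) => s (- x 1)) := sc.comp h1.neg
    rw [hΦ]; exact (b1.smul hφ).add (b2.smul hψ)
  have Φs : HasCompactSupport Φ := by
    have a1 : HasCompactSupport (fun x : (EuclideanSpace ℝ (Fin 2)) => s (x 1) • φ x) :=
      hφs.mono fun x hx hx' => hx (by simp only [hx', smul_zero])
    have a2 : HasCompactSupport (fun x : (EuclideanSpace ℝ (Fin 2)) => s (- x 1) • ψ x) :=
      hψs.mono fun x hx hx' => hx (by simp only [hx', smul_zero])
    rw [hΦ]; exact a1.add a2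
  have up : ∀ x : (EuclideanSpace ℝ (Fin 2)), 0 < x 1 → Φ x = s (x 1) • φ x := by
    intro x hx; simp [hΦ, s0 (- x 1) (by linarith)]
  have dn : ∀ x : (EuclideanSpace ℝ (Fin 2)), x 1 ≤ 0 → Φ x = s (- x 1) • ψ x := by
    intro x hx; simp [hΦ, s0 (x 1) (by linarith)]
  have Φ1 : ∀ x, ‖Φ x‖ ≤ 1 := by
    intro x
    rcases lt_or_ge 0 (x 1) with h | h
    · rw [up x h, norm_smul, Real.norm_of_nonneg (sn _)]
      exact mul_le_one₀ (sl _) (norm_nonneg _) (hφ1 x)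
    · rw [dn x h, norm_smul, Real.norm_of_nonneg (sn _)]
      exact mul_le_one₀ (sl _) (norm_nonneg _) (hψ1 x)
  have d1 : Set.EqOn (vdiv Φ) (vdiv φ) (Rup ∩ E) := by
    rintro x ⟨hx, hxE⟩
    apply vdiv_congr
    have := hδE x (subset_closure hxE)
    rw [abs_of_pos hx.2.1] at this
    have hev : ∀ᶠ y : (EuclideanSpace ℝ (Fin 2)) in 𝓝 x, δ / 2 < y 1 :=
      h1.continuous.continuousAt.eventually (lt_mem_nhds (by linarith))
    filter_upwards [hev] with y hy
    rw [up y (by linarith), s1 _ hy.le, one_smul]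
  have d2 : Set.EqOn (vdiv Φ) (vdiv ψ) (Rdown ∩ E) := by
    rintro x ⟨hx, hxE⟩
    apply vdiv_congr
    have := hδE x (subset_closure hxE)
    rw [abs_of_neg hx.2.2] at this
    have hev : ∀ᶠ y : (EuclideanSpace ℝ (Fin 2)) in 𝓝 x, y 1 < - (δ / 2) :=
      h1.continuous.continuousAt.eventually (gt_mem_nhds (by linarith))
    filter_upwards [hev] with y hy
    rw [dn y (by linarith), s1 _ (by linarith), one_smul]
  have m1 : MeasurableSet (Rup ∩ E) := (meas_box _ _ _ _).inter hE
  have m2 : MeasurableSet (Rdown ∩ E) := (meas_box _ _ _ _).inter hE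
  have hEeq : E = (Rup ∩ E) ∪ (Rdown ∩ E) := by
    rw [← union_inter_distrib_right]
    exact (inter_eq_right.2 (subset_closure.trans hcc.2)).symm
  have hdisj : Disjoint (Rup ∩ E) (Rdown ∩ E) := by
    rw [Set.disjoint_left]
    rintro x ⟨hx, -⟩ ⟨hx', -⟩
    exact absurd hx.2.1 (not_lt.2 hx'.2.2.le)
  have hI := vdiv_integrable Φc Φs
  have : ∫ x in E, vdiv Φ x = (∫ x in Rup ∩ E, vdiv φ x) + ∫ x in Rdown ∩ E, vdiv ψ x := by
    conv_lhs => rw [hEeq]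
    rw [setIntegral_union hdisj m2 hI.integrableOn hI.integrableOn,
      setIntegral_congr_fun m1 d1, setIntegral_congr_fun m2 d2]
  rw [← this]
  exact le_perimeter Φc Φs Φ1

lemma tendsto_part {E : ℕ → Set (EuclideanSpace ℝ (Fin 2))} (hmeas : ∀ k, MeasurableSet (E k)) {A : Set (EuclideanSpace ℝ (Fin 2))}
    (hA : A ⊆ Rup ∪ Rdown)
    (hL1 : TendstoL1 E (Rup ∪ Rdown)) {f : (EuclideanSpace ℝ (Fin 2)) → ℝ} (hf : Integrable f) :
    Tendsto (fun k => ∫ x in A ∩ E k, f x) atTop (𝓝 (∫ x in A, f x)) := by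
  have h0 : Tendsto (fun k => volume (A \ E k)) atTop (𝓝 0) :=
    tendsto_of_tendsto_of_tendsto_of_le_of_le tendsto_const_nhds hL1 (fun k => zero_le)
      (fun k => measure_mono ((sdiff_subset_sdiff_left hA).trans subset_union_right))
  have h1 := hf.tendsto_setIntegral_nhds_zero h0
  have h2 : (fun k => ∫ x in A ∩ E k, f x) = fun k => (∫ x in A, f x) - ∫ x in A \ E k, f x := by
    funext k
    have := integral_inter_add_sdiff (s := A) (hmeas k) (hf.integrableOn (s := A))
    linarith
  rw [h2]
  simpa using tendsto_const_nhds.sub h1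

lemma liminf_part
    (E : ℕ → Set (EuclideanSpace ℝ (Fin 2)))
    (hmeas : ∀ k, MeasurableSet (E k))
    (hcc : ∀ k, CpctContained (E k) (Rup ∪ Rdown))
    (hL1 : TendstoL1 E (Rup ∪ Rdown)) :
    perimeter Rup + perimeter Rdown ≤ Filter.liminf (fun k => perimeter (E k)) atTop := by
  refine le_of_forall_lt fun r hr => ?_
  obtain ⟨a, ha, b, hb, hab⟩ := ENNReal.exists_lt_add_of_lt_add hr (by simp [Rup_per])
    (by simp [Rdown_per])
  obtain ⟨φ, hφ, hφs, hφ1, hφa⟩ := lt_perimeter ha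
  obtain ⟨ψ, hψ, hψs, hψ1, hψb⟩ := lt_perimeter hb
  refine hab.trans_le ?_
  have hA : 0 < ∫ x in Rup, vdiv φ x := ENNReal.ofReal_pos.1 (lt_of_le_of_lt zero_le hφa)
  have hB : 0 < ∫ x in Rdown, vdiv ψ x := ENNReal.ofReal_pos.1 (lt_of_le_of_lt zero_le hψb)
  refine (add_le_add hφa.le hψb.le).trans ?_
  rw [← ENNReal.ofReal_add hA.le hB.le]
  have ht : Tendsto (fun k => ENNReal.ofReal ((∫ x in Rup ∩ E k, vdiv φ x) +
      ∫ x in Rdown ∩ E k, vdiv ψ x)) atTop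
      (𝓝 (ENNReal.ofReal ((∫ x in Rup, vdiv φ x) + ∫ x in Rdown, vdiv ψ x))) :=
    ENNReal.tendsto_ofReal
      ((tendsto_part hmeas subset_union_left hL1 (vdiv_integrable hφ hφs)).add
       (tendsto_part hmeas subset_union_right hL1 (vdiv_integrable hψ hψs)))
  rw [← ht.liminf_eq]
  exact liminf_le_liminf (Eventually.of_forall fun k =>
    glue (hmeas k) (hcc k) hφ hφs hφ1 hψ hψs hψ1)

/-- For the slit rectangle `Ω = R₁ ∪ R₂ ⊆ ℝ²` and any measurable sets
`E k ⋐ Ω` with `E k → Ω` in `L¹`: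
`liminf_k P(E k) ≥ P(R₁) + P(R₂) = P(Ω) + 2 H¹(S) > P(Ω)`. -/
theorem slit_rectangle_example
    (E : ℕ → Set (EuclideanSpace ℝ (Fin 2)))
    (hmeas : ∀ k, MeasurableSet (E k))
    (hcc : ∀ k, CpctContained (E k) (Rup ∪ Rdown))
    (hL1 : TendstoL1 E (Rup ∪ Rdown)) :
    perimeter Rup + perimeter Rdown ≤ Filter.liminf (fun k => perimeter (E k)) atTop ∧
    perimeter Rup + perimeter Rdown =
      perimeter (Rup ∪ Rdown) + 2 * μH[(1 : ℝ)] slitS ∧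
    perimeter (Rup ∪ Rdown) < perimeter (Rup ∪ Rdown) + 2 * μH[(1 : ℝ)] slitS := by
  refine ⟨liminf_part E hmeas hcc hL1, ?_, ?_⟩
  · rw [Rup_per, Rdown_per, Omega_per, slit_meas]; norm_num
  · rw [Omega_per, slit_meas]; norm_num
end
end
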